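/- Let $a\in(-1,1)$, $\alpha>1$, let $\varphi(r)=(4\pi r)^{(n+a)/2}(1+x_0^2/r)^{a/2}$, and let $u\in\mathcal{H}_a$ satisfy $\mathscr{L}_a u\le 0$ in $\Omega_{\alpha^2 r}(\xi_0)$. Then there exists $C=C(n,\alpha,a)>0$ such that $u_{\alpha^2 r}(\xi_0)-u_{\alpha r}(\xi_0)\ \ge\ C\big(\varphi(\alpha r)^{-1}-\varphi(\alpha^2 r)^{-1}\big)\int_{\Omega_r(\xi_0)}(-\mathscr{L}_a u)\,dY\,dt$, where $u_\rho(\xi_0)=\varphi(\rho)^{-1}\int_{\Omega_\rho(\xi_0)}\frac{u\,|y|^a|\nabla_Y\Gamma(\xi_0;Y,t)|^2}{\Gamma(\xi_0;Y,t)^2}\,dY\,dt$. -/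

import Mathlib

noncomputable section
open Real MeasureTheory

/-- Partial derivative of `f : (Fin n → ℝ) → ℝ` in the `i`-th coordinate at `X`. -/
def pd {n : ℕ} (i : Fin n) (f : (Fin n → ℝ) → ℝ) (X : Fin n → ℝ) : ℝ :=
  deriv (fun s => f (Function.update X i s)) (X i)

/-- The Bessel-type profile `F(z)` with `ν = (a-1)/2`:
`F(z) = e^{-z/2} ( ∑_k (z/4)^{2k}/(k! Γ(k+ν+1)) + (z/4)|z/4|^{-a} ∑_k (z/4)^{2k}/(k! Γ(k-ν+1)) )`. -/
def Fker (a z : ℝ) : ℝ :=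
  Real.exp (-z / 2) *
    ((∑' k : ℕ, (z / 4) ^ (2 * k) / ((Nat.factorial k : ℝ) * Real.Gamma ((k : ℝ) + (a - 1) / 2 + 1))) +
      z / 4 * |z / 4| ^ (-a) *
        ∑' k : ℕ, (z / 4) ^ (2 * k) / ((Nat.factorial k : ℝ) * Real.Gamma ((k : ℝ) - (a - 1) / 2 + 1)))

/-- The one-dimensional degenerate heat kernel
`ũ(x,y,t) = (4t)^{-(a+1)/2} e^{-(x-y)²/(4t)} F(xy/t)`. -/
def utilde (a x y t : ℝ) : ℝ :=
  (4 * t) ^ (-(a + 1) / 2) * Real.exp (-(x - y) ^ 2 / (4 * t)) * Fker a (x * y / t)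
/-- The fundamental solution `Γ(X,t;Y,τ)` of the degenerate parabolic operator
`𝓛_a u = D_t(|y|^a u) - div_Y(|y|^a ∇_Y u)` in spatial dimension `n = m+1 ≥ 2`:
`Γ = C_{n,a} (t-τ)^{-(n+a)/2} e^{-|X-Y|²/(4(t-τ))} F(xy/(t-τ))` for `t > τ`, and `0` otherwise,
where `x, y` are the last coordinates of `X, Y` and `C_{n,a} = 2^{-1-a}(4π)^{-(n-1)/2}`. -/
def GammaFS (a : ℝ) (m : ℕ) (X : Fin (m + 1) → ℝ) (t : ℝ) (Y : Fin (m + 1) → ℝ) (τ : ℝ) : ℝ :=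
  if τ < t then
    2 ^ (-1 - a) * (4 * π) ^ (-(m : ℝ) / 2) * (t - τ) ^ (-((m : ℝ) + 1 + a) / 2) *
      Real.exp (-(∑ i, (X i - Y i) ^ 2) / (4 * (t - τ))) *
      Fker a (X (Fin.last m) * Y (Fin.last m) / (t - τ))
  else 0

/-- The class `𝓗_a`: continuous functions on `ℝⁿ × ℝ` that are `C²` away from the hyperplane
`{y = 0}` and whose weighted normal derivative `|y|^a D_y u` has matching one-sided limits
across `{y = 0}`. -/
def memHa (a : ℝ) (m : ℕ) (u : (Fin (m + 1) → ℝ) → ℝ → ℝ) : Prop :=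
  Continuous (fun p : (Fin (m + 1) → ℝ) × ℝ => u p.1 p.2) ∧
  (∀ (X : Fin (m + 1) → ℝ) (t : ℝ), X (Fin.last m) ≠ 0 →
    ContDiffAt ℝ 2 (fun p : (Fin (m + 1) → ℝ) × ℝ => u p.1 p.2) (X, t)) ∧
  (∀ (X : Fin (m + 1) → ℝ) (t : ℝ), ∃ L : ℝ,
    Filter.Tendsto
      (fun y => |y| ^ a * pd (Fin.last m) (fun Z => u Z t) (Function.update X (Fin.last m) y))
      (nhdsWithin 0 (Set.Ioi 0)) (nhds L) ∧
    Filter.Tendsto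
      (fun y => |y| ^ a * pd (Fin.last m) (fun Z => u Z t) (Function.update X (Fin.last m) y))
      (nhdsWithin 0 (Set.Iio 0)) (nhds L))

/-- `φ(r) = (4πr)^{(n+a)/2} (1 + x₀²/r)^{a/2}`, the normalizing factor of the parabolic ball. -/
def phiw (a : ℝ) (m : ℕ) (x₀ r : ℝ) : ℝ :=
  (4 * π * r) ^ (((m : ℝ) + 1 + a) / 2) * (1 + x₀ ^ 2 / r) ^ (a / 2)

/-- The `𝓛_a`-parabolic ball
`Ω_r(ξ₀) = {(Y,t) : Γ(ξ₀;Y,t) > (4πr)^{-(n+a)/2}(1+x₀²/r)^{-a/2}}`. -/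
def pball (a : ℝ) (m : ℕ) (X₀ : Fin (m + 1) → ℝ) (t₀ r : ℝ) :
    Set ((Fin (m + 1) → ℝ) × ℝ) :=
  {ζ | (phiw a m (X₀ (Fin.last m)) r)⁻¹ < GammaFS a m X₀ t₀ ζ.1 ζ.2}

/-- The mean value
`u_r(ξ₀) = φ(r)⁻¹ ∫_{Ω_r(ξ₀)} u |y|^a |∇_Y Γ(ξ₀;Y,t)|² / Γ(ξ₀;Y,t)² dY dt`. -/
def mval (a : ℝ) (m : ℕ) (u : (Fin (m + 1) → ℝ) → ℝ → ℝ) (X₀ : Fin (m + 1) → ℝ)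
    (t₀ r : ℝ) : ℝ :=
  (phiw a m (X₀ (Fin.last m)) r)⁻¹ *
    ∫ ζ in pball a m X₀ t₀ r,
      u ζ.1 ζ.2 * |ζ.1 (Fin.last m)| ^ a *
        (∑ i, (pd i (fun Y => GammaFS a m X₀ t₀ Y ζ.2) ζ.1) ^ 2) /
        (GammaFS a m X₀ t₀ ζ.1 ζ.2) ^ 2

/-- The classical expression of `𝓛_a u = D_t(|y|^a u) - div(|y|^a ∇ u)` away from `{y = 0}`:
`𝓛_a u = |y|^a (∂_t u - Δ_Y u - (a/y) ∂_y u)`. -/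
def Lau (a : ℝ) (m : ℕ) (u : (Fin (m + 1) → ℝ) → ℝ → ℝ)
    (X : Fin (m + 1) → ℝ) (t : ℝ) : ℝ :=
  |X (Fin.last m)| ^ a *
    (deriv (fun s => u X s) t - (∑ i, pd i (pd i (fun Z => u Z t)) X) -
      a / X (Fin.last m) * pd (Fin.last m) (fun Z => u Z t) X)

noncomputable section
open Real MeasureTheory

/-! ### Part 1: coordinates and integration by parts off the hyperplane -/

/-- Space-time with coordinates `((x, t), y)`. -/
abbrev FF (m : ℕ) := ((Fin m → ℝ) × ℝ) × ℝ

/-- Directional derivative. -/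
def dd {E : Type*} [NormedAddCommGroup E] [NormedSpace ℝ E] (d : E) (f : E → ℝ) (ζ : E) : ℝ :=
  fderiv ℝ f ζ d

def dI {m : ℕ} (i : Fin m) : FF m := ((Pi.single i 1, 0), 0)
def dT {m : ℕ} : FF m := ((0, 1), 0)
def dY {m : ℕ} : FF m := ((0, 0), 1)

def Lop (a : ℝ) {m : ℕ} (f : FF m → ℝ) (ζ : FF m) : ℝ :=
  |ζ.2| ^ a * (dd dT f ζ - (∑ i, dd (dI i) (dd (dI i) f) ζ) - dd dY (dd dY f) ζ - a / ζ.2 * dd dY f ζ)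

def Lst (a : ℝ) {m : ℕ} (f : FF m → ℝ) (ζ : FF m) : ℝ :=
  |ζ.2| ^ a * (dd dT f ζ + (∑ i, dd (dI i) (dd (dI i) f) ζ) + dd dY (dd dY f) ζ + a / ζ.2 * dd dY f ζ)

section ibp
variable {E : Type*} [NormedAddCommGroup E] [NormedSpace ℝ E]

lemma dd_contDiffAt {f : E → ℝ} {x : E} {n k : WithTop ℕ∞} (h : ContDiffAt ℝ n f x) (hk : k + 1 ≤ n) (d : E) :
    ContDiffAt ℝ k (dd d f) x := by
  have := h.fderiv_right hk
  exact this.clm_apply contDiffAt_const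

lemma dd_contDiff {f : E → ℝ} {n k : WithTop ℕ∞} (h : ContDiff ℝ n f) (hk : k + 1 ≤ n) (d : E) :
    ContDiff ℝ k (dd d f) :=
  contDiff_iff_contDiffAt.2 fun x => dd_contDiffAt h.contDiffAt hk d

lemma tsupport_dd {f : E → ℝ} (d : E) : tsupport (dd d f) ⊆ tsupport f :=
  tsupport_fderiv_apply_subset ℝ d

lemma dd_hcs {f : E → ℝ} (h : HasCompactSupport f) (d : E) : HasCompactSupport (dd d f) :=
  h.of_isClosed_subset (isClosed_tsupport _) (tsupport_dd d)

lemma cont_mul_tsupport {g h : E → ℝ} (hg : Continuous g) (hh : ∀ x ∈ tsupport g, ContinuousAt h x) :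
    Continuous (fun x => g x * h x) := by
  rw [continuous_iff_continuousAt]
  intro x
  by_cases hx : x ∈ tsupport g
  · exact hg.continuousAt.mul (hh x hx)
  · have : (fun x => g x * h x) =ᶠ[nhds x] fun _ => 0 := by
      filter_upwards [(isClosed_tsupport g).isOpen_compl.mem_nhds hx] with y hy
      rw [image_eq_zero_of_notMem_tsupport hy, zero_mul]
    exact this.continuousAt

variable [MeasurableSpace E] [BorelSpace E] [FiniteDimensional ℝ E] {μ : Measure E} [μ.IsAddHaarMeasure]

lemma int_mul_tsupport {g h : E → ℝ} (hg : Continuous g) (hc : HasCompactSupport g)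
    (hh : ∀ x ∈ tsupport g, ContinuousAt h x) : Integrable (fun x => g x * h x) μ :=
  (cont_mul_tsupport hg hh).integrable_of_hasCompactSupport hc.mul_right

lemma ibp1 {f g : E → ℝ} (hg : ContDiff ℝ 1 g) (hc : HasCompactSupport g)
    (hf : ∀ x ∈ tsupport g, ContDiffAt ℝ 1 f x) (d : E) :
    ∫ x, g x * dd d f x ∂μ = - ∫ x, dd d g x * f x ∂μ := by
  have hcd : Continuous (dd d g) := (dd_contDiff hg (k := 0) (by norm_num) d).continuous
  refine integral_mul_fderiv_eq_neg_fderiv_mul_of_integrable ?_ ?_ ?_ ?_ ?_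
  · exact int_mul_tsupport hcd (dd_hcs hc d) fun x hx => (hf x (tsupport_dd d hx)).continuousAt
  · exact int_mul_tsupport hg.continuous hc fun x hx =>
      (dd_contDiffAt (hf x hx) (k := 0) (by norm_num) d).continuousAt
  · exact int_mul_tsupport hg.continuous hc fun x hx => (hf x hx).continuousAt
  · exact fun x _ => (hg.differentiable (by norm_num)) x
  · exact fun x hx => (hf x hx).differentiableAt (by norm_num)

lemma ibp2 {f g : E → ℝ} (hg : ContDiff ℝ 2 g) (hc : HasCompactSupport g)
    (hf : ∀ x ∈ tsupport g, ContDiffAt ℝ 2 f x) (d : E) :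
    ∫ x, g x * dd d (dd d f) x ∂μ = ∫ x, dd d (dd d g) x * f x ∂μ := by
  rw [ibp1 (hg.of_le (by norm_num)) hc (fun x hx => dd_contDiffAt (hf x hx) (by norm_num) d) d,
    ibp1 (dd_contDiff hg (by norm_num) d) (dd_hcs hc d)
      (fun x hx => (hf x (tsupport_dd d hx)).of_le (by norm_num)) d, neg_neg]
end ibp

variable {m : ℕ}

instance instHaarQ : (volume : Measure ((Fin m → ℝ) × ℝ)).IsAddHaarMeasure :=
  MeasureTheory.Measure.prod.instIsAddHaarMeasure _ _

instance instHaarFF : (volume : Measure (FF m)).IsAddHaarMeasure :=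
  MeasureTheory.Measure.prod.instIsAddHaarMeasure (volume : Measure ((Fin m → ℝ) × ℝ)) (volume : Measure ℝ)

lemma contDiff_of_tsup {E : Type*} [NormedAddCommGroup E] [NormedSpace ℝ E] {f : E → ℝ} {n : WithTop ℕ∞}
    (h : ∀ x ∈ tsupport f, ContDiffAt ℝ n f x) : ContDiff ℝ n f := by
  rw [contDiff_iff_contDiffAt]
  intro x
  by_cases hx : x ∈ tsupport f
  · exact h x hx
  · exact (contDiffAt_const (c := (0:ℝ))).congr_of_eventuallyEq (notMem_tsupport_iff_eventuallyEq.1 hx)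

lemma cdAt_abs_rpow (b : ℝ) {ζ : FF m} (h : ζ.2 ≠ 0) {n : ℕ∞} :
    ContDiffAt ℝ n (fun ζ : FF m => |ζ.2| ^ b) ζ := by
  have h1 : ContDiffAt ℝ n (fun ζ : FF m => |ζ.2|) ζ := by
    have : ContDiffAt ℝ n (fun y : ℝ => |y|) ζ.2 := contDiffAt_abs h
    exact this.comp ζ contDiffAt_snd
  exact h1.rpow_const_of_ne (by simpa using h)

lemma dd_dY_eq {f : FF m → ℝ} {ζ : FF m} (h : DifferentiableAt ℝ f ζ) :
    HasDerivAt (fun y => f (ζ.1, y)) (dd dY f ζ) ζ.2 := by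
  have h1 : HasDerivAt (fun y : ℝ => ((ζ.1, y) : FF m)) dY ζ.2 := by
    have := (hasDerivAt_const ζ.2 ζ.1).prodMk (hasDerivAt_id ζ.2)
    exact this
  exact HasFDerivAt.comp_hasDerivAt (f := fun y : ℝ => ((ζ.1, y) : FF m)) ζ.2
    (show HasFDerivAt f (fderiv ℝ f ζ) (ζ.1, ζ.2) from h.hasFDerivAt) h1

lemma dd_mul {E : Type*} [NormedAddCommGroup E] [NormedSpace ℝ E] {f g : E → ℝ} {x : E} (d : E)
    (hf : DifferentiableAt ℝ f x) (hg : DifferentiableAt ℝ g x) :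
    dd d (fun x => f x * g x) x = f x * dd d g x + g x * dd d f x := by
  unfold dd
  rw [show (fun x => f x * g x) = f * g from rfl, fderiv_mul hf hg]
  simp

lemma dd_add {E : Type*} [NormedAddCommGroup E] [NormedSpace ℝ E] {f g : E → ℝ} {x : E} (d : E)
    (hf : DifferentiableAt ℝ f x) (hg : DifferentiableAt ℝ g x) :
    dd d (fun x => f x + g x) x = dd d f x + dd d g x := by
  unfold dd
  rw [show (fun x => f x + g x) = f + g from rfl, fderiv_add hf hg]
  simp

lemma dd_congr {E : Type*} [NormedAddCommGroup E] [NormedSpace ℝ E] {f g : E → ℝ} {x : E} (d : E)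
    (h : f =ᶠ[nhds x] g) : dd d f x = dd d g x := by
  unfold dd; rw [h.fderiv_eq]

lemma hasDerivAt_absrpow (b : ℝ) {y : ℝ} (h : y ≠ 0) :
    HasDerivAt (fun y : ℝ => |y| ^ b) (b / y * |y| ^ b) y := by
  have h1 : HasDerivAt (fun y : ℝ => |y|) (SignType.sign y : ℝ) y := hasDerivAt_abs h
  have h2 := h1.rpow_const (p := b) (Or.inl (by simpa using h))
  convert h2 using 1
  rw [Real.rpow_sub_one (by simpa using h)]
  rcases lt_or_gt_of_ne h with h | h
  · simp [abs_of_neg h, sign_neg h]; field_simp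
  · simp [abs_of_pos h, sign_pos h]; field_simp

lemma dd_dir_fun {g : ℝ → ℝ} {ζ : FF m} (hg : DifferentiableAt ℝ g ζ.2) (d : FF m) :
    dd d (fun ζ : FF m => g ζ.2) ζ = deriv g ζ.2 * d.2 := by
  unfold dd
  have h1 : HasFDerivAt (fun ζ : FF m => ζ.2) (ContinuousLinearMap.snd ℝ _ ℝ) ζ := hasFDerivAt_snd
  have := hg.hasDerivAt.hasFDerivAt.comp ζ h1
  have h2 := this.fderiv
  rw [show (fun ζ : FF m => g ζ.2) = g ∘ fun ζ : FF m => ζ.2 from rfl, h2]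
  simp [mul_comm]

lemma dd_abs_rpow (b : ℝ) {ζ : FF m} (h : ζ.2 ≠ 0) (d : FF m) :
    dd d (fun ζ : FF m => |ζ.2| ^ b) ζ = b / ζ.2 * |ζ.2| ^ b * d.2 := by
  have := hasDerivAt_absrpow b h
  rw [dd_dir_fun this.differentiableAt, this.deriv]

lemma ne_nhds {ζ : FF m} (h : ζ.2 ≠ 0) : ∀ᶠ x in nhds ζ, x.2 ≠ 0 :=
  (continuous_snd.continuousAt (x := ζ)).eventually_ne h

lemma ibp_off (a : ℝ) {f Ψ : FF m → ℝ} (hΨ : ContDiff ℝ 2 Ψ) (hc : HasCompactSupport Ψ)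
    (hoff : ∀ ζ ∈ tsupport Ψ, ζ.2 ≠ 0) (hf : ∀ ζ ∈ tsupport Ψ, ContDiffAt ℝ 2 f ζ) :
    Integrable (fun ζ => Ψ ζ * Lop a f ζ) ∧ Integrable (fun ζ => f ζ * Lst a Ψ ζ) ∧
    ∫ ζ, Ψ ζ * (-Lop a f ζ) = ∫ ζ, f ζ * Lst a Ψ ζ := by
  set g : FF m → ℝ := fun ζ => |ζ.2| ^ a * Ψ ζ with hgdef
  set k : FF m → ℝ := fun ζ => a / ζ.2 * (|ζ.2| ^ a * Ψ ζ) with hkdef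
  have sg : tsupport g ⊆ tsupport Ψ := tsupport_mul_subset_right
  have sk : tsupport k ⊆ tsupport Ψ := (tsupport_mul_subset_right).trans sg
  have hg : ContDiff ℝ 2 g := contDiff_of_tsup fun x hx =>
    (cdAt_abs_rpow a (hoff x (sg hx)) (n := 2)).mul hΨ.contDiffAt
  have hk : ContDiff ℝ 2 k := contDiff_of_tsup fun x hx =>
    (contDiffAt_const.div contDiffAt_snd (hoff x (sk hx))).mul hg.contDiffAt
  have cg : HasCompactSupport g := hc.mul_left
  have ck : HasCompactSupport k := cg.mul_left
  have hfg : ∀ ζ ∈ tsupport g, ContDiffAt ℝ 2 f ζ := fun ζ h => hf ζ (sg h)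
  have hfk : ∀ ζ ∈ tsupport k, ContDiffAt ℝ 2 f ζ := fun ζ h => hf ζ (sk h)
  have eT := ibp1 (μ := (volume : Measure (FF m))) (hg.of_le (by norm_num)) cg
    (fun x hx => (hfg x hx).of_le (by norm_num)) dT
  have eI := fun i => ibp2 (μ := (volume : Measure (FF m))) hg cg hfg (dI i)
  have eY := ibp2 (μ := (volume : Measure (FF m))) hg cg hfg dY
  have eK := ibp1 (μ := (volume : Measure (FF m))) (hk.of_le (by norm_num)) ck
    (fun x hx => (hfk x hx).of_le (by norm_num)) dY
  -- integrability
  have iT : Integrable fun x => g x * dd dT f x := int_mul_tsupport hg.continuous cg fun x hx =>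
      (dd_contDiffAt (hfg x hx) (k := 1) (by norm_num) _).continuousAt
  have iI : ∀ i, Integrable fun x => g x * dd (dI i) (dd (dI i) f) x := fun i =>
    int_mul_tsupport hg.continuous cg fun x hx =>
      (dd_contDiffAt (dd_contDiffAt (hfg x hx) (k := 1) (by norm_num) _) (k := 0) (by norm_num) _).continuousAt
  have iY : Integrable fun x => g x * dd dY (dd dY f) x := int_mul_tsupport hg.continuous cg fun x hx =>
      (dd_contDiffAt (dd_contDiffAt (hfg x hx) (k := 1) (by norm_num) _) (k := 0) (by norm_num) _).continuousAt
  have iK : Integrable fun x => k x * dd dY f x := int_mul_tsupport hk.continuous ck fun x hx =>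
      (dd_contDiffAt (hfk x hx) (k := 1) (by norm_num) _).continuousAt
  have jT : Integrable fun x => dd dT g x * f x :=
    int_mul_tsupport (dd_contDiff hg (k := 1) (by norm_num) _).continuous (dd_hcs cg _)
      fun x hx => (hfg x (tsupport_dd _ hx)).continuousAt
  have jK : Integrable fun x => dd dY k x * f x :=
    int_mul_tsupport (dd_contDiff hk (k := 1) (by norm_num) _).continuous (dd_hcs ck _)
      fun x hx => (hfk x (tsupport_dd _ hx)).continuousAt
  have jD : ∀ d, Integrable fun x => dd d (dd d g) x * f x := fun d =>
    int_mul_tsupport (dd_contDiff (dd_contDiff hg (k := 1) (by norm_num) d) (k := 0) (by norm_num) d).continuous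
      (dd_hcs (dd_hcs cg _) _)
      fun x hx => (hfg x (tsupport_dd _ (tsupport_dd _ hx))).continuousAt
  have e1 : (fun ζ => Ψ ζ * Lop a f ζ) = fun ζ => g ζ * dd dT f ζ - (∑ i, g ζ * dd (dI i) (dd (dI i) f) ζ)
      - g ζ * dd dY (dd dY f) ζ - k ζ * dd dY f ζ := by
    funext ζ; simp only [Lop, hgdef, hkdef, ← Finset.mul_sum]; ring
  have e2 : (fun ζ => f ζ * Lst a Ψ ζ) = fun ζ => dd dT g ζ * f ζ + (∑ i, dd (dI i) (dd (dI i) g) ζ * f ζ)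
      + dd dY (dd dY g) ζ * f ζ - dd dY k ζ * f ζ := by
    funext ζ
    by_cases hζ : ζ ∈ tsupport Ψ
    · have hy := hoff ζ hζ
      have hdΨ : ∀ x, DifferentiableAt ℝ Ψ x := fun x => hΨ.differentiable (by norm_num) x
      have f1 : ∀ x : FF m, x.2 ≠ 0 → ∀ d, dd d g x = |x.2| ^ a * dd d Ψ x + Ψ x * (a / x.2 * |x.2| ^ a * d.2) := by
        intro x hx d
        rw [hgdef, dd_mul d ((cdAt_abs_rpow a hx (n := 1)).differentiableAt (by norm_num)) (hdΨ x), dd_abs_rpow a hx]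
      have f2 : ∀ i, dd (dI i) (dd (dI i) g) ζ = |ζ.2| ^ a * dd (dI i) (dd (dI i) Ψ) ζ := by
        intro i
        have : dd (dI i) g =ᶠ[nhds ζ] fun x => |x.2| ^ a * dd (dI i) Ψ x := by
          filter_upwards [ne_nhds hy] with x hx
          rw [f1 x hx]; simp [dI]
        rw [dd_congr _ this, dd_mul _ ((cdAt_abs_rpow a hy (n := 1)).differentiableAt (by norm_num))
          ((dd_contDiff hΨ (k := 1) (by norm_num) _).differentiable (by norm_num) ζ), dd_abs_rpow a hy]
        simp [dI]
      have f3 : dd dY (dd dY g) ζ - dd dY k ζ = |ζ.2| ^ a * (dd dY (dd dY Ψ) ζ + a / ζ.2 * dd dY Ψ ζ) := by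
        have h1 : dd dY g =ᶠ[nhds ζ] fun x => |x.2| ^ a * dd dY Ψ x + k x := by
          filter_upwards [ne_nhds hy] with x hx
          rw [f1 x hx]; simp [dY, hkdef]; ring
        have h2 : DifferentiableAt ℝ (fun x : FF m => |x.2| ^ a * dd dY Ψ x) ζ :=
          ((cdAt_abs_rpow a hy (n := 1)).differentiableAt (by norm_num)).mul
          ((dd_contDiff hΨ (k := 1) (by norm_num) _).differentiable (by norm_num) ζ)
        rw [dd_congr _ h1]
        have h3 : dd dY (fun x => |x.2| ^ a * dd dY Ψ x + k x) ζ
            = dd dY (fun x => |x.2| ^ a * dd dY Ψ x) ζ + dd dY k ζ := by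
          exact dd_add dY h2 (hk.differentiable (by norm_num) ζ)
        rw [h3, dd_mul _ ((cdAt_abs_rpow a hy (n := 1)).differentiableAt (by norm_num))
          ((dd_contDiff hΨ (k := 1) (by norm_num) _).differentiable (by norm_num) ζ), dd_abs_rpow a hy]
        simp [dY]; ring
      have f4 : dd dT g ζ = |ζ.2| ^ a * dd dT Ψ ζ := by rw [f1 ζ hy]; simp [dT]
      rw [f4]
      simp only [f2, Lst]
      rw [add_sub_assoc, ← sub_mul, f3, ← Finset.sum_mul, ← Finset.mul_sum]
      ring
    · have z : ∀ (d : FF m) (h : FF m → ℝ), ζ ∉ tsupport h → dd d h ζ = 0 := fun d h hh =>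
        image_eq_zero_of_notMem_tsupport fun h' => hh (tsupport_dd d h')
      have zg : ζ ∉ tsupport g := fun h => hζ (sg h)
      have zk : ζ ∉ tsupport k := fun h => hζ (sk h)
      have zz : ∀ (d : FF m) (h : FF m → ℝ), ζ ∉ tsupport h → dd d (dd d h) ζ = 0 := fun d h hh =>
        z d _ fun h' => hh (tsupport_dd d h')
      simp [Lst, z _ _ hζ, z _ _ zg, z _ _ zk, zz _ _ hζ, zz _ _ zg]
  have hsum : Integrable fun ζ => ∑ i, g ζ * dd (dI i) (dd (dI i) f) ζ :=
    integrable_finsetSum _ fun i _ => iI i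
  have hsum2 : Integrable fun ζ => ∑ i, dd (dI i) (dd (dI i) g) ζ * f ζ :=
    integrable_finsetSum _ fun i _ => jD _
  have a1 : Integrable fun ζ => g ζ * dd dT f ζ - (∑ i, g ζ * dd (dI i) (dd (dI i) f) ζ) := iT.sub hsum
  have a2 : Integrable fun ζ => g ζ * dd dT f ζ - (∑ i, g ζ * dd (dI i) (dd (dI i) f) ζ)
      - g ζ * dd dY (dd dY f) ζ := a1.sub iY
  have b1 : Integrable fun ζ => dd dT g ζ * f ζ + (∑ i, dd (dI i) (dd (dI i) g) ζ * f ζ) := jT.add hsum2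
  have b2 : Integrable fun ζ => dd dT g ζ * f ζ + (∑ i, dd (dI i) (dd (dI i) g) ζ * f ζ)
      + dd dY (dd dY g) ζ * f ζ := b1.add (jD _)
  refine ⟨?_, ?_, ?_⟩
  · rw [e1]; exact a2.sub iK
  · rw [e2]; exact b2.sub jK
  · simp only [mul_neg, integral_neg]
    rw [e2, e1, integral_sub a2 iK, integral_sub a1 iY, integral_sub iT hsum,
      integral_sub b2 jK, integral_add b1 (jD _), integral_add jT hsum2,
      integral_finsetSum _ fun i _ => iI i, integral_finsetSum _ fun i _ => jD _, eT, eY, eK,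
      Finset.sum_congr rfl fun i _ => eI i]
    ring
end

set_option linter.all false
noncomputable section
open Real MeasureTheory

/-! ### Part 2: one-dimensional lemmas and the maximum principle -/

lemma locmax_second {g g1 : ℝ → ℝ} {x c : ℝ} (h : IsLocalMax g x)
    (h1 : ∀ᶠ y in nhds x, HasDerivAt g (g1 y) y) (h2 : HasDerivAt g1 c x) : c ≤ 0 := by
  by_contra hc
  push Not at hc
  have e : deriv g =ᶠ[nhds x] g1 := h1.mono fun y hy => hy.deriv
  have hdd : deriv (deriv g) x = c := by rw [e.deriv_eq, h2.deriv]
  have hmin : IsLocalMin g x := isLocalMin_of_deriv_deriv_pos (by rw [hdd]; exact hc)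
    h.deriv_eq_zero h1.self_of_nhds.continuousAt
  have hconst : g =ᶠ[nhds x] fun _ => g x := by
    filter_upwards [h, hmin] with y a b using le_antisymm a b
  have e1 : deriv g =ᶠ[nhds x] fun _ => 0 := by
    filter_upwards [hconst.eventuallyEq_nhds] with y hy
    rw [hy.deriv_eq]; simp
  have : deriv (deriv g) x = 0 := by rw [e1.deriv_eq]; simp
  linarith

/-- one-dimensional maximum principle -/
lemma max1 {h h1 h2 : ℝ → ℝ} {a y1 : ℝ} (hy1 : 0 < y1) (hc : ContinuousOn h (Set.Icc 0 y1))
    (d1 : ∀ y ∈ Set.Ioo 0 y1, HasDerivAt h (h1 y) y) (d2 : ∀ y ∈ Set.Ioo 0 y1, HasDerivAt h1 (h2 y) y)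
    (hp : ∀ y ∈ Set.Ioo 0 y1, 0 < h2 y + a / y * h1 y) (h0 : h 0 ≤ 0) (h01 : h y1 ≤ 0) :
    ∀ y ∈ Set.Icc 0 y1, h y ≤ 0 := by
  obtain ⟨x, hx, hmax⟩ := isCompact_Icc.exists_isMaxOn (Set.nonempty_Icc.2 hy1.le) hc
  intro y hy
  refine (hmax hy).trans ?_
  rcases eq_or_lt_of_le hx.1 with e | e
  · rw [← e]; exact h0
  rcases eq_or_lt_of_le hx.2 with e' | e'
  · rw [e']; exact h01
  exfalso
  have hxx : x ∈ Set.Ioo 0 y1 := ⟨e, e'⟩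
  have hloc : IsLocalMax h x := hmax.isLocalMax (Icc_mem_nhds e e')
  have z1 : h1 x = 0 := hloc.hasDerivAt_eq_zero (d1 x hxx)
  have z2 := locmax_second hloc (Filter.eventually_of_mem (Ioo_mem_nhds e e') d1) (d2 x hxx)
  have := hp x hxx
  rw [z1] at this
  linarith

/-- `D` has derivative `o(y^{-a})` on the right, so `D = o(y^{1-a})` -/
lemma flux_small {D D1 : ℝ → ℝ} {a : ℝ} (ha : a < 1) (hc : ContinuousOn D (Set.Ici 0)) (h0 : D 0 = 0)
    (hd : ∀ y, 0 < y → HasDerivAt D (D1 y) y)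
    (hl : Filter.Tendsto (fun y => y ^ a * D1 y) (nhdsWithin 0 (Set.Ioi 0)) (nhds 0)) (ε : ℝ) (hε : 0 < ε) :
    ∀ᶠ y in nhdsWithin 0 (Set.Ioi 0), |D y| ≤ ε * y ^ (1 - a) := by
  have h1a : 0 < 1 - a := by linarith
  have hev := (Metric.tendsto_nhds.1 hl) (ε * (1 - a)) (by positivity)
  obtain ⟨δ, hδ, hsub⟩ := mem_nhdsGT_iff_exists_Ioo_subset.1 hev
  have hδ : 0 < δ := hδ
  have key : ∀ s : ℝ, |s| = 1 → ∀ y ∈ Set.Ioo 0 δ, 0 ≤ ε * y ^ (1 - a) + s * D y := by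
    intro s hs y hy
    have hmono : MonotoneOn (fun y => ε * y ^ (1 - a) + s * D y) (Set.Icc 0 y) := by
      apply monotoneOn_of_deriv_nonneg (convex_Icc 0 y)
      · refine ContinuousOn.add (continuousOn_const.mul ?_) (continuousOn_const.mul (hc.mono fun z hz => hz.1))
        exact (Real.continuous_rpow_const h1a.le).continuousOn
      · intro z hz
        rw [interior_Icc] at hz
        exact (((Real.hasDerivAt_rpow_const (Or.inl hz.1.ne')).const_mul ε).add
          ((hd z hz.1).const_mul s)).differentiableAt.differentiableWithinAt
      · intro z hz
        rw [interior_Icc] at hz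
        have hz0 : 0 < z := hz.1
        have hder : HasDerivAt (fun y => ε * y ^ (1 - a) + s * D y) (ε * ((1 - a) * z ^ (1 - a - 1)) + s * D1 z) z :=
          ((Real.hasDerivAt_rpow_const (p := 1 - a) (Or.inl hz.1.ne')).const_mul ε).add
          ((hd z hz.1).const_mul s)
        rw [hder.deriv]
        have hb : dist (z ^ a * D1 z) 0 < ε * (1 - a) := hsub ⟨hz.1, hz.2.trans hy.2⟩
        rw [dist_zero_right, Real.norm_eq_abs] at hb
        have hz' : z ^ (1 - a - 1) * z ^ a = 1 := by
          rw [← Real.rpow_add hz0]; simp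
        have hza : 0 < z ^ a := Real.rpow_pos_of_pos hz0 a
        have hb2 : |s * (z ^ a * D1 z)| < ε * (1 - a) := by rw [abs_mul, hs, one_mul]; exact hb
        have := (abs_lt.1 hb2).1
        have e : ε * ((1 - a) * z ^ (1 - a - 1)) + s * D1 z
            = z ^ (1 - a - 1) * (ε * (1 - a) + s * (z ^ a * D1 z)) := by
          linear_combination (- s * D1 z) * hz'
        rw [e]
        have := Real.rpow_pos_of_pos hz0 (1 - a - 1)
        nlinarith
    have := hmono (Set.left_mem_Icc.2 hy.1.le) (Set.right_mem_Icc.2 hy.1.le) hy.1.le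
    simp only [h0, Real.zero_rpow h1a.ne', mul_zero, add_zero] at this
    exact this
  filter_upwards [Ioo_mem_nhdsGT hδ] with y hy
  have k1 := key 1 (by norm_num) y hy
  have k2 := key (-1) (by norm_num) y hy
  rw [abs_le]; constructor <;> linarith

variable {m : ℕ}

/-- smallness of the symmetric second difference at the plane -/
def symSmall (a : ℝ) (f : FF m → ℝ) (q : (Fin m → ℝ) × ℝ) : Prop :=
  ∀ ε > 0, ∀ᶠ y in nhdsWithin (0:ℝ) (Set.Ioi 0), |f (q, y) + f (q, -y) - 2 * f (q, 0)| ≤ ε * y ^ (1 - a)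

lemma symSmall_of_flux {a : ℝ} (ha : a < 1) {v : FF m → ℝ} (hv : Continuous v)
    (hv2 : ∀ ζ : FF m, ζ.2 ≠ 0 → DifferentiableAt ℝ v ζ) (q : (Fin m → ℝ) × ℝ) (L : ℝ)
    (h1 : Filter.Tendsto (fun y => |y| ^ a * dd dY v (q, y)) (nhdsWithin 0 (Set.Ioi 0)) (nhds L))
    (h2 : Filter.Tendsto (fun y => |y| ^ a * dd dY v (q, y)) (nhdsWithin 0 (Set.Iio 0)) (nhds L)) :
    symSmall a v q := by
  intro ε hε
  refine flux_small (D := fun y => v (q, y) + v (q, -y) - 2 * v (q, 0))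
    (D1 := fun y => dd dY v (q, y) - dd dY v (q, -y)) ha ?_ (by simp; ring) ?_ ?_ ε hε
  · exact Continuous.continuousOn (by fun_prop)
  · intro y hy
    have d1 := dd_dY_eq (hv2 (q, y) hy.ne')
    have d2 := dd_dY_eq (hv2 (q, -y) (by simpa using hy.ne'))
    have d3 := d2.scomp y (hasDerivAt_neg y)
    have := (d1.add d3).sub_const (2 * v (q, 0))
    have e : dd dY v (q, y) - dd dY v (q, -y) = dd dY v (q, y) + (-1 : ℝ) • dd dY v (q, -y) := by
      rw [smul_eq_mul]; ring
    rw [e]; exact this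
  · have hneg : Filter.Tendsto (fun y : ℝ => -y) (nhdsWithin 0 (Set.Ioi 0)) (nhdsWithin 0 (Set.Iio 0)) := by
      have := tendsto_neg_nhdsGT (a := (0:ℝ))
      simpa using this
    have := h1.sub (h2.comp hneg)
    rw [sub_self] at this
    refine this.congr' ?_
    filter_upwards [self_mem_nhdsWithin] with y hy
    simp only [Function.comp, abs_neg, abs_of_pos (show (0:ℝ) < y from hy)]
    ring

lemma dd_sub {E : Type*} [NormedAddCommGroup E] [NormedSpace ℝ E] {f g : E → ℝ} {x : E} (d : E)
    (hf : DifferentiableAt ℝ f x) (hg : DifferentiableAt ℝ g x) :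
    dd d (fun x => f x - g x) x = dd d f x - dd d g x := by
  unfold dd
  rw [show (fun x => f x - g x) = f - g from rfl, fderiv_sub hf hg]
  simp

lemma dd_const_mul {E : Type*} [NormedAddCommGroup E] [NormedSpace ℝ E] {f : E → ℝ} {x : E} (d : E) (c : ℝ)
    (hf : DifferentiableAt ℝ f x) :
    dd d (fun x => c * f x) x = c * dd d f x := by
  unfold dd
  rw [fderiv_const_mul hf]; simp

section
variable {E : Type*} [NormedAddCommGroup E] [NormedSpace ℝ E]
lemma cdAt_ev {f : E → ℝ} {x : E} (h : ContDiffAt ℝ 2 f x) : ∀ᶠ y in nhds x, ContDiffAt ℝ 2 f y :=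
  h.eventually (by simp)
lemma cdAt_da {f : E → ℝ} {x : E} (h : ContDiffAt ℝ 2 f x) : DifferentiableAt ℝ f x :=
  h.differentiableAt (by norm_num)
lemma cdAt_dda {f : E → ℝ} {x : E} (h : ContDiffAt ℝ 2 f x) (d : E) : DifferentiableAt ℝ (dd d f) x :=
  (dd_contDiffAt h (k := 1) (by norm_num) d).differentiableAt (by norm_num)
lemma dd2_add {f g : E → ℝ} {x : E} (d : E) (hf : ContDiffAt ℝ 2 f x) (hg : ContDiffAt ℝ 2 g x) :
    dd d (dd d (fun x => f x + g x)) x = dd d (dd d f) x + dd d (dd d g) x := by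
  rw [← dd_add d (cdAt_dda hf d) (cdAt_dda hg d)]
  apply dd_congr
  filter_upwards [cdAt_ev hf, cdAt_ev hg] with y a b using dd_add d (cdAt_da a) (cdAt_da b)
lemma dd2_sub {f g : E → ℝ} {x : E} (d : E) (hf : ContDiffAt ℝ 2 f x) (hg : ContDiffAt ℝ 2 g x) :
    dd d (dd d (fun x => f x - g x)) x = dd d (dd d f) x - dd d (dd d g) x := by
  rw [← dd_sub d (cdAt_dda hf d) (cdAt_dda hg d)]
  apply dd_congr
  filter_upwards [cdAt_ev hf, cdAt_ev hg] with y a b using dd_sub d (cdAt_da a) (cdAt_da b)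
lemma dd2_const_mul {f : E → ℝ} {x : E} (d : E) (c : ℝ) (hf : ContDiffAt ℝ 2 f x) :
    dd d (dd d (fun x => c * f x)) x = c * dd d (dd d f) x := by
  rw [← dd_const_mul d c (cdAt_dda hf d)]
  apply dd_congr
  filter_upwards [cdAt_ev hf] with y a using dd_const_mul d c (cdAt_da a)

lemma hasDerivAt_line {f : E → ℝ} {x d : E} {s : ℝ} (h : DifferentiableAt ℝ f (x + s • d)) :
    HasDerivAt (fun s : ℝ => f (x + s • d)) (dd d f (x + s • d)) s := by
  have h1 : HasDerivAt (fun s : ℝ => x + s • d) d s := by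
    simpa using ((hasDerivAt_id s).smul_const d).const_add x
  exact h.hasFDerivAt.comp_hasDerivAt s h1

lemma locmax_dd {f : E → ℝ} {x : E} (d : E) (h : IsLocalMax f x) (hf : ContDiffAt ℝ 2 f x) :
    dd d f x = 0 ∧ dd d (dd d f) x ≤ 0 := by
  constructor
  · unfold dd; rw [h.fderiv_eq_zero]; rfl
  · have hc : Filter.Tendsto (fun s : ℝ => x + s • d) (nhds 0) (nhds x) := by
      have : Continuous (fun s : ℝ => x + s • d) := by fun_prop
      simpa using this.tendsto 0
    have hl : IsLocalMax (fun s : ℝ => f (x + s • d)) 0 := by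
      have := hc.eventually h
      filter_upwards [this] with s hs
      simpa using hs
    refine locmax_second hl (g1 := fun s => dd d f (x + s • d)) ?_ ?_
    · filter_upwards [hc.eventually (cdAt_ev hf)] with s hs using hasDerivAt_line (cdAt_da hs)
    · have := hasDerivAt_line (f := dd d f) (x := x) (d := d) (s := 0) (by simpa using cdAt_dda hf d)
      simpa using this
end

lemma Lop_sub (a : ℝ) {f g : FF m → ℝ} {ζ : FF m} (hf : ContDiffAt ℝ 2 f ζ) (hg : ContDiffAt ℝ 2 g ζ) :
    Lop a (fun x => f x - g x) ζ = Lop a f ζ - Lop a g ζ := by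
  simp only [Lop, dd_sub _ (cdAt_da hf) (cdAt_da hg), dd2_sub _ hf hg, Finset.sum_sub_distrib]; ring
lemma Lop_add (a : ℝ) {f g : FF m → ℝ} {ζ : FF m} (hf : ContDiffAt ℝ 2 f ζ) (hg : ContDiffAt ℝ 2 g ζ) :
    Lop a (fun x => f x + g x) ζ = Lop a f ζ + Lop a g ζ := by
  simp only [Lop, dd_add _ (cdAt_da hf) (cdAt_da hg), dd2_add _ hf hg, Finset.sum_add_distrib]; ring
lemma Lop_const_mul (a c : ℝ) {f : FF m → ℝ} {ζ : FF m} (hf : ContDiffAt ℝ 2 f ζ) :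
    Lop a (fun x => c * f x) ζ = c * Lop a f ζ := by
  simp only [Lop, dd_const_mul _ _ (cdAt_da hf), dd2_const_mul _ _ hf, ← Finset.mul_sum]; ring

lemma no_locmax {a : ℝ} {f φ : FF m → ℝ} {ζ : FF m}
    (hf : ζ.2 ≠ 0 → ContDiffAt ℝ 2 f ζ) (hφ : ζ.2 ≠ 0 → ContDiffAt ℝ 2 φ ζ)
    (hL : ζ.2 ≠ 0 → Lop a f ζ ≤ 0) (hLφ : ζ.2 ≠ 0 → 0 < Lop a φ ζ)
    (hs : symSmall a f ζ.1) {κ : ℝ} (hκ : 0 < κ)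
    (hw : ∀ y, 0 < y → φ (ζ.1, y) + φ (ζ.1, -y) - 2 * φ (ζ.1, 0) ≤ - κ * y ^ (1 - a)) :
    ¬ IsLocalMax (fun x => f x - φ x) ζ := by
  intro h
  by_cases h0 : ζ.2 = 0
  · obtain ⟨q, y⟩ := ζ
    simp only at h0 hs hw
    subst h0
    have c1 : Filter.Tendsto (fun y : ℝ => ((q, y) : FF m)) (nhdsWithin 0 (Set.Ioi 0)) (nhds (q, 0)) := by
      have : Continuous (fun y : ℝ => ((q, y) : FF m)) := by fun_prop
      exact (this.tendsto 0).mono_left nhdsWithin_le_nhds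
    have c2 : Filter.Tendsto (fun y : ℝ => ((q, -y) : FF m)) (nhdsWithin 0 (Set.Ioi 0)) (nhds (q, 0)) := by
      have : Continuous (fun y : ℝ => ((q, -y) : FF m)) := by fun_prop
      simpa using (this.tendsto 0).mono_left nhdsWithin_le_nhds
    have := ((c1.eventually h).and (c2.eventually h)).and ((hs (κ/2) (by positivity)).and self_mem_nhdsWithin)
    obtain ⟨y, ⟨e1, e2⟩, e3, e4⟩ := this.exists
    have e4 : 0 < y := e4
    have := hw y e4
    have := (abs_le.1 e3).1
    have := Real.rpow_pos_of_pos e4 (1 - a)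
    nlinarith
  · have hc := (hf h0).sub (hφ h0)
    have hT := (locmax_dd dT h hc).1
    have hY := locmax_dd dY h hc
    have hI := fun i => (locmax_dd (dI i) h hc).2
    have e := Lop_sub a (hf h0) (hφ h0)
    have : 0 ≤ Lop a (fun x => f x - φ x) ζ := by
      unfold Lop
      refine mul_nonneg (by positivity) ?_
      have hT : dd dT (fun x => f x - φ x) ζ = 0 := hT
      have hY1 : dd dY (fun x => f x - φ x) ζ = 0 := hY.1
      have hY2 : dd dY (dd dY (fun x => f x - φ x)) ζ ≤ 0 := hY.2
      have hI : ∑ i, dd (dI i) (dd (dI i) (fun x => f x - φ x)) ζ ≤ 0 := Finset.sum_nonpos fun i _ => hI i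
      rw [hT, hY1]; linarith
    have := hL h0
    have := hLφ h0
    linarith
end

set_option linter.all false
noncomputable section
open Real MeasureTheory
variable {m : ℕ}

/-! ### Part 3: averaging in the tangential variables -/

abbrev QQ (m : ℕ) := (Fin m → ℝ) × ℝ

def eI {m : ℕ} (i : Fin m) : QQ m := (Pi.single i 1, 0)
def eT {m : ℕ} : QQ m := (0, 1)

/-- tangential adjoint heat operator -/
def Hq (η : QQ m → ℝ) (q : QQ m) : ℝ := dd eT η q + ∑ i, dd (eI i) (dd (eI i) η) q

lemma dd_slice {f : FF m → ℝ} {q : QQ m} {y : ℝ} (h : DifferentiableAt ℝ f (q, y)) (d : QQ m) :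
    dd d (fun q => f (q, y)) q = dd (d, 0) f (q, y) := by
  have h1 : HasFDerivAt (fun q : QQ m => ((q, y) : FF m)) (ContinuousLinearMap.inl ℝ (QQ m) ℝ) q :=
    hasFDerivAt_prodMk_left q y
  have := (h.hasFDerivAt.comp q h1).fderiv
  unfold dd
  rw [show (fun q => f (q, y)) = f ∘ fun q => (q, y) from rfl, this]
  simp

lemma cd_slice {f : FF m → ℝ} {q : QQ m} {y : ℝ} {n : WithTop ℕ∞} (h : ContDiffAt ℝ n f (q, y)) :
    ContDiffAt ℝ n (fun q => f (q, y)) q :=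
  ContDiffAt.comp (f := fun q : QQ m => ((q, y) : FF m)) q h (contDiffAt_id.prodMk contDiffAt_const)

lemma dd2_slice {f : FF m → ℝ} {q : QQ m} {y : ℝ} (h : ContDiffAt ℝ 2 f (q, y)) (d : QQ m) :
    dd d (dd d (fun q => f (q, y))) q = dd (d, 0) (dd (d, 0) f) (q, y) := by
  rw [← dd_slice (cdAt_dda h _) d]
  apply dd_congr
  have hc : Filter.Tendsto (fun q : QQ m => ((q, y) : FF m)) (nhds q) (nhds (q, y)) := by
    have : Continuous (fun q : QQ m => ((q, y) : FF m)) := by fun_prop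
    exact this.tendsto q
  filter_upwards [hc.eventually (cdAt_ev h)] with z hz using dd_slice (cdAt_da hz) d

/-- integration by parts at fixed `y` -/
lemma ibp_slice {v : FF m → ℝ} {y : ℝ} (hv : ∀ q, ContDiffAt ℝ 2 v (q, y)) {η : QQ m → ℝ}
    (hη : ContDiff ℝ 2 η) (hc : HasCompactSupport η) :
    Integrable (fun q => η q * (dd dT v (q, y) - ∑ i, dd (dI i) (dd (dI i) v) (q, y))) ∧
    ∫ q, η q * (dd dT v (q, y) - ∑ i, dd (dI i) (dd (dI i) v) (q, y)) = - ∫ q, Hq η q * v (q, y) := by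
  set g : QQ m → ℝ := fun q => v (q, y) with hg
  have hg2 : ∀ q, ContDiffAt ℝ 2 g q := fun q => cd_slice (hv q)
  have e1 : ∀ q, dd dT v (q, y) = dd eT g q := fun q => (dd_slice (cdAt_da (hv q)) eT).symm
  have e2 : ∀ q i, dd (dI i) (dd (dI i) v) (q, y) = dd (eI i) (dd (eI i) g) q :=
    fun q i => (dd2_slice (hv q) (eI i)).symm
  simp only [e1, e2]
  have iT : Integrable fun q => η q * dd eT g q := int_mul_tsupport hη.continuous hc fun x _ =>
      (cdAt_dda (hg2 x) _).continuousAt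
  have iI : ∀ i, Integrable fun x => η x * dd (eI i) (dd (eI i) g) x := fun i =>
    int_mul_tsupport hη.continuous hc fun x hx =>
      (dd_contDiffAt (dd_contDiffAt (hg2 x) (k := 1) (by norm_num) _) (k := 0) (by norm_num) _).continuousAt
  have jT : Integrable fun x => dd eT η x * g x :=
    int_mul_tsupport (dd_contDiff hη (k := 1) (by norm_num) _).continuous (dd_hcs hc _)
      fun x _ => (hg2 x).continuousAt
  have jD : ∀ d, Integrable fun x => dd d (dd d η) x * g x := fun d =>
    int_mul_tsupport (dd_contDiff (dd_contDiff hη (k := 1) (by norm_num) d) (k := 0) (by norm_num) d).continuous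
      (dd_hcs (dd_hcs hc _) _) fun x _ => (hg2 x).continuousAt
  have sI : Integrable fun x => ∑ i, η x * dd (eI i) (dd (eI i) g) x := integrable_finsetSum _ fun i _ => iI i
  have sJ : Integrable fun x => ∑ i, dd (eI i) (dd (eI i) η) x * g x := integrable_finsetSum _ fun i _ => jD _
  have e : (fun q => η q * (dd eT g q - ∑ i, dd (eI i) (dd (eI i) g) q)) =
      fun q => η q * dd eT g q - ∑ i, η q * dd (eI i) (dd (eI i) g) q := by
    funext q; rw [mul_sub, Finset.mul_sum]
  have e' : (fun q => Hq η q * g q) = fun q => dd eT η q * g q + ∑ i, dd (eI i) (dd (eI i) η) q * g q := by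
    funext q; rw [Hq, add_mul, Finset.sum_mul]
  rw [e]
  refine ⟨iT.sub sI, ?_⟩
  rw [show (∫ q, Hq η q * g q) = ∫ q, (dd eT η q * g q + ∑ i, dd (eI i) (dd (eI i) η) q * g q) by rw [e']]
  rw [integral_sub iT sI, integral_add jT sJ, integral_finsetSum _ fun i _ => iI i,
    integral_finsetSum _ fun i _ => jD _,
    ibp1 (hη.of_le (by norm_num)) hc (fun x _ => (hg2 x).of_le (by norm_num)) eT,
    Finset.sum_congr rfl fun i _ => ibp2 hη hc (fun x _ => hg2 x) (eI i)]
  ring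

/-- differentiation under the integral -/
lemma pint {η : QQ m → ℝ} (hη : Continuous η) (hc : HasCompactSupport η) {f : FF m → ℝ}
    (hf : ∀ ζ : FF m, ζ.2 ≠ 0 → ContDiffAt ℝ 1 f ζ) {y0 : ℝ} (hy : y0 ≠ 0) :
    HasDerivAt (fun y => ∫ q, η q * f (q, y)) (∫ q, η q * dd dY f (q, y0)) y0 := by
  have hr : 0 < |y0| / 2 := by positivity
  have hball : ∀ y ∈ Metric.closedBall y0 (|y0| / 2), y ≠ 0 := by
    intro y hyy h0
    rw [h0, Metric.mem_closedBall, dist_zero_left, Real.norm_eq_abs] at hyy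
    have := abs_pos.2 hy
    linarith
  have hdc : ∀ ζ : FF m, ζ.2 ≠ 0 → ContinuousAt (dd dY f) ζ := fun ζ h =>
    (dd_contDiffAt (hf ζ h) (k := 0) (by norm_num) _).continuousAt
  have hK : IsCompact (tsupport η ×ˢ Metric.closedBall y0 (|y0| / 2)) :=
    hc.isCompact.prod (isCompact_closedBall _ _)
  obtain ⟨M, hM⟩ := hK.exists_bound_of_continuousOn (f := dd dY f)
    (fun ζ hζ => (hdc ζ (hball _ hζ.2)).continuousWithinAt)
  have hfc : ∀ y, y ≠ 0 → Continuous fun q : QQ m => f (q, y) := fun y h =>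
    continuous_iff_continuousAt.2 fun q => (cd_slice (hf (q, y) h)).continuousAt
  have hfc' : ∀ y, y ≠ 0 → Continuous fun q : QQ m => dd dY f (q, y) := fun y h =>
    continuous_iff_continuousAt.2 fun q => (cd_slice (dd_contDiffAt (hf (q, y) h) (k := 0) (by norm_num) _)).continuousAt
  refine (hasDerivAt_integral_of_dominated_loc_of_deriv_le (s := Metric.ball y0 (|y0| / 2))
    (F := fun y q => η q * f (q, y)) (F' := fun y q => η q * dd dY f (q, y))
    (bound := fun q => |η q| * M) (Metric.ball_mem_nhds _ hr) ?_ ?_ ?_ ?_ ?_ ?_).2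
  · filter_upwards [Metric.ball_mem_nhds y0 hr] with y h
    exact (hη.mul (hfc y (hball y (Metric.ball_subset_closedBall h)))).aestronglyMeasurable
  · exact (hη.mul (hfc y0 hy)).integrable_of_hasCompactSupport hc.mul_right
  · exact (hη.mul (hfc' y0 hy)).aestronglyMeasurable
  · refine Filter.Eventually.of_forall fun q y h => ?_
    rw [norm_mul, Real.norm_eq_abs]
    by_cases hq : q ∈ tsupport η
    · exact mul_le_mul_of_nonneg_left (hM (q, y) ⟨hq, Metric.ball_subset_closedBall h⟩) (abs_nonneg _)
    · rw [image_eq_zero_of_notMem_tsupport hq]; simp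
  · exact (hη.abs.mul continuous_const).integrable_of_hasCompactSupport (hc.norm.mul_right (f := fun q => ‖η q‖))
  · refine Filter.Eventually.of_forall fun q y h => ?_
    have hy0 : y ≠ 0 := hball y (Metric.ball_subset_closedBall h)
    exact (dd_dY_eq (ζ := (q, y)) ((hf _ hy0).differentiableAt (by norm_num))).const_mul (η q)

lemma continuous_pint {η : QQ m → ℝ} (hη : Continuous η) (hc : HasCompactSupport η) {f : FF m → ℝ}
    (hf : Continuous f) : Continuous (fun ζ : FF m => ∫ q, η q * f (q + ζ.1, ζ.2)) := by
  have : (fun ζ : FF m => ∫ q, η q * f (q + ζ.1, ζ.2)) =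
      fun ζ : FF m => ∫ q in tsupport η, η q * f (q + ζ.1, ζ.2) := by
    funext ζ
    rw [setIntegral_eq_integral_of_forall_compl_eq_zero]
    intro q hq
    rw [image_eq_zero_of_notMem_tsupport hq, zero_mul]
  rw [this]
  apply continuous_parametric_integral_of_continuous _ hc.isCompact
  fun_prop

lemma chord {a : ℝ} (ha1 : -1 < a) (ha : a < 1) {v : FF m → ℝ} (hv : Continuous v)
    (hv2 : ∀ ζ : FF m, ζ.2 ≠ 0 → ContDiffAt ℝ 2 v ζ) {η : QQ m → ℝ} (hη : ContDiff ℝ 2 η)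
    (hc : HasCompactSupport η) (h0 : ∀ q, 0 ≤ η q) {y0 M B s : ℝ} (hs : |s| = 1)
    (hL : ∀ q ∈ tsupport η, ∀ y, y ≠ 0 → |y| < y0 → Lop a v (q, y) ≤ 0)
    (hM : ∀ q ∈ tsupport η, ∀ y, |y| < y0 → |v (q, y)| ≤ M)
    (hB : M * ∫ q, |Hq η q| < B * (2 * (1 + a))) {y1 : ℝ} (hy1 : 0 < y1) (hy10 : y1 < y0) :
    ∀ y ∈ Set.Icc 0 y1, (∫ q, η q * v (q, s * y)) + B * y ^ 2 ≤
      (∫ q, η q * v (q, 0)) + y ^ (1 - a) * (((∫ q, η q * v (q, s * y1)) + B * y1 ^ 2 -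
        ∫ q, η q * v (q, 0)) / y1 ^ (1 - a)) := by
  set V0 := ∫ q, η q * v (q, 0) with hV0
  set κ := ((∫ q, η q * v (q, s * y1)) + B * y1 ^ 2 - V0) / y1 ^ (1 - a) with hκ
  have h1a : 0 < 1 - a := by linarith
  have hs0 : s ≠ 0 := by intro h; rw [h] at hs; simp at hs
  have hss : s * s = 1 := by rw [← abs_mul_abs_self, hs, one_mul]
  have hy1p := Real.rpow_pos_of_pos hy1 (1 - a)
  have hcHq : Continuous (Hq η) := by
    unfold Hq
    refine (dd_contDiff hη (k := 1) (by norm_num) _).continuous.add (continuous_finsetSum _ fun i _ => ?_)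
    exact (dd_contDiff (dd_contDiff hη (k := 1) (by norm_num) _) (k := 0) (by norm_num) _).continuous
  have htH : ∀ q, q ∉ tsupport η → Hq η q = 0 := by
    intro q hq
    unfold Hq
    rw [image_eq_zero_of_notMem_tsupport (fun h => hq (tsupport_dd _ h)), zero_add]
    exact Finset.sum_eq_zero fun i _ =>
      image_eq_zero_of_notMem_tsupport (fun h => hq (tsupport_dd _ (tsupport_dd _ h)))
  have hsH : HasCompactSupport (Hq η) := HasCompactSupport.intro hc.isCompact htH
  set f1 : ℝ → ℝ := fun y => (∫ q, η q * dd dY v (q, s * y)) * s + B * (2 * y) - κ * ((1 - a) * y ^ (1 - a - 1))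
  set f2 : ℝ → ℝ := fun y => (∫ q, η q * dd dY (dd dY v) (q, s * y)) * s * s + B * 2 -
    κ * ((1 - a) * ((1 - a - 1) * y ^ (1 - a - 1 - 1)))
  have hsy : ∀ y, HasDerivAt (fun y => s * y) s y := fun y => by
    simpa using (hasDerivAt_id y).const_mul s
  have key := max1 (h := fun y => (∫ q, η q * v (q, s * y)) + B * y ^ 2 - κ * y ^ (1 - a) - V0)
    (h1 := f1) (h2 := f2) (a := a) hy1 ?_ ?_ ?_ ?_ ?_ ?_
  · intro y hy
    have := key y hy
    linarith
  · apply Continuous.continuousOn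
    have h1 := continuous_pint hη.continuous hc hv
    have h2 : Continuous fun y : ℝ => ∫ q, η q * v (q, s * y) := by
      have := h1.comp (show Continuous fun y : ℝ => ((0, s * y) : FF m) by fun_prop)
      simpa [Function.comp_def] using this
    exact ((h2.add (by fun_prop)).sub (continuous_const.mul (Real.continuous_rpow_const h1a.le))).sub continuous_const
  · intro y hy
    have hne : s * y ≠ 0 := mul_ne_zero hs0 hy.1.ne'
    have d1 := (pint hη.continuous hc (fun ζ h => (hv2 ζ h).of_le (by norm_num)) hne).comp y (hsy y)
    have d2 : HasDerivAt (fun y : ℝ => B * y ^ 2) (B * (2 * y)) y := by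
      simpa using (hasDerivAt_pow 2 y).const_mul B
    have d3 := (Real.hasDerivAt_rpow_const (p := 1 - a) (x := y) (Or.inl hy.1.ne')).const_mul κ
    exact ((d1.add d2).sub d3).sub_const V0
  · intro y hy
    have hne : s * y ≠ 0 := mul_ne_zero hs0 hy.1.ne'
    have d1 := ((pint (f := dd dY v) hη.continuous hc
      (fun ζ h => dd_contDiffAt (hv2 ζ h) (k := 1) (by norm_num) _) hne).comp y (hsy y)).mul_const s
    have d2 : HasDerivAt (fun y : ℝ => B * (2 * y)) (B * 2) y := by
      simpa using ((hasDerivAt_id y).const_mul 2).const_mul B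
    have d3 := ((Real.hasDerivAt_rpow_const (p := 1 - a - 1) (x := y) (Or.inl hy.1.ne')).const_mul (1 - a)).const_mul κ
    exact (d1.add d2).sub d3
  · intro y hy
    have hy0 : 0 < y := hy.1
    have hne : s * y ≠ 0 := mul_ne_zero hs0 hy.1.ne'
    have habs : |s * y| < y0 := by rw [abs_mul, hs, one_mul, abs_of_pos hy0]; exact hy.2.trans hy10
    have hI1 : Integrable fun q => η q * dd dY v (q, s * y) := int_mul_tsupport hη.continuous hc fun q _ =>
      (cd_slice (f := dd dY v) (dd_contDiffAt (hv2 (q, s * y) hne) (k := 0) (by norm_num) _)).continuousAt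
    have hI2 : Integrable fun q => η q * dd dY (dd dY v) (q, s * y) := int_mul_tsupport hη.continuous hc fun q _ =>
      (cd_slice (f := dd dY (dd dY v)) (dd_contDiffAt (dd_contDiffAt (hv2 (q, s * y) hne) (k := 1) (by norm_num) _)
        (k := 0) (by norm_num) _)).continuousAt
    obtain ⟨hI3, e3⟩ := ibp_slice (fun q => hv2 (q, s * y) hne) hη hc
    have hle : ∫ q, η q * (dd dT v (q, s * y) - ∑ i, dd (dI i) (dd (dI i) v) (q, s * y)) ≤
        ∫ q, (η q * dd dY (dd dY v) (q, s * y) + a / (s * y) * (η q * dd dY v (q, s * y))) := by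
      refine integral_mono hI3 (hI2.add (hI1.const_mul _)) fun q => ?_
      by_cases hq : q ∈ tsupport η
      · have := hL q hq (s * y) hne habs
        unfold Lop at this
        have hp : 0 < |s * y| ^ a := Real.rpow_pos_of_pos (abs_pos.2 hne) a
        have h3 := nonpos_of_mul_nonpos_right this hp
        have := mul_le_mul_of_nonneg_left h3 (h0 q)
        simp only at this ⊢
        linarith
      · simp [image_eq_zero_of_notMem_tsupport hq]
    rw [integral_add hI2 (hI1.const_mul _), integral_const_mul, e3] at hle
    have hb : |∫ q, Hq η q * v (q, s * y)| ≤ M * ∫ q, |Hq η q| := by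
      rw [← integral_const_mul]
      refine (abs_integral_le_integral_abs).trans (integral_mono_of_nonneg ?_ ?_ ?_)
      · exact Filter.Eventually.of_forall fun q => abs_nonneg _
      · exact ((hcHq.abs).integrable_of_hasCompactSupport hsH.norm).const_mul M
      · refine Filter.Eventually.of_forall fun q => ?_
        simp only [abs_mul]
        by_cases hq : q ∈ tsupport η
        · rw [mul_comm]; exact mul_le_mul_of_nonneg_right (hM q hq _ habs) (abs_nonneg _)
        · rw [htH q hq]; simp
    have hb' := (abs_le.1 hb).2
    have e4 : f2 y + a / y * f1 y = (∫ q, η q * dd dY (dd dY v) (q, s * y)) +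
        a / (s * y) * (∫ q, η q * dd dY v (q, s * y)) + B * (2 * (1 + a)) := by
      simp only [f1, f2]
      have hr : y ^ (1 - a - 1) = y ^ (1 - a - 1 - 1) * y := by
        rw [← Real.rpow_add_one hy0.ne']; congr 1; ring
      rw [hr]
      have hsinv : a / (s * y) = a / y * s := by
        field_simp; linear_combination -a * hss
      rw [hsinv, mul_assoc _ s s, hss]
      field_simp
      ring
    rw [e4]; linarith
  · simp [hV0, Real.zero_rpow h1a.ne']
  · have : κ * y1 ^ (1 - a) = (∫ q, η q * v (q, s * y1)) + B * y1 ^ 2 - V0 := by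
      rw [hκ]; field_simp
    linarith
end

set_option linter.all false
noncomputable section
open Real MeasureTheory
variable {m : ℕ}

lemma approx_conv {η : QQ m → ℝ} (hη : Continuous η) (hc : HasCompactSupport η) (h0 : ∀ q, 0 ≤ η q)
    (h1 : ∫ q, η q = 1) {v : FF m → ℝ} (hv : Continuous v) {S : Set (FF m → ℝ)}
    (hS : ∀ q ∈ tsupport η, (fun ζ : FF m => v (q + ζ.1, ζ.2)) ∈ S)
    (hconv : ∀ f ∈ S, ∀ g ∈ S, ∀ s t : ℝ, 0 ≤ s → 0 ≤ t → s + t = 1 → (fun ζ => s * f ζ + t * g ζ) ∈ S)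
    {K : Set (FF m)} (hK : IsCompact K) {ε : ℝ} (hε : 0 < ε) :
    ∃ f ∈ S, ∀ ζ ∈ K, |f ζ - ∫ q, η q * v (q + ζ.1, ζ.2)| < ε := by
  haveI : CompactSpace K := isCompact_iff_compactSpace.1 hK
  let T0 : C(QQ m × K, ℝ) := ⟨fun x => v (x.1 + x.2.1.1, x.2.1.2), by fun_prop⟩
  let T : C(QQ m, C(K, ℝ)) := T0.curry
  let S' : Set C(K, ℝ) := {F | ∃ f ∈ S, ∀ ζ : K, F ζ = f ζ}
  have hconv' : Convex ℝ S' := by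
    rintro F ⟨f, hf, ef⟩ G ⟨g, hg, eg⟩ s t hs ht hst
    exact ⟨_, hconv f hf g hg s t hs ht hst, fun ζ => by simp [ef, eg]⟩
  have hηm : Measurable fun q => (η q).toNNReal := (hη.measurable).real_toNNReal
  let μ : Measure (QQ m) := volume.withDensity fun q => ((η q).toNNReal : ENNReal)
  have hηi : Integrable η := hη.integrable_of_hasCompactSupport hc
  haveI : IsProbabilityMeasure μ := by
    constructor
    have : μ Set.univ = ∫⁻ q, ENNReal.ofReal (η q) := by
      simp only [μ, withDensity_apply _ MeasurableSet.univ, Measure.restrict_univ]; rfl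
    rw [this, ← ofReal_integral_eq_lintegral_ofReal hηi (Filter.Eventually.of_forall h0), h1, ENNReal.ofReal_one]
  have hIntg : Integrable (fun q => η q • T q) := by
    refine Continuous.integrable_of_hasCompactSupport (by fun_prop) ?_
    exact hc.smul_right
  have hsm : ∀ F : C(K, ℝ), ∀ q, (η q).toNNReal • F = η q • F := fun F q => by
    rw [NNReal.smul_def, Real.coe_toNNReal _ (h0 q)]
  have hTi : Integrable T μ := by
    rw [integrable_withDensity_iff_integrable_smul hηm]
    simpa only [hsm] using hIntg
  have hae : ∀ᵐ q ∂μ, T q ∈ closure S' := by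
    rw [ae_withDensity_iff (by fun_prop)]
    refine Filter.Eventually.of_forall fun q hq => subset_closure ⟨_, hS q ?_, fun ζ => rfl⟩
    apply subset_tsupport
    intro h; apply hq; simp [h]
  have hmem := hconv'.closure.integral_mem isClosed_closure hae hTi
  rw [integral_withDensity_eq_integral_smul hηm] at hmem
  simp only [hsm] at hmem
  obtain ⟨F, ⟨f, hf, ef⟩, hd⟩ := Metric.mem_closure_iff.1 hmem ε hε
  refine ⟨f, hf, fun ζ hζ => ?_⟩
  have hev : (∫ q, η q • T q) ⟨ζ, hζ⟩ = ∫ q, η q * v (q + ζ.1, ζ.2) := by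
    rw [ContinuousMap.integral_apply hIntg]; rfl
  rw [← hev, ← ef ⟨ζ, hζ⟩]
  have := (ContinuousMap.dist_lt_iff hε).1 hd ⟨ζ, hζ⟩
  rw [dist_comm, Real.dist_eq] at this
  exact this
end

set_option linter.all false
noncomputable section
open Real MeasureTheory
variable {m : ℕ}

lemma dd_fst {R : QQ m → ℝ} {ζ : FF m} (h : DifferentiableAt ℝ R ζ.1) (d : FF m) :
    dd d (fun ζ : FF m => R ζ.1) ζ = dd d.1 R ζ.1 := by
  have h1 : HasFDerivAt (fun ζ : FF m => ζ.1) (ContinuousLinearMap.fst ℝ (QQ m) ℝ) ζ := hasFDerivAt_fst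
  have := (h.hasFDerivAt.comp ζ h1).fderiv
  unfold dd
  rw [show (fun ζ : FF m => R ζ.1) = R ∘ fun ζ : FF m => ζ.1 from rfl, this]
  simp

lemma Lop_sep (a : ℝ) {R : QQ m → ℝ} (hR : ContDiff ℝ 2 R) {w w1 : ℝ → ℝ} {ζ : FF m} {w2 : ℝ}
    (hw : ContDiffAt ℝ 2 w ζ.2) (h1 : ∀ᶠ y in nhds ζ.2, HasDerivAt w (w1 y) y) (h2 : HasDerivAt w1 w2 ζ.2) :
    Lop a (fun ζ : FF m => R ζ.1 + w ζ.2) ζ = |ζ.2| ^ a * (dd eT R ζ.1 - (∑ i, dd (eI i) (dd (eI i) R) ζ.1)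
      - w2 - a / ζ.2 * w1 ζ.2) := by
  have cR : ContDiffAt ℝ 2 (fun ζ : FF m => R ζ.1) ζ := (hR.comp contDiff_fst).contDiffAt
  have cw : ContDiffAt ℝ 2 (fun ζ : FF m => w ζ.2) ζ := hw.comp ζ contDiffAt_snd
  have dR : ∀ x, DifferentiableAt ℝ R x := fun x => hR.differentiable (by norm_num) x
  have ew : ∀ d, dd d (fun ζ : FF m => w ζ.2) =ᶠ[nhds ζ] fun ζ => w1 ζ.2 * d.2 := by
    intro d
    have := continuous_snd.continuousAt (x := ζ) |>.eventually h1
    filter_upwards [this] with x hx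
    rw [dd_dir_fun hx.differentiableAt, hx.deriv]
  have ew2 : ∀ d, dd d (dd d (fun ζ : FF m => w ζ.2)) ζ = w2 * d.2 * d.2 := by
    intro d
    have hh : HasDerivAt (fun y => w1 y * d.2) (w2 * d.2) ζ.2 := h2.mul_const d.2
    rw [dd_congr d (ew d), dd_dir_fun (g := fun y => w1 y * d.2) hh.differentiableAt, hh.deriv]
  have eR : ∀ d, dd d (fun ζ : FF m => R ζ.1) = fun ζ => dd d.1 R ζ.1 := fun d => by
    funext x; exact dd_fst (dR _) d
  have eR2 : ∀ d, dd d (dd d (fun ζ : FF m => R ζ.1)) ζ = dd d.1 (dd d.1 R) ζ.1 := fun d => by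
    rw [eR d, dd_fst ((dd_contDiff hR (k := 1) (by norm_num) _).differentiable (by norm_num) _)]
  have z1 : ∀ x, dd (0 : QQ m) R x = 0 := fun x => by simp [dd]
  unfold Lop
  simp only [dd_add _ (cdAt_da cR) (cdAt_da cw), dd2_add _ cR cw, (ew _).self_of_nhds, ew2, eR2]
  simp only [eR]
  have z2 : dd (0 : QQ m) (dd (0 : QQ m) R) ζ.1 = 0 := by simp [dd]
  simp only [dT, dI, dY, eT, eI, mul_zero, add_zero, mul_one]
  simp only [show ((0, 0) : QQ m) = 0 from rfl, z1, z2, zero_add]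

/-- quadratic barrier -/
def Rq (N : ℝ) (p q : QQ m) : ℝ :=
  (∑ j, (N * q.1 j ^ 2 + (q.1 j - p.1 j) ^ 2)) + (N * q.2 ^ 2 + (q.2 - p.2) ^ 2)

lemma Rq_cd (N : ℝ) (p : QQ m) : ContDiff ℝ 2 (Rq N p) := by unfold Rq; fun_prop

lemma Rq_T (N : ℝ) (p q : QQ m) : dd eT (Rq N p) q = 2 * N * q.2 + 2 * (q.2 - p.2) := by
  have h := hasDerivAt_line (f := Rq N p) (x := q) (d := eT) (s := 0)
    ((Rq_cd N p).differentiable (by norm_num) _)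
  simp only [zero_smul, add_zero] at h
  refine h.unique ?_
  simp only [Rq, eT, Prod.fst_add, Prod.snd_add, Prod.smul_fst, Prod.smul_snd, smul_zero, add_zero, smul_eq_mul, mul_one]
  have h1 : HasDerivAt (fun s : ℝ => q.2 + s) 1 0 := by simpa using (hasDerivAt_id (0:ℝ)).const_add q.2
  have := (((h1.pow 2).const_mul N).add ((h1.sub_const p.2).pow 2)).const_add
    (∑ j, (N * q.1 j ^ 2 + (q.1 j - p.1 j) ^ 2))
  exact HasDerivAt.congr_deriv this (by simp; ring)

lemma Rq_I1 (N : ℝ) (p q : QQ m) (i : Fin m) : dd (eI i) (Rq N p) q = 2 * N * q.1 i + 2 * (q.1 i - p.1 i) := by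
  have h := hasDerivAt_line (f := Rq N p) (x := q) (d := eI i) (s := 0)
    ((Rq_cd N p).differentiable (by norm_num) _)
  simp only [zero_smul, add_zero] at h
  refine h.unique ?_
  simp only [Rq, eI, Prod.fst_add, Prod.snd_add, Prod.smul_fst, Prod.smul_snd, smul_zero, add_zero, smul_eq_mul, mul_one,
    Pi.add_apply, Pi.smul_apply]
  have h1 : ∀ j, HasDerivAt (fun s : ℝ => q.1 j + s * (Pi.single i 1 : Fin m → ℝ) j) ((Pi.single i 1 : Fin m → ℝ) j) 0 :=
    fun j => by simpa using ((hasDerivAt_id (0:ℝ)).mul_const ((Pi.single i 1 : Fin m → ℝ) j)).const_add (q.1 j)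
  have := (HasDerivAt.fun_sum (u := Finset.univ) fun j _ => (((h1 j).pow 2).const_mul N).add (((h1 j).sub_const (p.1 j)).pow 2)).add_const
    (N * q.2 ^ 2 + (q.2 - p.2) ^ 2)
  simp only [mul_zero, add_zero]
  refine HasDerivAt.congr_deriv this ?_
  rw [Finset.sum_eq_single i]
  · simp; ring
  · intro j _ hj; simp [Pi.single_eq_of_ne hj]
  · simp

lemma Rq_I2 (N : ℝ) (p q : QQ m) (i : Fin m) : dd (eI i) (dd (eI i) (Rq N p)) q = 2 * N + 2 := by
  have e : dd (eI i) (Rq N p) = fun q : QQ m => 2 * N * q.1 i + 2 * (q.1 i - p.1 i) := funext fun q => Rq_I1 N p q i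
  rw [e]
  have h := hasDerivAt_line (f := fun q : QQ m => 2 * N * q.1 i + 2 * (q.1 i - p.1 i)) (x := q) (d := eI i) (s := 0)
    (by fun_prop)
  simp only [zero_smul, add_zero] at h
  refine h.unique ?_
  simp only [eI, Prod.fst_add, Prod.smul_fst, smul_eq_mul, Pi.add_apply, Pi.smul_apply, Pi.single_eq_same, mul_one]
  have h1 : HasDerivAt (fun s : ℝ => q.1 i + s) 1 0 := by simpa using (hasDerivAt_id (0:ℝ)).const_add (q.1 i)
  have := (h1.const_mul (2 * N)).add ((h1.sub_const (p.1 i)).const_mul 2)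
  exact HasDerivAt.congr_deriv this (by ring)

/-- wedge -/
def wdg (a A A' B : ℝ) (y : ℝ) : ℝ := A * (max y 0) ^ (1 - a) + A' * (max (-y) 0) ^ (1 - a) - B * y ^ 2

lemma wdg_pos {a A A' B y : ℝ} (ha : a < 1) (hy : 0 ≤ y) : wdg a A A' B y = A * |y| ^ (1 - a) - B * y ^ 2 := by
  rw [wdg, max_eq_left hy, max_eq_right (by linarith), abs_of_nonneg hy, Real.zero_rpow (by linarith)]; ring
lemma wdg_neg {a A A' B y : ℝ} (ha : a < 1) (hy : y ≤ 0) : wdg a A A' B y = A' * |y| ^ (1 - a) - B * y ^ 2 := by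
  rw [wdg, max_eq_right hy, max_eq_left (by linarith), abs_of_nonpos hy, Real.zero_rpow (by linarith)]; ring

lemma wdg_cont {a A A' B : ℝ} (ha : a < 1) : Continuous (wdg a A A' B) := by
  unfold wdg
  have h := Real.continuous_rpow_const (q := 1 - a) (by linarith)
  have h1 := h.comp (continuous_id.max continuous_const : Continuous fun y : ℝ => max y 0)
  have h2 := h.comp (continuous_neg.max continuous_const : Continuous fun y : ℝ => max (-y) 0)
  exact ((continuous_const.mul h1).add (continuous_const.mul h2)).sub (by fun_prop)

lemma wdg_ev {a A A' B y : ℝ} (ha : a < 1) (hy : y ≠ 0) :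
    ∃ C, wdg a A A' B =ᶠ[nhds y] fun y => C * |y| ^ (1 - a) - B * y ^ 2 := by
  rcases lt_or_gt_of_ne hy with h | h
  · exact ⟨A', by filter_upwards [gt_mem_nhds h] with z hz using wdg_neg ha (le_of_lt hz)⟩
  · exact ⟨A, by filter_upwards [lt_mem_nhds h] with z hz using wdg_pos ha (le_of_lt hz)⟩

lemma barrier {a A A' B N : ℝ} (ha : a < 1) {p : QQ m} {ζ : FF m} (hy : ζ.2 ≠ 0) :
    ContDiffAt ℝ 2 (fun ζ : FF m => Rq N p ζ.1 + wdg a A A' B ζ.2) ζ ∧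
    Lop a (fun ζ : FF m => Rq N p ζ.1 + wdg a A A' B ζ.2) ζ =
      |ζ.2| ^ a * (2 * N * ζ.1.2 + 2 * (ζ.1.2 - p.2) - m * (2 * N + 2) + 2 * B * (1 + a)) := by
  obtain ⟨C, hC⟩ := wdg_ev (A := A) (A' := A') (B := B) ha hy
  have cw : ContDiffAt ℝ 2 (wdg a A A' B) ζ.2 := by
    refine ContDiffAt.congr_of_eventuallyEq ?_ hC
    have h1 : ContDiffAt ℝ 2 (fun y : ℝ => |y|) ζ.2 := contDiffAt_abs (n := 2) hy
    exact (contDiffAt_const.mul (h1.rpow_const_of_ne (by simpa using hy))).sub (by fun_prop)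
  have cR : ContDiffAt ℝ 2 (fun ζ : FF m => Rq N p ζ.1) ζ := ((Rq_cd N p).comp contDiff_fst).contDiffAt
  refine ⟨cR.add (cw.comp ζ contDiffAt_snd), ?_⟩
  have d1 : ∀ y : ℝ, y ≠ 0 → HasDerivAt (fun y : ℝ => C * |y| ^ (1 - a) - B * y ^ 2)
      (C * ((1 - a) / y * |y| ^ (1 - a)) - B * (2 * y)) y := fun y hy =>
    ((hasDerivAt_absrpow (1 - a) hy).const_mul C).sub (by simpa using (hasDerivAt_pow 2 y).const_mul B)
  have d2 : HasDerivAt (fun y : ℝ => C * ((1 - a) / y * |y| ^ (1 - a)) - B * (2 * y))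
      (C * (-(1 - a) / ζ.2 ^ 2 * |ζ.2| ^ (1 - a) + (1 - a) / ζ.2 * ((1 - a) / ζ.2 * |ζ.2| ^ (1 - a))) - B * 2) ζ.2 := by
    have e1 : HasDerivAt (fun y : ℝ => (1 - a) / y) (-(1 - a) / ζ.2 ^ 2) ζ.2 := by
      have := (hasDerivAt_inv hy).const_mul (1 - a)
      exact HasDerivAt.congr_deriv this (by ring)
    refine ((e1.mul (hasDerivAt_absrpow (1 - a) hy)).const_mul C).sub ?_
    simpa using ((hasDerivAt_id ζ.2).const_mul 2).const_mul B
  have hev : ∀ᶠ y in nhds ζ.2, HasDerivAt (wdg a A A' B) (C * ((1 - a) / y * |y| ^ (1 - a)) - B * (2 * y)) y := by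
    filter_upwards [hC.eventuallyEq_nhds, eventually_ne_nhds hy] with y e1 e2
    exact (d1 y e2).congr_of_eventuallyEq e1
  rw [Lop_sep a (Rq_cd N p) cw hev d2, Rq_T]
  simp only [Rq_I2, Finset.sum_const, Finset.card_univ, Fintype.card_fin, nsmul_eq_mul]
  congr 1
  field_simp
  ring
end

set_option linter.all false
noncomputable section
open Real MeasureTheory
variable {m : ℕ}

/-- translate in the tangential variables -/
def trl (p : QQ m) (f : FF m → ℝ) : FF m → ℝ := fun ζ => f (p + ζ.1, ζ.2)

lemma trl_eq (p : QQ m) (f : FF m → ℝ) : trl p f = fun ζ => f (((p, 0) : FF m) + ζ) := by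
  funext ζ; simp only [trl]; congr 1; ext <;> simp

lemma dd_trl (p : QQ m) (f : FF m → ℝ) (d : FF m) : dd d (trl p f) = trl p (dd d f) := by
  funext ζ
  rw [trl_eq, trl_eq]
  unfold dd
  rw [fderiv_comp_add_left]

lemma Lop_trl (a : ℝ) (p : QQ m) (f : FF m → ℝ) (ζ : FF m) : Lop a (trl p f) ζ = Lop a f (p + ζ.1, ζ.2) := by
  simp only [Lop, dd_trl]; rfl

lemma cd_trl {p : QQ m} {f : FF m → ℝ} {ζ : FF m} (h : ContDiffAt ℝ 2 f (p + ζ.1, ζ.2)) :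
    ContDiffAt ℝ 2 (trl p f) ζ := by
  have h1 : ContDiffAt ℝ 2 (fun ζ : FF m => ((p + ζ.1, ζ.2) : FF m)) ζ := by fun_prop
  exact ContDiffAt.comp (f := fun ζ : FF m => ((p + ζ.1, ζ.2) : FF m)) ζ h h1

/-- class of subsolutions in a box -/
def clsJ (a ρ δ : ℝ) : Set (FF m → ℝ) :=
  {f | Continuous f ∧ (∀ ζ : FF m, ζ.2 ≠ 0 → ContDiffAt ℝ 2 f ζ) ∧
    (∀ ζ : FF m, ‖ζ.1‖ < ρ → |ζ.2| < δ → ζ.2 ≠ 0 → Lop a f ζ ≤ 0) ∧ ∀ q, symSmall a f q}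

lemma clsJ_conv {a ρ δ : ℝ} : ∀ f ∈ clsJ (m := m) a ρ δ, ∀ g ∈ clsJ (m := m) a ρ δ, ∀ s t : ℝ, 0 ≤ s → 0 ≤ t → s + t = 1 →
    (fun ζ => s * f ζ + t * g ζ) ∈ clsJ a ρ δ := by
  rintro f ⟨f1, f2, f3, f4⟩ g ⟨g1, g2, g3, g4⟩ s t hs ht hst
  refine ⟨by fun_prop, fun ζ h => (contDiffAt_const.mul (f2 ζ h)).add (contDiffAt_const.mul (g2 ζ h)), ?_, ?_⟩
  · intro ζ h1 h2 h3
    rw [Lop_add a (contDiffAt_const.mul (f2 ζ h3)) (contDiffAt_const.mul (g2 ζ h3)), Lop_const_mul a s (f2 ζ h3),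
      Lop_const_mul a t (g2 ζ h3)]
    have := mul_nonpos_of_nonneg_of_nonpos hs (f3 ζ h1 h2 h3)
    have := mul_nonpos_of_nonneg_of_nonpos ht (g3 ζ h1 h2 h3)
    linarith
  · intro q ε hε
    filter_upwards [f4 q ε hε, g4 q ε hε] with y e1 e2
    have e : s * f (q, y) + t * g (q, y) + (s * f (q, -y) + t * g (q, -y)) - 2 * (s * f (q, 0) + t * g (q, 0))
      = s * (f (q, y) + f (q, -y) - 2 * f (q, 0)) + t * (g (q, y) + g (q, -y) - 2 * g (q, 0)) := by ring
    rw [e]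
    refine (abs_add_le _ _).trans ?_
    rw [abs_mul, abs_mul, abs_of_nonneg hs, abs_of_nonneg ht]
    have h1 := mul_le_mul_of_nonneg_left e1 hs
    have h2 := mul_le_mul_of_nonneg_left e2 ht
    have : s * (ε * y ^ (1 - a)) + t * (ε * y ^ (1 - a)) = ε * y ^ (1 - a) := by rw [← add_mul, hst, one_mul]
    linarith

lemma Rq_split (N : ℝ) (p q : QQ m) : Rq N p q = N * Rq 1 (q) q + Rq 0 p q := by
  simp [Rq, Finset.sum_add_distrib, mul_add, Finset.mul_sum]; ring

lemma Rq0_nonneg (p q : QQ m) : 0 ≤ Rq 0 p q := by unfold Rq; positivity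

lemma Rq0_pos {p q : QQ m} (h : p ≠ q) : 0 < Rq 0 p q := by
  rcases (Rq0_nonneg p q).lt_or_eq with h1 | h1
  · exact h1
  exfalso
  apply h
  simp only [Rq, zero_mul, zero_add] at h1
  have n1 : 0 ≤ ∑ j, (q.1 j - p.1 j) ^ 2 := by positivity
  have h2 : (q.2 - p.2) ^ 2 = 0 := by nlinarith [sq_nonneg (q.2 - p.2)]
  have h3 : ∑ j, (q.1 j - p.1 j) ^ 2 = 0 := by linarith
  rw [Finset.sum_eq_zero_iff_of_nonneg fun j _ => sq_nonneg _] at h3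
  refine Prod.ext (funext fun j => ?_) ?_
  · have := h3 j (Finset.mem_univ j)
    have := pow_eq_zero_iff (two_ne_zero) |>.1 this
    linarith
  · have := pow_eq_zero_iff (two_ne_zero) |>.1 h2
    linarith

lemma Rq1_norm (q : QQ m) : ‖q‖ ^ 2 ≤ Rq 1 q q := by
  have n1 : ∀ j, q.1 j ^ 2 ≤ ∑ j, q.1 j ^ 2 := fun j =>
    Finset.single_le_sum (f := fun j => q.1 j ^ 2) (fun j _ => sq_nonneg _) (Finset.mem_univ j)
  have e : Rq 1 q q = (∑ j, q.1 j ^ 2) + q.2 ^ 2 := by simp [Rq]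
  have n0 : 0 ≤ ∑ j, q.1 j ^ 2 := by positivity
  rw [e]
  have : ‖q‖ ≤ Real.sqrt ((∑ j, q.1 j ^ 2) + q.2 ^ 2) := by
    rw [Prod.norm_def]
    refine max_le ((pi_norm_le_iff_of_nonneg (Real.sqrt_nonneg _)).2 fun j => ?_) ?_
    · apply Real.le_sqrt_of_sq_le; rw [Real.norm_eq_abs, sq_abs]; linarith [n1 j, sq_nonneg q.2]
    · apply Real.le_sqrt_of_sq_le; rw [Real.norm_eq_abs, sq_abs]; linarith
  calc ‖q‖ ^ 2 ≤ (Real.sqrt ((∑ j, q.1 j ^ 2) + q.2 ^ 2)) ^ 2 := by gcongr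
    _ = _ := Real.sq_sqrt (by positivity)

lemma Rq1_zero : Rq 1 (0 : QQ m) 0 = 0 := by simp [Rq]

/-- The final contradiction: wedge from above is impossible. -/
lemma no_wedge {a : ℝ} (ha1 : -1 < a) (ha : a < 1) {V : FF m → ℝ} (hV : Continuous V) {ρ y1 A A' B : ℝ}
    (hρ : 0 < ρ) (hy1 : 0 < y1) (hAA : A + A' < 0)
    (h1 : ∀ p : QQ m, ‖p‖ ≤ ρ → ∀ y ∈ Set.Icc 0 y1, V (p, y) + B * y ^ 2 ≤ V (p, 0) + y ^ (1 - a) * A)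
    (h2 : ∀ p : QQ m, ‖p‖ ≤ ρ → ∀ y ∈ Set.Icc 0 y1, V (p, -y) + B * y ^ 2 ≤ V (p, 0) + y ^ (1 - a) * A')
    (happ : ∀ K : Set (FF m), IsCompact K → ∀ ε > 0, ∃ f ∈ clsJ a ρ y1, ∀ ζ ∈ K, |f ζ - V ζ| < ε) : False := by
  have hVc : Continuous fun p : QQ m => V (p, 0) := by fun_prop
  obtain ⟨M, hM⟩ := (isCompact_closedBall (0 : QQ m) ρ).exists_bound_of_continuousOn hVc.continuousOn
  set N := (2 * M + 1) / ρ ^ 2 with hN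
  have hNρ : N * ρ ^ 2 = 2 * M + 1 := by rw [hN]; field_simp
  have hM0 : 0 ≤ M := (norm_nonneg _).trans (hM 0 (by simp [hρ.le]))
  have hN0 : 0 < N := by positivity
  have hRc : Continuous fun p : QQ m => Rq 1 p p := by unfold Rq; fun_prop
  obtain ⟨ps, hps, hmax⟩ := (isCompact_closedBall (0 : QQ m) ρ).exists_isMaxOn ⟨0, by simp [hρ.le]⟩
    (f := fun p => V (p, 0) - N * Rq 1 p p) (by fun_prop)
  have hps' : ‖ps‖ < ρ := by
    rcases (mem_closedBall_zero_iff.1 hps).lt_or_eq with h | h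
    · exact h
    exfalso
    have e1 : V (0, 0) - N * Rq 1 0 0 ≤ V (ps, 0) - N * Rq 1 ps ps := hmax (by simp [hρ.le] : (0 : QQ m) ∈ _)
    rw [Rq1_zero] at e1
    have e2 := Rq1_norm ps
    rw [h] at e2
    have e3 := (abs_le.1 (hM ps hps)).2
    have e4 := (abs_le.1 (hM 0 (by simp [hρ.le]))).1
    have := mul_le_mul_of_nonneg_left e2 hN0.le
    linarith
  set κ := -(A + A') / 4 with hκ
  have hκ0 : 0 < κ := by rw [hκ]; linarith
  set B' := max (B + 1) ((2 * N * ρ + 4 * ρ + m * (2 * N + 2) + 1) / (2 * (1 + a))) with hB'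
  have h1a : 0 < 1 + a := by linarith
  have h1a' : 0 < 1 - a := by linarith
  have hB1 : 0 < B' - B := by have := le_max_left (B + 1) ((2 * N * ρ + 4 * ρ + m * (2 * N + 2) + 1) / (2 * (1 + a))); linarith
  have hB2 : 2 * N * ρ + 4 * ρ + m * (2 * N + 2) + 1 ≤ 2 * B' * (1 + a) := by
    have := le_max_right (B + 1) ((2 * N * ρ + 4 * ρ + m * (2 * N + 2) + 1) / (2 * (1 + a)))
    rw [div_le_iff₀ (by positivity)] at this
    linarith
  obtain ⟨δ, hδ0, hδ1, hδ2⟩ : ∃ δ, 0 < δ ∧ δ ≤ y1 ∧ (B' - B) * δ ^ (1 + a) < κ := by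
    have hc : Filter.Tendsto (fun δ : ℝ => (B' - B) * δ ^ (1 + a)) (nhdsWithin 0 (Set.Ioi 0)) (nhds 0) := by
      have h0 : Continuous fun δ : ℝ => (B' - B) * δ ^ (1 + a) := (continuous_const (y := B' - B)).mul (Real.continuous_rpow_const h1a.le)
      have := (h0.tendsto 0).mono_left (nhdsWithin_le_nhds (s := Set.Ioi 0))
      simpa [Real.zero_rpow h1a.ne'] using this
    obtain ⟨δ, e1, e2⟩ := ((hc.eventually (gt_mem_nhds hκ0)).and (Ioo_mem_nhdsGT hy1)).exists
    exact ⟨δ, e2.1, e2.2.le, e1⟩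
  set φ : FF m → ℝ := fun ζ => Rq N ps ζ.1 + wdg a (A + κ) (A' + κ) B' ζ.2 with hφ
  have hφc : Continuous φ := ((Rq_cd N ps).continuous.comp continuous_fst).add ((wdg_cont ha).comp continuous_snd)
  set c := V (ps, 0) - N * Rq 1 ps ps with hc
  have hw0 : wdg a (A + κ) (A' + κ) B' 0 = 0 := by
    rw [wdg_pos ha le_rfl]; simp [Real.zero_rpow h1a'.ne']
  have hR0 : Rq 0 ps ps = 0 := by simp [Rq]
  have hcen : V (ps, 0) - φ (ps, 0) = c := by
    simp only [hφ, hw0]; rw [Rq_split, hR0, hc]; ring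
  -- main estimate
  have hmain : ∀ ζ : FF m, ‖ζ.1‖ ≤ ρ → |ζ.2| ≤ δ →
      V ζ - φ ζ ≤ c - Rq 0 ps ζ.1 - |ζ.2| ^ (1 - a) * (κ - (B' - B) * δ ^ (1 + a)) := by
    rintro ⟨p, y⟩ hp hy
    simp only at hp hy ⊢
    have e1 : V (p, 0) - N * Rq 1 p p ≤ c := hmax (mem_closedBall_zero_iff.2 hp)
    have hyy : y ^ 2 ≤ |y| ^ (1 - a) * δ ^ (1 + a) := by
      rcases eq_or_ne y 0 with h | h
      · rw [h]; simp; positivity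
      have hy0 := abs_pos.2 h
      have : y ^ 2 = |y| ^ (1 - a) * |y| ^ (1 + a) := by
        rw [← Real.rpow_add hy0, ← sq_abs]
        rw [show (1 - a + (1 + a)) = ((2 : ℕ) : ℝ) by push_cast; ring, Real.rpow_natCast]
      rw [this]
      gcongr
    have hyy' := mul_le_mul_of_nonneg_left hyy hB1.le
    simp only [hφ]
    rw [Rq_split]
    rcases le_total 0 y with h | h
    · have := h1 p hp y ⟨h, by rw [abs_of_nonneg h] at hy; linarith⟩
      rw [wdg_pos ha h]
      rw [abs_of_nonneg h] at *
      linarith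
    · have := h2 p hp (-y) ⟨by linarith, by rw [abs_of_nonpos h] at hy; linarith⟩
      rw [wdg_neg ha h]
      rw [abs_of_nonpos h] at *
      rw [neg_neg, neg_sq] at this
      linarith
  set K : Set (FF m) := Metric.closedBall (0 : QQ m) ρ ×ˢ Metric.closedBall (0:ℝ) δ with hK
  have hKc : IsCompact K := (isCompact_closedBall _ _).prod (isCompact_closedBall _ _)
  have memK : ∀ ζ : FF m, ζ ∈ K ↔ ‖ζ.1‖ ≤ ρ ∧ |ζ.2| ≤ δ := fun ζ => by simp [hK, Set.mem_prod]
  set O : Set (FF m) := Metric.ball (0 : QQ m) ρ ×ˢ Metric.ball (0:ℝ) δ with hO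
  have memO : ∀ ζ : FF m, ζ ∈ O ↔ ‖ζ.1‖ < ρ ∧ |ζ.2| < δ := fun ζ => by simp [hO, Set.mem_prod]
  have hOo : IsOpen O := Metric.isOpen_ball.prod Metric.isOpen_ball
  have hdc : IsCompact (K \ O) := hKc.diff hOo
  have hdn : (K \ O).Nonempty := ⟨(0, δ), by rw [memK]; simp [hρ.le, abs_of_pos hδ0], by
    rw [memO]; simp [abs_of_pos hδ0]⟩
  obtain ⟨z, hz, hzmax⟩ := hdc.exists_isMaxOn hdn (f := fun ζ => V ζ - φ ζ) (by fun_prop)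
  have hzc : V z - φ z < c := by
    obtain ⟨hzK, hzO⟩ := hz
    rw [memK] at hzK
    have e := hmain z hzK.1 hzK.2
    have r0 := Rq0_nonneg ps z.1
    have k0 : 0 < κ - (B' - B) * δ ^ (1 + a) := by linarith
    have w0 : 0 ≤ |z.2| ^ (1 - a) := by positivity
    by_cases hzy : z.2 = 0
    · have : ps ≠ z.1 := by
        rintro h
        apply hzO
        rw [memO, ← h, hzy]
        simpa using ⟨hps', hδ0⟩
      have := Rq0_pos this
      have := mul_nonneg w0 k0.le
      linarith
    · have : 0 < |z.2| ^ (1 - a) := Real.rpow_pos_of_pos (abs_pos.2 hzy) _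
      have := mul_pos this k0
      linarith
  obtain ⟨f, hf, hfa⟩ := happ K hKc ((c - (V z - φ z)) / 3) (by linarith)
  obtain ⟨x, hx, hxmax⟩ := hKc.exists_isMaxOn ⟨z, hz.1⟩ (f := fun ζ => f ζ - φ ζ)
    (by have := hf.1; fun_prop)
  have hpsK : ((ps, 0) : FF m) ∈ K := by rw [memK]; simpa using ⟨hps'.le, hδ0.le⟩
  have hxO : x ∈ O := by
    by_contra h
    have e1 : V x - φ x ≤ V z - φ z := hzmax ⟨hx, h⟩
    have e2 : f (ps, 0) - φ (ps, 0) ≤ f x - φ x := hxmax hpsK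
    have e3 := (abs_lt.1 (hfa x hx)).2
    have e4 := (abs_lt.1 (hfa _ hpsK)).1
    linarith
  have hloc : IsLocalMax (fun ζ => f ζ - φ ζ) x :=
    hxmax.isLocalMax (Filter.mem_of_superset (hOo.mem_nhds hxO) (Set.prod_mono Metric.ball_subset_closedBall Metric.ball_subset_closedBall))
  rw [memO] at hxO
  refine no_locmax (a := a) (κ := 2 * κ) (fun h => hf.2.1 x h) (fun h => (barrier ha h).1) (fun h => hf.2.2.1 x hxO.1 (hxO.2.trans_le hδ1) h)
    (fun h => ?_) (hf.2.2.2 x.1) (by linarith) ?_ hloc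
  · rw [(barrier ha h).2]
    refine mul_pos (Real.rpow_pos_of_pos (abs_pos.2 h) _) ?_
    have t1 : |x.1.2| ≤ ρ := (norm_snd_le x.1).trans hxO.1.le
    have t2 : |ps.2| ≤ ρ := (norm_snd_le ps).trans hps'.le
    have := (abs_le.1 t1).1
    have := (abs_le.1 t2).2
    have := mul_le_mul_of_nonneg_left (abs_le.1 t1).1 (show 0 ≤ 2 * N by linarith)
    linarith
  · intro y hy
    simp only [hφ, hw0]
    rw [wdg_pos ha hy.le, wdg_neg ha (by linarith : -y ≤ 0), abs_neg, abs_of_pos hy]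
    have : 0 < B' ∨ B' ≤ 0 := lt_or_ge _ _
    have hB'0 : 0 ≤ B' := by
      have : 0 ≤ 2 * B' * (1 + a) := le_trans (by positivity) hB2
      nlinarith
    have := mul_nonneg hB'0 (sq_nonneg y)
    have e : A + κ + (A' + κ) = -(2 * κ) := by rw [hκ]; ring
    have e' : (A + κ) * y ^ (1 - a) + (A' + κ) * y ^ (1 - a) = -(2 * κ) * y ^ (1 - a) := by rw [← add_mul, e]
    nlinarith
end

set_option linter.all false
noncomputable section
open Real MeasureTheory
variable {m : ℕ}

lemma lemJ1 {a : ℝ} (ha1 : -1 < a) (ha : a < 1) {v : FF m → ℝ} (hv : Continuous v)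
    (hv2 : ∀ ζ : FF m, ζ.2 ≠ 0 → ContDiffAt ℝ 2 v ζ) (hsym : ∀ q, symSmall a v q)
    {U : Set (FF m)} (hU : IsOpen U) (hL : ∀ ζ ∈ U, ζ.2 ≠ 0 → Lop a v ζ ≤ 0)
    {η : QQ m → ℝ} (hη : ContDiff ℝ 2 η)
    (hc : HasCompactSupport η) (h0 : ∀ q, 0 ≤ η q) (h1 : ∫ q, η q = 1)
    (hηU : ∀ q ∈ tsupport η, ((q, 0) : FF m) ∈ U) :
    ∃ B y0 : ℝ, 0 < y0 ∧ ∀ y ∈ Set.Ioo 0 y0,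
      -(B * y ^ 2) ≤ (∫ q, η q * v (q, y)) + (∫ q, η q * v (q, -y)) - 2 * ∫ q, η q * v (q, 0) := by
  set K0 : Set (FF m) := tsupport η ×ˢ {0} with hK0
  have hK0c : IsCompact K0 := hc.isCompact.prod isCompact_singleton
  have hK0U : K0 ⊆ U := by
    rintro ⟨q, y⟩ ⟨h1, h2⟩
    simp only [Set.mem_singleton_iff] at h2
    subst h2; exact hηU q h1
  obtain ⟨δ, hδ, hδU⟩ := hK0c.exists_cthickening_subset_open hU hK0U
  have hmem : ∀ q ∈ tsupport η, ∀ p : QQ m, ‖p‖ ≤ δ → ∀ y : ℝ, |y| ≤ δ → ((p + q, y) : FF m) ∈ Metric.cthickening δ K0 := by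
    intro q hq p hp y hy
    refine Metric.mem_cthickening_of_dist_le _ ((q, 0) : FF m) _ _ ⟨hq, rfl⟩ ?_
    rw [Prod.dist_eq]
    refine max_le ?_ ?_
    · simpa [dist_eq_norm] using hp
    · simpa [dist_eq_norm] using hy
  obtain ⟨M, hM⟩ := hK0c.cthickening (r := δ) |>.exists_bound_of_continuousOn hv.continuousOn
  have h1a : 0 < 1 + a := by linarith
  set B := (M * (∫ q, |Hq η q|) + 1) / (2 * (1 + a)) with hB
  have hBM : M * ∫ q, |Hq η q| < B * (2 * (1 + a)) := by
    rw [hB, div_mul_cancel₀ _ (by positivity)]; linarith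
  refine ⟨2 * B, δ, hδ, fun y1 hy1 => ?_⟩
  by_contra hcon
  push Not at hcon
  set V : FF m → ℝ := fun ζ => ∫ q, η q * v (q + ζ.1, ζ.2) with hV
  have hVc : Continuous V := continuous_pint hη.continuous hc hv
  have V0 : ∀ y, V (0, y) = ∫ q, η q * v (q, y) := fun y => by simp [hV]
  rw [← V0, ← V0, ← V0] at hcon
  set Dp : QQ m → ℝ := fun p => V (p, y1) + B * y1 ^ 2 - V (p, 0) with hDp
  set Dm : QQ m → ℝ := fun p => V (p, -y1) + B * y1 ^ 2 - V (p, 0) with hDm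
  have hDpc : Continuous Dp := by fun_prop
  have hDmc : Continuous Dm := by fun_prop
  have hD0 : Dp 0 + Dm 0 < 0 := by simp only [hDp, hDm]; linarith
  set μ := -(Dp 0 + Dm 0) / 4 with hμ
  have hμ0 : 0 < μ := by rw [hμ]; linarith
  obtain ⟨ρ, hρ0, hρδ, hρ1⟩ : ∃ ρ, 0 < ρ ∧ ρ ≤ δ ∧ ∀ p : QQ m, ‖p‖ ≤ ρ → Dp p ≤ Dp 0 + μ ∧ Dm p ≤ Dm 0 + μ := by
    have e1 := (hDpc.tendsto 0).eventually (gt_mem_nhds (show Dp 0 < Dp 0 + μ by linarith))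
    have e2 := (hDmc.tendsto 0).eventually (gt_mem_nhds (show Dm 0 < Dm 0 + μ by linarith))
    obtain ⟨ε, hε, he⟩ := Metric.eventually_nhds_iff.1 (e1.and e2)
    refine ⟨min δ (ε / 2), by positivity, min_le_left _ _, fun p hp => ?_⟩
    have := he (y := p) (by rw [dist_zero_right]; have := hp.trans (min_le_right _ _); linarith)
    exact ⟨this.1.le, this.2.le⟩
  set σ1 := y1 ^ (1 - a) with hσ
  have hσ0 : 0 < σ1 := Real.rpow_pos_of_pos hy1.1 _
  have hch : ∀ p : QQ m, ‖p‖ ≤ ρ → ∀ s : ℝ, |s| = 1 → ∀ y ∈ Set.Icc 0 y1,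
      V (p, s * y) + B * y ^ 2 ≤ V (p, 0) + y ^ (1 - a) * ((V (p, s * y1) + B * y1 ^ 2 - V (p, 0)) / σ1) := by
    intro p hp s hs y hy
    have := chord ha1 ha (v := trl p v) (by unfold trl; fun_prop) (fun ζ h => cd_trl (hv2 _ h)) hη hc h0
      (y0 := δ) (M := M) (B := B) (s := s) hs
      (fun q hq y hy hyδ => by
        rw [Lop_trl]; exact hL _ (hδU (hmem q hq p (hp.trans hρδ) y hyδ.le)) hy)
      (fun q hq y hyδ => hM _ (hmem q hq p (hp.trans hρδ) y hyδ.le)) hBM hy1.1 hy1.2 y hy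
    simp only [trl] at this
    simp only [hV]
    simpa only [add_comm p] using this
  refine no_wedge ha1 ha hVc hρ0 hy1.1 (A := (Dp 0 + μ) / σ1) (A' := (Dm 0 + μ) / σ1) (B := B) ?_ ?_ ?_ ?_
  · rw [← add_div]; apply div_neg_of_neg_of_pos _ hσ0; rw [hμ]; linarith
  · intro p hp y hy
    have := hch p hp 1 (by simp) y hy
    simp only [one_mul] at this
    refine this.trans ?_
    have := (hρ1 p hp).1
    have h3 : 0 ≤ y ^ (1 - a) := Real.rpow_nonneg hy.1 _
    gcongr
  · intro p hp y hy
    have := hch p hp (-1) (by simp) y hy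
    simp only [neg_one_mul] at this
    refine this.trans ?_
    have := (hρ1 p hp).2
    have h3 : 0 ≤ y ^ (1 - a) := Real.rpow_nonneg hy.1 _
    gcongr
  · intro K hK ε hε
    refine approx_conv hη.continuous hc h0 h1 hv (fun q hq => ?_) clsJ_conv hK hε
    refine ⟨by fun_prop, fun ζ h => cd_trl (p := q) (hv2 _ h), ?_, fun p => hsym (q + p)⟩
    intro ζ hz1 hz2 hz3
    have := Lop_trl a q v ζ
    change Lop a (trl q v) ζ ≤ 0
    rw [this]
    refine hL _ (hδU ?_) hz3
    rw [add_comm]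
    exact hmem q hq _ (hz1.le.trans hρδ) _ (hz2.le.trans hy1.2.le)

lemma lemJ {a : ℝ} (ha1 : -1 < a) (ha : a < 1) {v : FF m → ℝ} (hv : Continuous v)
    (hv2 : ∀ ζ : FF m, ζ.2 ≠ 0 → ContDiffAt ℝ 2 v ζ) (hsym : ∀ q, symSmall a v q)
    {U : Set (FF m)} (hU : IsOpen U) (hL : ∀ ζ ∈ U, ζ.2 ≠ 0 → Lop a v ζ ≤ 0)
    {η : QQ m → ℝ} (hη : ContDiff ℝ 2 η)
    (hc : HasCompactSupport η) (h0 : ∀ q, 0 ≤ η q)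
    (hηU : ∀ q ∈ tsupport η, ((q, 0) : FF m) ∈ U) :
    ∃ B y0 : ℝ, 0 < y0 ∧ 0 ≤ B ∧ ∀ y ∈ Set.Ioo 0 y0,
      -(B * y ^ 2) ≤ (∫ q, η q * v (q, y)) + (∫ q, η q * v (q, -y)) - 2 * ∫ q, η q * v (q, 0) := by
  have hi : Integrable η := hη.continuous.integrable_of_hasCompactSupport hc
  rcases (integral_nonneg h0 : 0 ≤ ∫ q, η q).lt_or_eq with hpos | hz
  · set c := ∫ q, η q with hcdef
    obtain ⟨B, y0, hy0, h⟩ := lemJ1 ha1 ha hv hv2 hsym hU hL (η := fun q => c⁻¹ * η q) (contDiff_const.mul hη)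
      hc.mul_left (fun q => mul_nonneg (by positivity) (h0 q)) (by rw [integral_const_mul, ← hcdef]; field_simp)
      (fun q hq => hηU q (tsupport_mul_subset_right hq))
    refine ⟨max (c * B) 0, y0, hy0, le_max_right _ _, fun y hy => ?_⟩
    have := h y hy
    simp only [mul_assoc, integral_const_mul] at this
    have h2 := mul_le_mul_of_nonneg_left this hpos.le
    have e : ∀ x, c * (c⁻¹ * x) = x := fun x => by field_simp
    simp only [mul_sub, mul_add, e] at h2
    rw [mul_left_comm c 2, e] at h2
    have := mul_le_mul_of_nonneg_right (le_max_left (c * B) 0) (sq_nonneg y)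
    linarith
  · have : η =ᵐ[volume] 0 := (integral_eq_zero_iff_of_nonneg h0 hi).1 hz.symm
    have h3 : η = 0 := hη.continuous.ae_eq_iff_eq volume continuous_zero |>.1 this
    exact ⟨0, 1, one_pos, le_rfl, fun y hy => by simp [h3]⟩
end

set_option linter.all false
noncomputable section
open Real MeasureTheory
variable {m : ℕ}

lemma hasDerivAt_pos_sq (t : ℝ) : HasDerivAt (fun t : ℝ => (max t 0) ^ 2) (2 * max t 0) t := by
  rcases lt_trichotomy t 0 with h | h | h
  · rw [max_eq_right h.le]
    refine (hasDerivAt_const t (0:ℝ)).congr_of_eventuallyEq ?_ |>.congr_deriv (by simp)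
    filter_upwards [gt_mem_nhds h] with s hs
    rw [max_eq_right (le_of_lt hs)]; simp
  · subst h
    rw [hasDerivAt_iff_isLittleO_nhds_zero]
    simp only [zero_add, max_self, smul_zero, mul_zero, sub_zero]
    have h1 : (fun h : ℝ => (max h 0) ^ 2 - 0 ^ 2) =O[nhds 0] fun h => h ^ 2 := by
      refine Asymptotics.IsBigO.of_bound 1 (Filter.Eventually.of_forall fun x => ?_)
      rw [zero_pow two_ne_zero, sub_zero, norm_pow, norm_pow, one_mul]
      gcongr
      rw [Real.norm_eq_abs, Real.norm_eq_abs, abs_of_nonneg (le_max_right _ _)]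
      exact max_le (le_abs_self _) (abs_nonneg _)
    refine h1.trans_isLittleO ?_
    exact (Asymptotics.isLittleO_pow_id one_lt_two)
  · rw [max_eq_left h.le]
    refine (hasDerivAt_pow 2 t).congr_of_eventuallyEq ?_ |>.congr_deriv (by simp)
    filter_upwards [lt_mem_nhds h] with s hs
    rw [max_eq_left (le_of_lt hs)]

def bq (s : ℝ) : ℝ := (s - 1/2) * (1 - s)
def bp (s : ℝ) : ℝ := (max (bq s) 0) ^ 2
def bp1 (s : ℝ) : ℝ := 2 * max (bq s) 0 * (3/2 - 2 * s)
lemma bp_der (s : ℝ) : HasDerivAt bp (bp1 s) s := by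
  have h : HasDerivAt bq (3/2 - 2 * s) s := by
    have := ((hasDerivAt_id s).sub_const (1/2)).mul ((hasDerivAt_id s).const_sub 1)
    exact this.congr_deriv (by simp; ring)
  exact (hasDerivAt_pos_sq (bq s)).comp s h
lemma bp_cont : Continuous bp := by unfold bp bq; fun_prop
lemma bp1_cont : Continuous bp1 := by unfold bp1 bq; fun_prop
lemma bp_nonneg (s : ℝ) : 0 ≤ bp s := by unfold bp; positivity
lemma bp_lo {s : ℝ} (h : s ≤ 1/2) : max (bq s) 0 = 0 := max_eq_right (by unfold bq; nlinarith)
lemma bp_hi {s : ℝ} (h : 1 ≤ s) : max (bq s) 0 = 0 := max_eq_right (by unfold bq; nlinarith)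
def bc : ℝ := ∫ x in (1/2:ℝ)..1, bp x
lemma bc_pos : 0 < bc := by
  unfold bc
  apply intervalIntegral.intervalIntegral_pos_of_pos_on (bp_cont.intervalIntegrable _ _) _ (by norm_num)
  intro x hx
  have : 0 < bq x := by unfold bq; nlinarith [hx.1, hx.2]
  unfold bp; rw [max_eq_left this.le]; positivity
def Th (s : ℝ) : ℝ := (∫ x in (1/2:ℝ)..s, bp x) / bc
def Th1 (s : ℝ) : ℝ := bp s / bc
def Th2 (s : ℝ) : ℝ := bp1 s / bc
lemma Th_der (s : ℝ) : HasDerivAt Th (Th1 s) s :=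
  (intervalIntegral.integral_hasDerivAt_right (bp_cont.intervalIntegrable _ _)
    (bp_cont.stronglyMeasurableAtFilter _ _) bp_cont.continuousAt).div_const _
lemma Th1_der (s : ℝ) : HasDerivAt Th1 (Th2 s) s := (bp_der s).div_const _
lemma Th1_cont : Continuous Th1 := bp_cont.div_const _
lemma Th2_cont : Continuous Th2 := bp1_cont.div_const _
lemma Th_cd : ContDiff ℝ 2 Th := by
  have h1 : deriv Th = Th1 := funext fun s => (Th_der s).deriv
  have h2 : deriv Th1 = Th2 := funext fun s => (Th1_der s).deriv
  have e1 : ContDiff ℝ 1 Th1 := by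
    rw [contDiff_one_iff_deriv, h2]
    exact ⟨fun s => (Th1_der s).differentiableAt, Th2_cont⟩
  rw [show (2 : WithTop ℕ∞) = 1 + 1 by norm_num, contDiff_succ_iff_deriv, h1]
  exact ⟨fun s => (Th_der s).differentiableAt, by simp, e1⟩
lemma Th_zero {s : ℝ} (h : s ≤ 1/2) : Th s = 0 := by
  unfold Th
  rw [intervalIntegral.integral_congr (g := fun _ => 0)]
  · simp
  · intro x hx
    rw [Set.uIcc_of_ge h] at hx
    simp only [bp, bp_lo hx.2]; norm_num
lemma Th1_lo {s : ℝ} (h : s ≤ 1/2) : Th1 s = 0 := by unfold Th1 bp; rw [bp_lo h]; simp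
lemma Th2_lo {s : ℝ} (h : s ≤ 1/2) : Th2 s = 0 := by unfold Th2 bp1; rw [bp_lo h]; simp
lemma Th1_hi {s : ℝ} (h : 1 ≤ s) : Th1 s = 0 := by unfold Th1 bp; rw [bp_hi h]; simp
lemma Th2_hi {s : ℝ} (h : 1 ≤ s) : Th2 s = 0 := by unfold Th2 bp1; rw [bp_hi h]; simp
lemma Th_mono : Monotone Th := monotone_of_deriv_nonneg (fun s => (Th_der s).differentiableAt) fun s => by
  rw [(Th_der s).deriv]; exact div_nonneg (bp_nonneg s) bc_pos.le
lemma Th_one' : Th 1 = 1 := div_self bc_pos.ne'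
lemma Th_one {s : ℝ} (h : 1 ≤ s) : Th s = 1 := by
  have e : Th s = Th 1 := by
    unfold Th
    rw [← intervalIntegral.integral_add_adjacent_intervals (bp_cont.intervalIntegrable (1/2) 1) (bp_cont.intervalIntegrable 1 s)]
    rw [intervalIntegral.integral_congr (a := 1) (b := s) (g := fun _ => 0)]
    · simp
    · intro x hx
      rw [Set.uIcc_of_le h] at hx
      simp only [bp, bp_hi hx.1]; norm_num
  rw [e, Th_one']
lemma Th_nonneg (s : ℝ) : 0 ≤ Th s := by
  rcases le_total s (1/2) with h | h
  · rw [Th_zero h]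
  · rw [← Th_zero le_rfl]; exact Th_mono h
lemma Th_le (s : ℝ) : Th s ≤ 1 := by
  rcases le_total s 1 with h | h
  · rw [← Th_one']; exact Th_mono h
  · rw [Th_one h]
lemma Th_bd : ∃ C, 0 ≤ C ∧ ∀ s, |Th1 s| ≤ C ∧ |Th2 s| ≤ C := by
  obtain ⟨C1, h1⟩ := (isCompact_Icc (a := (1/2:ℝ)) (b := 1)).exists_bound_of_continuousOn Th1_cont.continuousOn
  obtain ⟨C2, h2⟩ := (isCompact_Icc (a := (1/2:ℝ)) (b := 1)).exists_bound_of_continuousOn Th2_cont.continuousOn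
  refine ⟨max (max C1 C2) 0, le_max_right _ _, fun s => ?_⟩
  rcases le_total s (1/2) with h | h
  · rw [Th1_lo h, Th2_lo h]; simp
  rcases le_total 1 s with h' | h'
  · rw [Th1_hi h', Th2_hi h']; simp
  · exact ⟨(h1 s ⟨h, h'⟩).trans ((le_max_left _ _).trans (le_max_left _ _)), (h2 s ⟨h, h'⟩).trans ((le_max_right _ _).trans (le_max_left _ _))⟩
lemma Th2_sign (s : ℝ) : (s ≤ 3/4 → 0 ≤ Th2 s) ∧ (3/4 ≤ s → Th2 s ≤ 0) := by
  have : 0 ≤ max (bq s) 0 := le_max_right _ _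
  constructor
  · intro h
    refine div_nonneg ?_ bc_pos.le
    unfold bp1
    exact mul_nonneg (by positivity) (by linarith)
  · intro h
    refine div_nonpos_of_nonpos_of_nonneg ?_ bc_pos.le
    unfold bp1
    exact mul_nonpos_of_nonneg_of_nonpos (by positivity) (by linarith)

/-! the cutoff in y -/
def rr (a Y y : ℝ) : ℝ := |y| ^ (1 - a) / Y ^ (1 - a)
def th (a Y y : ℝ) : ℝ := Th (rr a Y y)
def th1 (a Y y : ℝ) : ℝ := Th1 (rr a Y y) * ((1 - a) * rr a Y y / y)
def th2 (a Y y : ℝ) : ℝ := Th2 (rr a Y y) * ((1 - a) * rr a Y y / y) ^ 2 + Th1 (rr a Y y) * (- a * (1 - a) * rr a Y y / y ^ 2)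
def jj (a Y y : ℝ) : ℝ := |y| ^ a * (Th2 (rr a Y y) * ((1 - a) * rr a Y y / y) ^ 2)

lemma rr_der (a Y : ℝ) {y : ℝ} (hy : y ≠ 0) : HasDerivAt (rr a Y) ((1 - a) * rr a Y y / y) y := by
  refine ((hasDerivAt_absrpow (1 - a) hy).div_const _).congr_deriv ?_
  unfold rr; ring
lemma th_der (a Y : ℝ) {y : ℝ} (hy : y ≠ 0) : HasDerivAt (th a Y) (th1 a Y y) y :=
  (Th_der _).comp y (rr_der a Y hy)
lemma th1_der (a Y : ℝ) {y : ℝ} (hy : y ≠ 0) : HasDerivAt (th1 a Y) (th2 a Y y) y := by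
  have h1 := (Th1_der _).comp y (rr_der a Y hy)
  have h2 := ((rr_der a Y hy).const_mul (1 - a)).div (hasDerivAt_id y) hy
  refine (h1.mul h2).congr_deriv ?_
  unfold th2
  simp only [id, Function.comp, Pi.div_apply]
  field_simp
  ring
lemma jj_eq (a Y : ℝ) {y : ℝ} (hy : y ≠ 0) : |y| ^ a * (th2 a Y y + a / y * th1 a Y y) = jj a Y y := by
  unfold jj th2 th1; congr 1; field_simp; ring
lemma k_der (a Y : ℝ) {y : ℝ} (hy : y ≠ 0) : HasDerivAt (fun y => |y| ^ a * th1 a Y y) (jj a Y y) y := by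
  refine ((hasDerivAt_absrpow a hy).mul (th1_der a Y hy)).congr_deriv ?_
  rw [← jj_eq a Y hy]; ring
lemma rr_cont {a : ℝ} (ha : a < 1) (Y : ℝ) : Continuous (rr a Y) := by
  unfold rr
  exact (continuous_abs.rpow_const (fun _ => Or.inr (by linarith))).div_const _
lemma rr_zero {a : ℝ} (ha : a < 1) (Y : ℝ) : rr a Y 0 = 0 := by
  unfold rr; rw [abs_zero, Real.zero_rpow (by linarith)]; simp
lemma rr_small {a : ℝ} (ha : a < 1) (Y : ℝ) : ∀ᶠ y in nhds (0:ℝ), rr a Y y < 1/2 := by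
  have := (rr_cont ha Y).tendsto 0
  rw [rr_zero ha] at this
  exact this.eventually (gt_mem_nhds (by norm_num))
lemma rr_big {a Y y : ℝ} (ha : a < 1) (hY : 0 < Y) (h : Y ≤ |y|) : 1 ≤ rr a Y y := by
  unfold rr
  rw [le_div_iff₀ (by positivity), one_mul]
  exact Real.rpow_le_rpow hY.le h (by linarith)
lemma th1_cont {a : ℝ} (ha : a < 1) (Y : ℝ) : Continuous (th1 a Y) := by
  rw [continuous_iff_continuousAt]
  intro y
  by_cases hy : y = 0
  · subst hy
    refine (continuousAt_const (y := (0:ℝ))).congr ?_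
    filter_upwards [rr_small ha Y] with y hy
    simp [th1, Th1_lo hy.le]
  · exact (th1_der a Y hy).continuousAt
lemma k_cont {a : ℝ} (ha : a < 1) (Y : ℝ) : Continuous (fun y => |y| ^ a * th1 a Y y) := by
  rw [continuous_iff_continuousAt]
  intro y
  by_cases hy : y = 0
  · subst hy
    refine (continuousAt_const (y := (0:ℝ))).congr ?_
    filter_upwards [rr_small ha Y] with y hy
    simp [th1, Th1_lo hy.le]
  · exact (k_der a Y hy).continuousAt
lemma jj_cont {a : ℝ} (ha : a < 1) (Y : ℝ) : Continuous (jj a Y) := by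
  rw [continuous_iff_continuousAt]
  intro y
  by_cases hy : y = 0
  · subst hy
    refine (continuousAt_const (y := (0:ℝ))).congr ?_
    filter_upwards [rr_small ha Y] with y hy
    simp [jj, Th2_lo hy.le]
  · unfold jj
    have h1 := (hasDerivAt_absrpow a hy).continuousAt
    have h2 := (rr_cont ha Y).continuousAt (x := y)
    have h3 := Th2_cont.comp (rr_cont ha Y) |>.continuousAt (x := y)
    exact h1.mul (h3.mul (((continuousAt_const.mul h2).div continuousAt_id hy).pow 2))
lemma k_der0 {a : ℝ} (ha : a < 1) (Y y : ℝ) : HasDerivAt (fun y => |y| ^ a * th1 a Y y) (jj a Y y) y := by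
  by_cases hy : y = 0
  · subst hy
    refine (hasDerivAt_const (0:ℝ) (0:ℝ)).congr_of_eventuallyEq ?_ |>.congr_deriv ?_
    · filter_upwards [rr_small ha Y] with y hy
      simp [th1, Th1_lo hy.le]
    · simp [jj]
  · exact k_der a Y hy
lemma th1_big {a Y y : ℝ} (ha : a < 1) (hY : 0 < Y) (h : Y ≤ |y|) : th1 a Y y = 0 := by
  unfold th1; rw [Th1_hi (rr_big ha hY h), zero_mul]
lemma jj_big {a Y y : ℝ} (ha : a < 1) (hY : 0 < Y) (h : Y ≤ |y|) : jj a Y y = 0 := by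
  unfold jj; rw [Th2_hi (rr_big ha hY h)]; simp
lemma th_big {a Y y : ℝ} (ha : a < 1) (hY : 0 < Y) (h : Y ≤ |y|) : th a Y y = 1 := by
  unfold th; rw [Th_one (rr_big ha hY h)]
lemma th_nonneg (a Y y : ℝ) : 0 ≤ th a Y y := Th_nonneg _
lemma th_le (a Y y : ℝ) : th a Y y ≤ 1 := Th_le _
lemma hcs_of_big {f : ℝ → ℝ} {Y : ℝ} (h : ∀ y, Y ≤ |y| → f y = 0) : HasCompactSupport f :=
  HasCompactSupport.intro (isCompact_closedBall (0:ℝ) Y) fun y hy => h y (by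
    simp only [Metric.mem_closedBall, dist_zero_right, Real.norm_eq_abs, not_le] at hy; exact hy.le)
lemma jj_int0 {a Y : ℝ} (ha : a < 1) (hY : 0 < Y) : ∫ y, jj a Y y = 0 := by
  apply integral_eq_zero_of_hasDerivAt_of_integrable (k_der0 ha Y)
  · exact (jj_cont ha Y).integrable_of_hasCompactSupport (hcs_of_big fun y hy => jj_big ha hY hy)
  · exact (k_cont ha Y).integrable_of_hasCompactSupport (hcs_of_big (Y := Y) fun y hy => by rw [th1_big ha hY hy, mul_zero])
lemma rr_neg (a Y y : ℝ) : rr a Y (-y) = rr a Y y := by unfold rr; rw [abs_neg]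
lemma jj_neg (a Y y : ℝ) : jj a Y (-y) = jj a Y y := by unfold jj; rw [abs_neg, rr_neg]; congr 2; rw [div_neg, neg_sq]
lemma th1_neg (a Y y : ℝ) : th1 a Y (-y) = - th1 a Y y := by unfold th1; rw [rr_neg, div_neg, mul_neg]

/-- dominating kernel -/
def DY (a Y y : ℝ) : ℝ := Set.indicator (Set.Icc (-Y) Y) (fun y => |y| ^ (-a) / Y ^ (1 - a)) y
lemma DY_nonneg {a Y : ℝ} (hY : 0 < Y) (y : ℝ) : 0 ≤ DY a Y y := by
  unfold DY; apply Set.indicator_nonneg; intro x _; positivity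
lemma abs_rpow_int {a : ℝ} (ha : a < 1) {Y : ℝ} (hY : 0 < Y) :
    IntervalIntegrable (fun y : ℝ => |y| ^ (-a)) volume (-Y) Y ∧ ∫ y in (-Y)..Y, |y| ^ (-a) = 2 * Y ^ (1 - a) / (1 - a) := by
  have i1 : IntervalIntegrable (fun y : ℝ => |y| ^ (-a)) volume 0 Y := by
    refine (intervalIntegral.intervalIntegrable_rpow' (by linarith : -1 < -a)).congr ?_
    rw [Set.uIoc_of_le hY.le]
    intro y hy
    simp [abs_of_pos hy.1]
  have i2 : IntervalIntegrable (fun y : ℝ => |y| ^ (-a)) volume (-Y) 0 := by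
    have := (IntervalIntegrable.iff_comp_neg (f := fun y : ℝ => |y| ^ (-a))).1 i1
    simp only [abs_neg, neg_zero] at this
    exact this.symm
  have e1 : ∫ y in (0:ℝ)..Y, |y| ^ (-a) = Y ^ (1 - a) / (1 - a) := by
    rw [intervalIntegral.integral_congr (g := fun y => y ^ (-a)), integral_rpow (Or.inl (by linarith))]
    · rw [Real.zero_rpow (by linarith), sub_zero, show -a + 1 = 1 - a by ring]
    · intro y hy
      rw [Set.uIcc_of_le hY.le] at hy
      simp [abs_of_nonneg hy.1]
  have e2 : ∫ y in (-Y)..0, |y| ^ (-a) = Y ^ (1 - a) / (1 - a) := by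
    rw [← e1]
    have := intervalIntegral.integral_comp_neg (a := (0:ℝ)) (b := Y) (fun y : ℝ => |y| ^ (-a))
    simp only [abs_neg, neg_zero] at this
    exact this.symm
  refine ⟨i2.trans i1, ?_⟩
  rw [← intervalIntegral.integral_add_adjacent_intervals i2 i1, e1, e2]; ring
lemma DY_int {a : ℝ} (ha : a < 1) {Y : ℝ} (hY : 0 < Y) :
    Integrable (DY a Y) ∧ ∫ y, DY a Y y = 2 / (1 - a) := by
  obtain ⟨h1, h2⟩ := abs_rpow_int ha hY
  have e : DY a Y = Set.indicator (Set.Icc (-Y) Y) (fun y => |y| ^ (-a) / Y ^ (1 - a)) := rfl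
  have hp := Real.rpow_pos_of_pos hY (1 - a)
  constructor
  · rw [e, integrable_indicator_iff measurableSet_Icc]
    rw [intervalIntegrable_iff_integrableOn_Icc_of_le (by linarith)] at h1
    exact h1.div_const _
  · rw [e, integral_indicator measurableSet_Icc, integral_Icc_eq_integral_Ioc, ← intervalIntegral.integral_of_le (by linarith),
      intervalIntegral.integral_div, h2]
    field_simp
lemma rr_div {a Y y : ℝ} (hY : 0 < Y) (hy : y ≠ 0) : |rr a Y y / y| = |y| ^ (-a) / Y ^ (1 - a) := by
  have hy0 := abs_pos.2 hy
  unfold rr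
  rw [abs_div, abs_of_nonneg (by positivity : 0 ≤ |y| ^ (1 - a) / Y ^ (1 - a))]
  rw [show 1 - a = -a + 1 by ring, Real.rpow_add_one hy0.ne']
  field_simp
lemma th1_bd {a C Y : ℝ} (ha : a < 1) (hC : ∀ s, |Th1 s| ≤ C ∧ |Th2 s| ≤ C) (hY : 0 < Y) (y : ℝ) :
    |th1 a Y y| ≤ (C * (1 - a)) * DY a Y y := by
  have hC0 : 0 ≤ C := (abs_nonneg _).trans (hC 0).1
  have h1a : 0 < 1 - a := by linarith
  have hd := DY_nonneg (a := a) hY y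
  by_cases hy : y = 0
  · subst hy; simp [th1]; positivity
  by_cases h : Y ≤ |y|
  · rw [th1_big ha hY h]; simp; positivity
  have e : DY a Y y = |y| ^ (-a) / Y ^ (1 - a) := by
    unfold DY; rw [Set.indicator_of_mem]; push Not at h; exact ⟨(abs_lt.1 h).1.le, (abs_lt.1 h).2.le⟩
  rw [e, ← rr_div hY hy]
  unfold th1
  rw [mul_div_assoc, abs_mul, abs_mul, abs_of_pos h1a, mul_assoc]
  have := (hC (rr a Y y)).1
  gcongr
lemma jj_bd {a C Y : ℝ} (ha : a < 1) (hC : ∀ s, |Th1 s| ≤ C ∧ |Th2 s| ≤ C) (hY : 0 < Y) (y : ℝ) :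
    |jj a Y y| * |y| ^ (1 - a) ≤ (C * (1 - a) ^ 2) * DY a Y y := by
  have hC0 : 0 ≤ C := (abs_nonneg _).trans (hC 0).1
  have h1a : 0 < 1 - a := by linarith
  have hd := DY_nonneg (a := a) hY y
  by_cases hy : y = 0
  · subst hy; simp [jj]; positivity
  by_cases h : Y ≤ |y|
  · rw [jj_big ha hY h]; simp; positivity
  have hy0 := abs_pos.2 hy
  push Not at h
  have e : DY a Y y = |y| ^ (-a) / Y ^ (1 - a) := by
    unfold DY; rw [Set.indicator_of_mem]; exact ⟨(abs_lt.1 h).1.le, (abs_lt.1 h).2.le⟩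
  rw [e]
  have hrd := rr_div (a := a) hY hy
  have hr1 : rr a Y y ≤ 1 := by
    unfold rr; rw [div_le_one (by positivity)]; exact Real.rpow_le_rpow hy0.le h.le h1a.le
  have hr0 : 0 ≤ rr a Y y := by unfold rr; positivity
  unfold jj
  rw [abs_mul, abs_mul, mul_div_assoc, abs_pow, abs_mul, abs_of_pos h1a, abs_of_nonneg (by positivity : 0 ≤ |y| ^ a)]
  have hh : |y| ^ a * |rr a Y y / y| * |y| ^ (1 - a) = rr a Y y := by
    rw [hrd]; unfold rr
    have : |y| ^ a * |y| ^ (-a) = 1 := by rw [← Real.rpow_add hy0]; simp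
    calc |y| ^ a * (|y| ^ (-a) / Y ^ (1 - a)) * |y| ^ (1 - a) = (|y| ^ a * |y| ^ (-a)) * (|y| ^ (1 - a) / Y ^ (1 - a)) := by ring
      _ = _ := by rw [this, one_mul]
  have := (hC (rr a Y y)).2
  calc |y| ^ a * (|Th2 (rr a Y y)| * ((1 - a) * |rr a Y y / y|) ^ 2) * |y| ^ (1 - a)
      = |Th2 (rr a Y y)| * (1 - a) ^ 2 * |rr a Y y / y| * (|y| ^ a * |rr a Y y / y| * |y| ^ (1 - a)) := by ring
    _ = |Th2 (rr a Y y)| * (1 - a) ^ 2 * (|y| ^ (-a) / Y ^ (1 - a)) * rr a Y y := by rw [hh, hrd]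
    _ ≤ C * (1 - a) ^ 2 * (|y| ^ (-a) / Y ^ (1 - a)) * 1 := by gcongr
    _ = _ := by ring
end

set_option linter.all false
noncomputable section
open Real MeasureTheory
variable {m : ℕ}

lemma lemJ2 {a : ℝ} (ha1 : -1 < a) (ha : a < 1) {v : FF m → ℝ} (hv : Continuous v)
    (hv2 : ∀ ζ : FF m, ζ.2 ≠ 0 → ContDiffAt ℝ 2 v ζ) (hsym : ∀ q, symSmall a v q)
    {U : Set (FF m)} (hU : IsOpen U) (hL : ∀ ζ ∈ U, ζ.2 ≠ 0 → Lop a v ζ ≤ 0)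
    {η : QQ m → ℝ} (hη : ContDiff ℝ 2 η)
    (hc : HasCompactSupport η) (h0 : ∀ q, 0 ≤ η q)
    (hηU : ∀ q ∈ tsupport η, ((q, 0) : FF m) ∈ U) :
    ∃ B y0 : ℝ, 0 < y0 ∧ 0 ≤ B ∧ ∀ y y1, 0 ≤ y → y ≤ y1 → y1 < y0 →
      (∫ q, η q * v (q, y)) + (∫ q, η q * v (q, -y)) + B * y ^ 2 ≤
      (∫ q, η q * v (q, y1)) + (∫ q, η q * v (q, -y1)) + B * y1 ^ 2 := by
  obtain ⟨B1, y01, hy01, hB1, hJ⟩ := lemJ ha1 ha hv hv2 hsym hU hL hη hc h0 hηU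
  set K0 : Set (FF m) := tsupport η ×ˢ {0} with hK0
  have hK0c : IsCompact K0 := hc.isCompact.prod isCompact_singleton
  have hK0U : K0 ⊆ U := by
    rintro ⟨q, y⟩ ⟨h1, h2⟩
    simp only [Set.mem_singleton_iff] at h2
    subst h2; exact hηU q h1
  obtain ⟨δ, hδ, hδU⟩ := hK0c.exists_cthickening_subset_open hU hK0U
  have hmem : ∀ q ∈ tsupport η, ∀ y : ℝ, |y| ≤ δ → ((q, y) : FF m) ∈ Metric.cthickening δ K0 := by
    intro q hq y hy
    refine Metric.mem_cthickening_of_dist_le _ ((q, 0) : FF m) _ _ ⟨hq, rfl⟩ ?_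
    rw [Prod.dist_eq]
    refine max_le ?_ ?_
    · simpa [dist_eq_norm] using hδ.le
    · simpa [dist_eq_norm] using hy
  obtain ⟨M, hM⟩ := hK0c.cthickening (r := δ) |>.exists_bound_of_continuousOn hv.continuousOn
  have h1a : 0 < 1 + a := by linarith
  set B := max ((M * (∫ q, |Hq η q|) + 1) / (2 * (1 + a))) B1 with hB
  have hBM : M * ∫ q, |Hq η q| < B * (2 * (1 + a)) := by
    have := le_max_left ((M * (∫ q, |Hq η q|) + 1) / (2 * (1 + a))) B1
    rw [div_le_iff₀ (by positivity)] at this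
    rw [hB]
    linarith
  have hBB : B1 ≤ B := le_max_right _ _
  refine ⟨2 * B, min δ y01, lt_min hδ hy01, by linarith, fun y y1 h1 h2 h3 => ?_⟩
  have hδ1 := h3.trans_le (min_le_left _ _)
  have hy1 := h3.trans_le (min_le_right _ _)
  rcases h2.eq_or_lt with h4 | h4
  · rw [h4]
  have hy0 : 0 < y1 := by linarith
  have hch := fun s hs => chord ha1 ha hv hv2 hη hc h0
      (y0 := δ) (M := M) (B := B) (s := s) hs
      (fun q hq y hy hyδ => hL _ (hδU (hmem q hq y hyδ.le)) hy)
      (fun q hq y hyδ => hM _ (hmem q hq y hyδ.le)) hBM hy0 hδ1 y ⟨h1, h2⟩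
  have c1 := hch 1 (by simp)
  have c2 := hch (-1) (by simp)
  simp only [one_mul, neg_one_mul] at c1 c2
  have hj := hJ y1 ⟨hy0, hy1⟩
  have hy1p := Real.rpow_pos_of_pos hy0 (1 - a)
  set X := ∫ q, η q * v (q, y1)
  set X' := ∫ q, η q * v (q, -y1)
  set Z := ∫ q, η q * v (q, 0)
  set P := ∫ q, η q * v (q, y)
  set P' := ∫ q, η q * v (q, -y)
  have hf0 : 0 ≤ X + X' - 2 * Z + 2 * B * y1 ^ 2 := by
    have := mul_le_mul_of_nonneg_right hBB (sq_nonneg y1)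
    have := mul_nonneg hB1 (sq_nonneg y1)
    linarith
  have hs : y ^ (1 - a) / y1 ^ (1 - a) ≤ 1 := by
    rw [div_le_one hy1p]; exact Real.rpow_le_rpow h1 h2 (by linarith)
  have : P + P' + 2 * B * y ^ 2 ≤ 2 * Z + y ^ (1 - a) / y1 ^ (1 - a) * (X + X' - 2 * Z + 2 * B * y1 ^ 2) := by
    have e : y ^ (1 - a) / y1 ^ (1 - a) * (X + X' - 2 * Z + 2 * B * y1 ^ 2) =
      y ^ (1 - a) * ((X + B * y1 ^ 2 - Z) / y1 ^ (1 - a)) + y ^ (1 - a) * ((X' + B * y1 ^ 2 - Z) / y1 ^ (1 - a)) := by ring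
    rw [e]; linarith
  have := mul_le_mul_of_nonneg_right hs hf0
  linarith

/-- the monotone part tested against `jj` -/
lemma jN_le {a : ℝ} (ha1 : -1 < a) (ha : a < 1) {N : ℝ → ℝ} (hN : Continuous N) {B y0 : ℝ} (hy0 : 0 < y0) (hB : 0 ≤ B)
    (hmono : ∀ y y1, 0 ≤ y → y ≤ y1 → y1 < y0 → N y + N (-y) + B * y ^ 2 ≤ N y1 + N (-y1) + B * y1 ^ 2)
    {C : ℝ} (hC : ∀ s, |Th1 s| ≤ C ∧ |Th2 s| ≤ C) {Y : ℝ} (hY : 0 < Y) (hYy : Y < y0) :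
    ∫ y, jj a Y y * N y ≤ B * Y ^ (1 + a) * (C * (1 - a) ^ 2) * (2 / (1 - a)) := by
  have hC0 : 0 ≤ C := (abs_nonneg _).trans (hC 0).1
  have h1a : 0 < 1 - a := by linarith
  have hjc := jj_cont ha Y
  have hjs : HasCompactSupport (jj a Y) := hcs_of_big fun y hy => jj_big ha hY hy
  have int : ∀ g : ℝ → ℝ, Continuous g → Integrable fun y => jj a Y y * g y := fun g hg =>
    (hjc.mul hg).integrable_of_hasCompactSupport hjs.mul_right
  set f : ℝ → ℝ := fun y => N y + N (-y) + B * y ^ 2 with hf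
  have hfev : ∀ y, f |y| = f y := by
    intro y
    rcases abs_cases y with ⟨h, _⟩ | ⟨h, _⟩
    · rw [h]
    · rw [h]; simp only [hf, neg_neg, neg_sq]; ring
  have hfc : Continuous f := by fun_prop
  have e0 : ∫ y, jj a Y y * N (-y) = ∫ y, jj a Y y * N y := by
    rw [← integral_neg_eq_self]
    simp only [neg_neg, jj_neg]
  -- threshold
  set yh := Y * (3/4 : ℝ) ^ (1 / (1 - a)) with hyh
  have hyh0 : 0 ≤ yh := by positivity
  have hyhY : yh ≤ Y := by
    rw [hyh]
    have : (3/4 : ℝ) ^ (1 / (1 - a)) ≤ 1 := Real.rpow_le_one (by norm_num) (by norm_num) (by positivity)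
    nlinarith
  have hyhr : yh ^ (1 - a) = 3/4 * Y ^ (1 - a) := by
    rw [hyh, Real.mul_rpow hY.le (by positivity), ← Real.rpow_mul (by norm_num), one_div_mul_cancel h1a.ne', Real.rpow_one]; ring
  have hYp := Real.rpow_pos_of_pos hY (1 - a)
  have key : ∀ y, jj a Y y * (f y - f yh) ≤ 0 := by
    intro y
    by_cases hy : Y ≤ |y|
    · rw [jj_big ha hY hy, zero_mul]
    push Not at hy
    rw [← hfev y]
    rcases le_total |y| yh with h | h
    · have hr : rr a Y y ≤ 3/4 := by
        unfold rr; rw [div_le_iff₀ hYp, ← hyhr]; exact Real.rpow_le_rpow (abs_nonneg _) h h1a.le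
      have h1 := hmono |y| yh (abs_nonneg _) h (hyhY.trans_lt hYy)
      have h2 := (Th2_sign (rr a Y y)).1 hr
      refine mul_nonpos_of_nonneg_of_nonpos ?_ (by simp only [hf]; linarith)
      unfold jj; positivity
    · have hr : 3/4 ≤ rr a Y y := by
        unfold rr; rw [le_div_iff₀ hYp, ← hyhr]; exact Real.rpow_le_rpow hyh0 h h1a.le
      have h1 := hmono yh |y| hyh0 h (hy.trans hYy)
      have h2 := (Th2_sign (rr a Y y)).2 hr
      refine mul_nonpos_of_nonpos_of_nonneg ?_ (by simp only [hf]; linarith)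
      unfold jj
      exact mul_nonpos_of_nonneg_of_nonpos (by positivity) (mul_nonpos_of_nonpos_of_nonneg h2 (by positivity))
  have k1 : ∫ y, jj a Y y * (f y - f yh) ≤ 0 := integral_nonpos key
  have k2 : ∫ y, jj a Y y * (f y - f yh) = 2 * (∫ y, jj a Y y * N y) + B * ∫ y, jj a Y y * y ^ 2 := by
    have e : (fun y => jj a Y y * (f y - f yh)) = fun y => (jj a Y y * N y + jj a Y y * N (-y)) + (B * (jj a Y y * y ^ 2) - jj a Y y * f yh) := by
      funext y; simp only [hf]; ring
    have i1 := int N hN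
    have i2 := int (fun y => N (-y)) (by fun_prop)
    have i3 : Integrable fun y => B * (jj a Y y * y ^ 2) := (int (fun y => y ^ 2) (by fun_prop)).const_mul B
    have i4 := int (fun y => f yh) (by fun_prop)
    have i12 : Integrable fun y => jj a Y y * N y + jj a Y y * N (-y) := i1.add i2
    have i34 : Integrable fun y => B * (jj a Y y * y ^ 2) - jj a Y y * f yh := i3.sub i4
    rw [e, integral_add i12 i34, integral_add i1 i2, integral_sub i3 i4, e0, integral_const_mul, integral_mul_const,
      jj_int0 ha hY]
    ring
  have k3 : |∫ y, jj a Y y * y ^ 2| ≤ Y ^ (1 + a) * (C * (1 - a) ^ 2) * (2 / (1 - a)) := by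
    obtain ⟨d1, d2⟩ := DY_int ha hY
    rw [← d2, ← integral_const_mul]
    refine abs_integral_le_integral_abs.trans (integral_mono (int _ (by fun_prop)).abs (d1.const_mul _) fun y => ?_)
    simp only
    rw [abs_mul]
    have hb := jj_bd ha hC hY y
    by_cases hy : Y ≤ |y|
    · rw [jj_big ha hY hy]; have := DY_nonneg (a := a) hY y; simp; positivity
    push Not at hy
    have hyy : |y ^ 2| ≤ |y| ^ (1 - a) * Y ^ (1 + a) := by
      rcases eq_or_ne y 0 with h | h
      · rw [h]; simp; positivity
      have hy0 := abs_pos.2 h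
      have : |y ^ 2| = |y| ^ (1 - a) * |y| ^ (1 + a) := by
        rw [← Real.rpow_add hy0, abs_pow]
        rw [show (1 - a + (1 + a)) = ((2 : ℕ) : ℝ) by push_cast; ring, Real.rpow_natCast]
      rw [this]
      have : 0 ≤ 1 + a := by linarith
      gcongr
    calc |jj a Y y| * |y ^ 2| ≤ |jj a Y y| * (|y| ^ (1 - a) * Y ^ (1 + a)) := by gcongr
      _ = Y ^ (1 + a) * (|jj a Y y| * |y| ^ (1 - a)) := by ring
      _ ≤ Y ^ (1 + a) * ((C * (1 - a) ^ 2) * DY a Y y) := by gcongr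
      _ = _ := by ring
  have := mul_le_mul_of_nonneg_left ((abs_le.1 k3).1) hB
  have : 0 ≤ B * Y ^ (1 + a) * (C * (1 - a) ^ 2) * (2 / (1 - a)) := by positivity
  nlinarith
end

set_option linter.all false
noncomputable section
open Real MeasureTheory
variable {m : ℕ}

/-- admissible test functions -/
structure TestFn (a : ℝ) (U : Set (FF m)) (ψ W : FF m → ℝ) : Prop where
  cont : Continuous ψ
  hcs : HasCompactSupport ψ
  nn : ∀ ζ, 0 ≤ ψ ζ
  sub : tsupport ψ ⊆ U
  cd : ∀ ζ : FF m, ζ.2 ≠ 0 → ContDiffAt ℝ 2 ψ ζ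
  Wc : Continuous W
  Weq : ∀ ζ : FF m, ζ.2 ≠ 0 → W ζ = |ζ.2| ^ a * dd dY ψ ζ
  eta : ContDiff ℝ 2 (fun q : QQ m => ψ (q, 0))
  int : Integrable (Lst a ψ)

/-- admissible subsolutions -/
structure SubSol (a : ℝ) (U : Set (FF m)) (v : FF m → ℝ) : Prop where
  cont : Continuous v
  cd : ∀ ζ : FF m, ζ.2 ≠ 0 → ContDiffAt ℝ 2 v ζ
  sym : ∀ q, symSmall a v q
  le : ∀ ζ ∈ U, ζ.2 ≠ 0 → Lop a v ζ ≤ 0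

lemma Lst_mul_th {a Y : ℝ} (ha : a < 1) {U : Set (FF m)} {ψ W : FF m → ℝ} (h : TestFn a U ψ W) (ζ : FF m) :
    Lst a (fun ζ => ψ ζ * th a Y ζ.2) ζ = th a Y ζ.2 * Lst a ψ ζ + (2 * W ζ * th1 a Y ζ.2 + ψ ζ * jj a Y ζ.2) := by
  by_cases hy : ζ.2 = 0
  · have h0 : ∀ᶠ x : FF m in nhds ζ, rr a Y x.2 < 1/2 := by
      have : Filter.Tendsto (fun x : FF m => x.2) (nhds ζ) (nhds 0) := by rw [← hy]; exact continuous_snd.tendsto ζ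
      exact this.eventually (rr_small ha Y)
    have hz : (fun ζ : FF m => ψ ζ * th a Y ζ.2) =ᶠ[nhds ζ] fun _ => 0 := by
      filter_upwards [h0] with x hx
      simp [th, Th_zero hx.le]
    have d1 : ∀ d : FF m, dd d (fun ζ : FF m => ψ ζ * th a Y ζ.2) =ᶠ[nhds ζ] fun _ => 0 := by
      intro d
      filter_upwards [hz.eventuallyEq_nhds] with x hx
      rw [dd_congr d hx]; simp [dd]
    have d2 : ∀ d : FF m, dd d (dd d (fun ζ : FF m => ψ ζ * th a Y ζ.2)) ζ = 0 := by
      intro d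
      rw [dd_congr d (d1 d)]; simp [dd]
    have e1 : th a Y ζ.2 = 0 := by rw [hy]; simp [th, rr_zero ha, Th_zero]
    have e2 : th1 a Y ζ.2 = 0 := by rw [hy]; simp [th1]
    have e3 : jj a Y ζ.2 = 0 := by rw [hy]; simp [jj]
    simp [Lst, d2, (d1 _).self_of_nhds, e1, e2, e3]
  · have hthd : ∀ x : FF m, x.2 ≠ 0 → ∀ d : FF m, dd d (fun ζ : FF m => th a Y ζ.2) x = th1 a Y x.2 * d.2 := fun x hx d => by
      have := th_der a Y hx
      rw [dd_dir_fun this.differentiableAt, this.deriv]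
    have hth1d : ∀ x : FF m, x.2 ≠ 0 → ∀ d : FF m, dd d (fun ζ : FF m => th1 a Y ζ.2) x = th2 a Y x.2 * d.2 := fun x hx d => by
      have := th1_der a Y hx
      rw [dd_dir_fun this.differentiableAt, this.deriv]
    have da : ∀ x : FF m, x.2 ≠ 0 → DifferentiableAt ℝ (fun ζ : FF m => th a Y ζ.2) x := fun x hx =>
      (th_der a Y hx).differentiableAt.comp x differentiableAt_snd
    have da1 : ∀ x : FF m, x.2 ≠ 0 → DifferentiableAt ℝ (fun ζ : FF m => th1 a Y ζ.2) x := fun x hx =>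
      (th1_der a Y hx).differentiableAt.comp x differentiableAt_snd
    have d1 : ∀ x : FF m, x.2 ≠ 0 → ∀ d : FF m, dd d (fun ζ : FF m => ψ ζ * th a Y ζ.2) x =
        ψ x * (th1 a Y x.2 * d.2) + th a Y x.2 * dd d ψ x := fun x hx d => by
      rw [dd_mul d (cdAt_da (h.cd x hx)) (da x hx), hthd x hx]
    have d2 : ∀ d : FF m, dd d (dd d (fun ζ : FF m => ψ ζ * th a Y ζ.2)) ζ =
        ψ ζ * (th2 a Y ζ.2 * d.2 * d.2) + 2 * (th1 a Y ζ.2 * d.2) * dd d ψ ζ + th a Y ζ.2 * dd d (dd d ψ) ζ := by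
      intro d
      have ev : dd d (fun ζ : FF m => ψ ζ * th a Y ζ.2) =ᶠ[nhds ζ] fun x => (ψ x * (th1 a Y x.2 * d.2)) + th a Y x.2 * dd d ψ x := by
        filter_upwards [ne_nhds hy] with x hx
        exact d1 x hx d
      have a1 : DifferentiableAt ℝ (fun x : FF m => th1 a Y x.2 * d.2) ζ := (da1 ζ hy).mul_const _
      have a2 : DifferentiableAt ℝ (fun x : FF m => ψ x * (th1 a Y x.2 * d.2)) ζ := (cdAt_da (h.cd ζ hy)).mul a1
      have a3 : DifferentiableAt ℝ (fun x : FF m => th a Y x.2 * dd d ψ x) ζ := (da ζ hy).mul (cdAt_dda (h.cd ζ hy) d)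
      have a4 : dd d (fun x : FF m => th1 a Y x.2 * d.2) ζ = d.2 * (th2 a Y ζ.2 * d.2) := by
        have : (fun x : FF m => th1 a Y x.2 * d.2) = fun x => d.2 * th1 a Y x.2 := by funext x; ring
        rw [this, dd_const_mul d d.2 (da1 ζ hy), hth1d ζ hy]
      rw [dd_congr d ev, dd_add d a2 a3, dd_mul d (cdAt_da (h.cd ζ hy)) a1, dd_mul d (da ζ hy) (cdAt_dda (h.cd ζ hy) d), a4, hthd ζ hy]
      ring
    have eT' : (dT : FF m).2 = 0 := rfl
    have eI' : ∀ i, (dI i : FF m).2 = 0 := fun _ => rfl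
    have eY' : (dY : FF m).2 = 1 := rfl
    rw [h.Weq ζ hy, ← jj_eq a Y hy]
    simp only [Lst, d1 ζ hy, d2, eT', eI', eY', mul_zero, zero_mul, zero_add, mul_one]
    rw [← Finset.mul_sum]
    ring

lemma testfn_vanish {a : ℝ} {U : Set (FF m)} {ψ W : FF m → ℝ} (h : TestFn a U ψ W) :
    ∃ R, 0 < R ∧ ∀ ζ : FF m, R < ‖ζ‖ → ψ ζ = 0 ∧ W ζ = 0 := by
  obtain ⟨R, hR⟩ := h.hcs.isCompact.isBounded.subset_closedBall (0 : FF m)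
  refine ⟨max R 1, by positivity, fun ζ hz => ?_⟩
  have hn : ∀ x : FF m, max R 1 < ‖x‖ → x ∉ tsupport ψ := fun x hx hx' => by
    have := hR hx'
    rw [mem_closedBall_zero_iff] at this
    exact absurd (this.trans (le_max_left _ 1)) (not_le.2 hx)
  refine ⟨image_eq_zero_of_notMem_tsupport (hn ζ hz), ?_⟩
  have hoff : ∀ x : FF m, max R 1 < ‖x‖ → x.2 ≠ 0 → W x = 0 := fun x hx hx0 => by
    rw [h.Weq x hx0, image_eq_zero_of_notMem_tsupport (fun h' => hn x hx (tsupport_dd _ h')), mul_zero]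
  have c1 : Filter.Tendsto (fun y : ℝ => ((ζ.1, y) : FF m)) (nhds ζ.2) (nhds ζ) :=
    (Continuous.prodMk_right ζ.1).tendsto ζ.2
  have c2 := c1.eventually ((continuous_norm.tendsto ζ).eventually (lt_mem_nhds hz))
  by_cases h0 : ζ.2 = 0
  · rw [h0] at c1 c2
    have c3 : Filter.Tendsto (fun y : ℝ => W (ζ.1, y)) (nhdsWithin 0 {0}ᶜ) (nhds (W ζ)) :=
      ((h.Wc.tendsto ζ).comp c1).mono_left nhdsWithin_le_nhds
    have c4 : Filter.Tendsto (fun y : ℝ => W (ζ.1, y)) (nhdsWithin 0 {0}ᶜ) (nhds 0) := by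
      refine tendsto_const_nhds.congr' ?_
      filter_upwards [nhdsWithin_le_nhds c2, self_mem_nhdsWithin] with y hy hy'
      exact (hoff _ hy hy').symm
    exact tendsto_nhds_unique c3 c4
  · exact hoff ζ hz h0

lemma small_near {g : FF m → ℝ} (hg : Continuous g) (hg0 : ∀ q, g (q, 0) = 0) (R : ℝ) {ω : ℝ} (hω : 0 < ω) :
    ∃ δ > 0, ∀ q : QQ m, ‖q‖ ≤ R → ∀ y : ℝ, |y| ≤ δ → |g (q, y)| ≤ ω := by
  have hK : IsCompact (Metric.closedBall (0 : QQ m) R ×ˢ {(0:ℝ)}) := (isCompact_closedBall _ _).prod isCompact_singleton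
  have hO : IsOpen {ζ : FF m | |g ζ| < ω} := isOpen_lt (by fun_prop) continuous_const
  obtain ⟨δ, hδ, h⟩ := hK.exists_cthickening_subset_open hO (by
    rintro ⟨q, y⟩ ⟨h1, h2⟩
    simp only [Set.mem_singleton_iff] at h2
    subst h2
    simp only [Set.mem_setOf_eq, hg0, abs_zero]; exact hω)
  refine ⟨δ, hδ, fun q hq y hy => le_of_lt (h ?_)⟩
  refine Metric.mem_cthickening_of_dist_le _ ((q, 0) : FF m) _ _ ⟨by simpa using hq, rfl⟩ ?_
  rw [Prod.dist_eq]
  refine max_le ?_ ?_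
  · simpa [dist_eq_norm] using hδ.le
  · simpa [dist_eq_norm] using hy

lemma hold_half {h h' : ℝ → ℝ} {a C : ℝ} (ha : a < 1) (hc : Continuous h) (hd : ∀ y > 0, HasDerivAt h (h' y) y)
    (hb : ∀ y > 0, |y| ^ a * h' y ≤ C) {y : ℝ} (hy : 0 ≤ y) : h y - h 0 ≤ C / (1 - a) * y ^ (1 - a) := by
  have h1a : 0 < 1 - a := by linarith
  have hpc : Continuous fun y : ℝ => y ^ (1 - a) := Real.continuous_rpow_const h1a.le
  have : MonotoneOn (fun y => C / (1 - a) * y ^ (1 - a) - h y) (Set.Ici 0) := by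
    have hder : ∀ y > 0, HasDerivAt (fun y => C / (1 - a) * y ^ (1 - a) - h y) (C * y ^ (-a) - h' y) y := by
      intro y hy
      have := ((Real.hasDerivAt_rpow_const (p := 1 - a) (Or.inl hy.ne')).const_mul (C / (1 - a))).sub (hd y hy)
      refine this.congr_deriv ?_
      rw [show 1 - a - 1 = -a by ring]; field_simp
    refine monotoneOn_of_deriv_nonneg (convex_Ici 0) (by fun_prop) ?_ ?_
    · rw [interior_Ici]; intro y hy; exact (hder y hy).differentiableAt.differentiableWithinAt
    · rw [interior_Ici]; intro y hy
      have hy : 0 < y := hy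
      rw [(hder y hy).deriv]
      have := hb y hy
      rw [abs_of_pos hy] at this
      have hp := Real.rpow_pos_of_pos hy a
      rw [Real.rpow_neg hy.le, ← div_eq_mul_inv, sub_nonneg, le_div_iff₀ hp]
      linarith
  have := this (Set.self_mem_Ici) hy hy
  simp only [Real.zero_rpow h1a.ne', mul_zero] at this
  linarith

lemma hold {h h' : ℝ → ℝ} {a C : ℝ} (ha : a < 1) (hc : Continuous h) (hd : ∀ y, y ≠ 0 → HasDerivAt h (h' y) y)
    (hb : ∀ y, y ≠ 0 → |(|y| ^ a * h' y)| ≤ C) (y : ℝ) : |h y - h 0| ≤ C / (1 - a) * |y| ^ (1 - a) := by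
  have p1 : ∀ h h' : ℝ → ℝ, Continuous h → (∀ y, y ≠ 0 → HasDerivAt h (h' y) y) → (∀ y, y ≠ 0 → |(|y| ^ a * h' y)| ≤ C) →
      ∀ y, 0 ≤ y → |h y - h 0| ≤ C / (1 - a) * |y| ^ (1 - a) := by
    intro h h' hc hd hb y hy
    rw [abs_of_nonneg hy, abs_le]
    constructor
    · have := hold_half (h := fun y => - h y) (h' := fun y => - h' y) (C := C) ha (by fun_prop) (fun y hy => (hd y hy.ne').neg) (fun y hy => by
        have := (abs_le.1 (hb y hy.ne')).1; linarith) hy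
      linarith
    · exact hold_half ha hc (fun y hy => hd y hy.ne') (fun y hy => (abs_le.1 (hb y hy.ne')).2) hy
  rcases le_total 0 y with hy | hy
  · exact p1 h h' hc hd hb y hy
  · have := p1 (fun y => h (-y)) (fun y => - h' (-y)) (by fun_prop) (fun y hy => by
      have := (hd (-y) (by simpa using hy)).scomp y (hasDerivAt_neg y)
      exact this.congr_deriv (by simp)) (fun y hy => by
      have := hb (-y) (by simpa using hy)
      rw [abs_neg] at this
      rw [mul_neg, abs_neg]; exact this) (-y) (by linarith)
    simpa using this
end

set_option linter.all false
noncomputable section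
open Real MeasureTheory
variable {m : ℕ}

lemma fiber_id {a Y : ℝ} (ha : a < 1) (hY : 0 < Y) {U : Set (FF m)} {ψ W : FF m → ℝ} (h : TestFn a U ψ W) (q : QQ m) :
    ∫ y, (2 * W (q, y) * th1 a Y y + (ψ (q, y) - ψ (q, 0)) * jj a Y y) = ∫ y, (W (q, y) - W (q, 0)) * th1 a Y y := by
  have hψ := h.cont
  have hW := h.Wc
  have ht := th1_cont ha Y
  have hj := jj_cont ha Y
  have hts : HasCompactSupport (th1 a Y) := hcs_of_big fun y hy => th1_big ha hY hy
  have hjs : HasCompactSupport (jj a Y) := hcs_of_big fun y hy => jj_big ha hY hy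
  have i1 : Integrable fun y => W (q, y) * th1 a Y y :=
    Continuous.integrable_of_hasCompactSupport (by fun_prop) hts.mul_left
  have i2 : Integrable fun y => ψ (q, y) * jj a Y y :=
    Continuous.integrable_of_hasCompactSupport (by fun_prop) hjs.mul_left
  have i3 : Integrable fun y => W (q, 0) * th1 a Y y :=
    Continuous.integrable_of_hasCompactSupport (by fun_prop) hts.mul_left
  have i4 : Integrable fun y => ψ (q, 0) * jj a Y y :=
    Continuous.integrable_of_hasCompactSupport (by fun_prop) hjs.mul_left
  have z1 : ∫ y, th1 a Y y = 0 := by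
    have := integral_neg_eq_self (fun y => th1 a Y y) volume
    simp only [th1_neg, integral_neg] at this
    linarith
  have k0 : ∫ y, (W (q, y) * th1 a Y y + ψ (q, y) * jj a Y y) = 0 := by
    refine integral_eq_zero_of_hasDerivAt_of_integrable (f := fun y => ψ (q, y) * (|y| ^ a * th1 a Y y)) ?_ (i1.add i2) ?_
    · intro y
      by_cases hy : y = 0
      · subst hy
        refine (hasDerivAt_const (0:ℝ) (0:ℝ)).congr_of_eventuallyEq ?_ |>.congr_deriv ?_
        · filter_upwards [rr_small ha Y] with y hy
          simp [th1, Th1_lo hy.le]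
        · simp [jj, th1]
      · have d1 := dd_dY_eq (ζ := (q, y)) (cdAt_da (h.cd (q, y) hy))
        refine (d1.mul (k_der a Y hy)).congr_deriv ?_
        rw [h.Weq (q, y) hy]; simp only; ring
    · have hk := k_cont ha Y
      exact Continuous.integrable_of_hasCompactSupport (by fun_prop) (hts.mul_left.mul_left)
  have e : (fun y => 2 * W (q, y) * th1 a Y y + (ψ (q, y) - ψ (q, 0)) * jj a Y y) =
      fun y => (W (q, y) * th1 a Y y + ψ (q, y) * jj a Y y) + (W (q, y) * th1 a Y y - ψ (q, 0) * jj a Y y) := by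
    funext y; ring
  have i12 : Integrable fun y => W (q, y) * th1 a Y y + ψ (q, y) * jj a Y y := i1.add i2
  have i14 : Integrable fun y => W (q, y) * th1 a Y y - ψ (q, 0) * jj a Y y := i1.sub i4
  rw [e, integral_add i12 i14, k0, integral_sub i1 i4, integral_const_mul, jj_int0 ha hY]
  simp only [sub_mul]
  rw [integral_sub i1 i3, integral_const_mul, z1]
  ring

lemma E_small {a : ℝ} (ha1 : -1 < a) (ha : a < 1) {U : Set (FF m)} (hU : IsOpen U) {ψ W v : FF m → ℝ}
    (h : TestFn a U ψ W) (hs : SubSol a U v) {ε : ℝ} (hε : 0 < ε) :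
    ∃ Y1 > 0, ∀ Y, 0 < Y → Y < Y1 → ∫ ζ : FF m, v ζ * (2 * W ζ * th1 a Y ζ.2 + ψ ζ * jj a Y ζ.2) ≤ ε := by
  have hψ := h.cont
  have hW := h.Wc
  have hv := hs.cont
  have h1a : 0 < 1 - a := by linarith
  have h1a' : 0 < 1 + a := by linarith
  obtain ⟨R, hR0, hR⟩ := testfn_vanish h
  obtain ⟨C, hC0, hC⟩ := Th_bd
  have vq : ∀ (q : QQ m) y, R < ‖q‖ → ψ (q, y) = 0 ∧ W (q, y) = 0 := fun q y hq =>
    hR (q, y) (hq.trans_le (norm_fst_le (q, y)))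
  set η : QQ m → ℝ := fun q => ψ (q, 0) with hη
  have ηs : HasCompactSupport η := HasCompactSupport.intro (isCompact_closedBall (0 : QQ m) R) fun q hq => by
    rw [mem_closedBall_zero_iff, not_le] at hq
    exact (vq q 0 hq).1
  have ηc : Continuous η := by fun_prop
  obtain ⟨B, y0, hy0, hB, hmono⟩ := lemJ2 ha1 ha hv hs.cd hs.sym hU hs.le h.eta ηs (fun q => h.nn _) (fun q hq => h.sub (by
    have := tsupport_comp_subset_preimage ψ (f := fun q : QQ m => ((q, 0) : FF m)) (by fun_prop) hq
    exact this))
  have Ws : HasCompactSupport W := HasCompactSupport.intro (isCompact_closedBall (0 : FF m) R) fun q hq => by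
    rw [mem_closedBall_zero_iff, not_le] at hq
    exact (hR q hq).2
  obtain ⟨CW, hCW⟩ := hW.bounded_above_of_compact_support Ws
  have hCW0 : 0 ≤ CW := (norm_nonneg _).trans (hCW 0)
  have hv0c : Continuous fun q : QQ m => v (q, 0) := by fun_prop
  obtain ⟨Cv, hCv⟩ := (isCompact_closedBall (0 : QQ m) R).exists_bound_of_continuousOn hv0c.continuousOn
  have hCv0 : 0 ≤ Cv := (norm_nonneg _).trans (hCv 0 (by simp [hR0.le]))
  have hζ : ∀ q y, |ψ (q, y) - ψ (q, 0)| ≤ CW / (1 - a) * |y| ^ (1 - a) := fun q y =>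
    hold (h := fun y => ψ (q, y)) (h' := fun y => dd dY ψ (q, y)) ha (by fun_prop)
      (fun y hy => dd_dY_eq (ζ := (q, y)) (cdAt_da (h.cd (q, y) hy)))
      (fun y hy => by have := hCW (q, y); rw [h.Weq (q, y) hy] at this; exact this) y
  set vol := ∫ q : QQ m, Set.indicator (Metric.closedBall (0 : QQ m) R) (fun _ => (1:ℝ)) q with hvol
  have voli : Integrable fun q : QQ m => Set.indicator (Metric.closedBall (0 : QQ m) R) (fun _ => (1:ℝ)) q := by
    rw [integrable_indicator_iff measurableSet_closedBall]
    exact integrableOn_const (isCompact_closedBall _ _).measure_lt_top.ne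
  have vol0 : 0 ≤ vol := integral_nonneg fun q => Set.indicator_nonneg (fun _ _ => zero_le_one) q
  set K := (2 * CW * (C * (1 - a)) + CW / (1 - a) * (C * (1 - a) ^ 2) + Cv * (C * (1 - a))) * (vol * (2 / (1 - a))) with hK
  have hK0 : 0 ≤ K := by positivity
  set ω := ε / (2 * (K + 1)) with hω
  have hω0 : 0 < ω := by positivity
  have hωK : ω * K ≤ ε / 2 := by
    rw [hω, div_mul_eq_mul_div, div_le_div_iff₀ (by positivity) (by norm_num)]; nlinarith
  obtain ⟨δ1, hδ1, hd1⟩ := small_near (g := fun ζ : FF m => v ζ - v (ζ.1, 0)) (by fun_prop) (fun q => by simp) R hω0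
  obtain ⟨δ2, hδ2, hd2⟩ := small_near (g := fun ζ : FF m => W ζ - W (ζ.1, 0)) (by fun_prop) (fun q => by simp) R hω0
  obtain ⟨δ3, hδ3, hd3⟩ : ∃ δ > 0, ∀ Y, 0 < Y → Y < δ → B * Y ^ (1 + a) * (C * (1 - a) ^ 2) * (2 / (1 - a)) ≤ ε / 2 := by
    have hc : Continuous fun Y : ℝ => B * Y ^ (1 + a) * (C * (1 - a) ^ 2) * (2 / (1 - a)) := by
      have := Real.continuous_rpow_const h1a'.le
      fun_prop
    have := (hc.tendsto 0).eventually (gt_mem_nhds (show B * (0:ℝ) ^ (1 + a) * (C * (1 - a) ^ 2) * (2 / (1 - a)) < ε / 2 by rw [Real.zero_rpow h1a'.ne']; simp only [mul_zero, zero_mul]; linarith))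
    obtain ⟨δ, hδ, hh⟩ := Metric.eventually_nhds_iff.1 this
    exact ⟨δ, hδ, fun Y hY hY' => (hh (by rw [dist_zero_right, Real.norm_eq_abs, abs_of_pos hY]; exact hY')).le⟩
  refine ⟨min (min δ1 δ2) (min δ3 y0), by positivity, fun Y hY hY1 => ?_⟩
  have l1 : Y < δ1 := hY1.trans_le ((min_le_left _ _).trans (min_le_left _ _))
  have l2 : Y < δ2 := hY1.trans_le ((min_le_left _ _).trans (min_le_right _ _))
  have l3 : Y < δ3 := hY1.trans_le ((min_le_right _ _).trans (min_le_left _ _))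
  have l4 : Y < y0 := hY1.trans_le ((min_le_right _ _).trans (min_le_right _ _))
  have ht := th1_cont ha Y
  have hj := jj_cont ha Y
  -- compact support criterion
  have hIntg : ∀ g : FF m → ℝ, Continuous g → (∀ ζ : FF m, R < ‖ζ.1‖ → g ζ = 0) → (∀ ζ : FF m, Y ≤ |ζ.2| → g ζ = 0) → Integrable g := by
    intro g hg g1 g2
    refine hg.integrable_of_hasCompactSupport (HasCompactSupport.intro
      ((isCompact_closedBall (0 : QQ m) R).prod (isCompact_closedBall (0 : ℝ) Y)) fun ζ hz => ?_)
    rw [Set.mem_prod, not_and_or, mem_closedBall_zero_iff, mem_closedBall_zero_iff, not_le, not_le] at hz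
    rcases hz with hz | hz
    · exact g1 ζ hz
    · exact g2 ζ (le_of_lt hz)
  have tz : ∀ y : ℝ, Y ≤ |y| → th1 a Y y = 0 := fun y hy => th1_big ha hY hy
  have jz : ∀ y : ℝ, Y ≤ |y| → jj a Y y = 0 := fun y hy => jj_big ha hY hy
  set H : FF m → ℝ := fun ζ => 2 * W ζ * th1 a Y ζ.2 + (ψ ζ - ψ (ζ.1, 0)) * jj a Y ζ.2 with hH
  have Hc : Continuous H := by fun_prop
  have H1 : ∀ ζ : FF m, R < ‖ζ.1‖ → H ζ = 0 := fun ζ hz => by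
    simp only [hH]
    rw [(vq ζ.1 ζ.2 hz).1, (vq ζ.1 ζ.2 hz).2, (vq ζ.1 0 hz).1]; simp
  have H2 : ∀ ζ : FF m, Y ≤ |ζ.2| → H ζ = 0 := fun ζ hz => by
    simp only [hH]
    rw [tz _ hz, jz _ hz]; simp
  set g1 : FF m → ℝ := fun ζ => η ζ.1 * v ζ * jj a Y ζ.2 with hg1
  set g2 : FF m → ℝ := fun ζ => (v ζ - v (ζ.1, 0)) * H ζ with hg2
  set g3 : FF m → ℝ := fun ζ => v (ζ.1, 0) * H ζ with hg3
  set g4 : FF m → ℝ := fun ζ => v (ζ.1, 0) * ((W ζ - W (ζ.1, 0)) * th1 a Y ζ.2) with hg4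
  have i1 : Integrable g1 := hIntg g1 (by fun_prop) (fun ζ hz => by
    have : η ζ.1 = 0 := (vq ζ.1 0 hz).1
    simp [hg1, this]) (fun ζ hz => by simp [hg1, jz _ hz])
  have i2 : Integrable g2 := hIntg g2 (by fun_prop) (fun ζ hz => by simp [hg2, H1 _ hz]) (fun ζ hz => by simp [hg2, H2 _ hz])
  have i3 : Integrable g3 := hIntg g3 (by fun_prop) (fun ζ hz => by simp [hg3, H1 _ hz]) (fun ζ hz => by simp [hg3, H2 _ hz])
  have i4 : Integrable g4 := hIntg g4 (by fun_prop) (fun ζ hz => by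
    simp only [hg4]; rw [(vq ζ.1 ζ.2 hz).2, (vq ζ.1 0 hz).2]; simp) (fun ζ hz => by simp [hg4, tz _ hz])
  have dec : (fun ζ : FF m => v ζ * (2 * W ζ * th1 a Y ζ.2 + ψ ζ * jj a Y ζ.2)) = fun ζ => g1 ζ + (g2 ζ + g3 ζ) := by
    funext ζ; simp only [hg1, hg2, hg3, hH, hη]; ring
  have i23 : Integrable fun ζ => g2 ζ + g3 ζ := i2.add i3
  rw [dec, integral_add i1 i23, integral_add i2 i3]
  have t1 : ∫ ζ, g1 ζ ≤ ε / 2 := by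
    have e : ∫ ζ, g1 ζ = ∫ y, jj a Y y * ∫ q, η q * v (q, y) := by
      rw [Measure.volume_eq_prod, integral_prod_symm _ (by rw [← Measure.volume_eq_prod]; exact i1)]
      congr 1; funext y
      simp only [hg1]
      rw [integral_mul_const, mul_comm]
    rw [e]
    have hN : Continuous fun y : ℝ => ∫ q, η q * v (q, y) := by
      have := (continuous_pint ηc ηs hv).comp (Continuous.prodMk_right (0 : QQ m))
      simpa [Function.comp_def] using this
    exact (jN_le ha1 ha hN hy0 hB hmono hC hY l4).trans (hd3 Y hY l3)
  have e34 : ∫ ζ, g3 ζ = ∫ ζ, g4 ζ := by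
    rw [Measure.volume_eq_prod, integral_prod _ (by rw [← Measure.volume_eq_prod]; exact i3),
      integral_prod _ (by rw [← Measure.volume_eq_prod]; exact i4)]
    congr 1; funext q
    simp only [hg3, hg4, hH]
    rw [integral_const_mul, integral_const_mul, fiber_id ha hY h q]
  obtain ⟨D1, D2⟩ := DY_int ha hY
  set Dd : FF m → ℝ := fun ζ => Set.indicator (Metric.closedBall (0 : QQ m) R) (fun _ => (1:ℝ)) ζ.1 * DY a Y ζ.2 with hDd
  have Di : Integrable Dd := voli.mul_prod D1
  have DI : ∫ ζ, Dd ζ = vol * (2 / (1 - a)) := by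
    rw [hvol, ← D2, ← integral_prod_mul]; rfl
  have Dnn : ∀ ζ, 0 ≤ Dd ζ := fun ζ => mul_nonneg (Set.indicator_nonneg (fun _ _ => zero_le_one) _) (DY_nonneg hY _)
  have bnd : ∀ ζ, g2 ζ + g4 ζ ≤ (ω * (2 * CW * (C * (1 - a)) + CW / (1 - a) * (C * (1 - a) ^ 2) + Cv * (C * (1 - a)))) * Dd ζ := by
    intro ζ
    have hr : 0 ≤ (ω * (2 * CW * (C * (1 - a)) + CW / (1 - a) * (C * (1 - a) ^ 2) + Cv * (C * (1 - a)))) * Dd ζ :=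
      mul_nonneg (by positivity) (Dnn ζ)
    by_cases hz : R < ‖ζ.1‖
    · have : g2 ζ + g4 ζ = 0 := by
        simp only [hg2, hg4]; rw [H1 ζ hz, (vq ζ.1 ζ.2 hz).2, (vq ζ.1 0 hz).2]; simp
      rw [this]; exact hr
    by_cases hz2 : Y ≤ |ζ.2|
    · have : g2 ζ + g4 ζ = 0 := by
        simp only [hg2, hg4]; rw [H2 ζ hz2, tz _ hz2]; simp
      rw [this]; exact hr
    push Not at hz hz2
    have eD : Dd ζ = DY a Y ζ.2 := by
      simp only [hDd]; rw [Set.indicator_of_mem (by rw [mem_closedBall_zero_iff]; exact hz), one_mul]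
    rw [eD]
    have hDn := DY_nonneg (a := a) hY ζ.2
    have b1 := hd1 ζ.1 hz ζ.2 (hz2.le.trans l1.le)
    have b2 := hd2 ζ.1 hz ζ.2 (hz2.le.trans l2.le)
    have b3 := hCW ζ
    have b4 : |v (ζ.1, 0)| ≤ Cv := hCv ζ.1 (by rw [mem_closedBall_zero_iff]; exact hz)
    have b5 := hζ ζ.1 ζ.2
    have b6 := th1_bd ha hC hY ζ.2
    have b7 := jj_bd ha hC hY ζ.2
    rw [Real.norm_eq_abs] at b3
    have hHb : |H ζ| ≤ 2 * CW * (C * (1 - a) * DY a Y ζ.2) + CW / (1 - a) * (C * (1 - a) ^ 2 * DY a Y ζ.2) := by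
      simp only [hH]
      refine (abs_add_le _ _).trans (add_le_add ?_ ?_)
      · rw [abs_mul, abs_mul, abs_two]; gcongr
      · rw [abs_mul]
        calc |ψ ζ - ψ (ζ.1, 0)| * |jj a Y ζ.2| ≤ (CW / (1 - a) * |ζ.2| ^ (1 - a)) * |jj a Y ζ.2| := by gcongr
          _ = CW / (1 - a) * (|jj a Y ζ.2| * |ζ.2| ^ (1 - a)) := by ring
          _ ≤ _ := by gcongr
    have p1 : g2 ζ ≤ ω * (2 * CW * (C * (1 - a) * DY a Y ζ.2) + CW / (1 - a) * (C * (1 - a) ^ 2 * DY a Y ζ.2)) := by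
      refine (le_abs_self _).trans ?_
      simp only [hg2]; rw [abs_mul]
      exact mul_le_mul b1 hHb (abs_nonneg _) hω0.le
    have p2 : g4 ζ ≤ Cv * (ω * (C * (1 - a) * DY a Y ζ.2)) := by
      refine (le_abs_self _).trans ?_
      simp only [hg4]; rw [abs_mul, abs_mul]
      exact mul_le_mul b4 (mul_le_mul b2 b6 (abs_nonneg _) hω0.le) (by positivity) hCv0
    calc g2 ζ + g4 ζ ≤ _ := add_le_add p1 p2
      _ = _ := by ring
  have t2 : (∫ ζ, g2 ζ) + ∫ ζ, g4 ζ ≤ ε / 2 := by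
    rw [← integral_add i2 i4]
    have i24 : Integrable fun ζ => g2 ζ + g4 ζ := i2.add i4
    refine (integral_mono i24 (Di.const_mul _) bnd).trans ?_
    rw [integral_const_mul, DI]
    refine le_trans (le_of_eq ?_) hωK
    rw [hK]; ring
  rw [e34]
  linarith
end

set_option linter.all false
noncomputable section
open Real MeasureTheory
variable {m : ℕ}

lemma fatou_int {X : Type*} [MeasurableSpace X] {μ : Measure X} {f : ℕ → X → ℝ} {F : X → ℝ} {c : ℕ → ℝ} {c' : ℝ}
    (hi : ∀ n, Integrable (f n) μ) (hn : ∀ n, 0 ≤ᵐ[μ] f n)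
    (ht : ∀ᵐ x ∂μ, Filter.Tendsto (fun n => f n x) Filter.atTop (nhds (F x)))
    (hc : ∀ n, ∫ x, f n x ∂μ ≤ c n) (hcc : Filter.Tendsto c Filter.atTop (nhds c')) :
    Integrable F μ ∧ ∫ x, F x ∂μ ≤ c' := by
  have hm : AEStronglyMeasurable F μ := aestronglyMeasurable_of_tendsto_ae _ (fun n => (hi n).1) ht
  have hF : 0 ≤ᵐ[μ] F := by
    filter_upwards [ht, ae_all_iff.2 hn] with x hx hx'
    exact ge_of_tendsto' hx hx'
  have hc0 : 0 ≤ c' := ge_of_tendsto' hcc fun n => (integral_nonneg_of_ae (hn n)).trans (hc n)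
  have key : ∫⁻ x, ENNReal.ofReal (F x) ∂μ ≤ ENNReal.ofReal c' := by
    calc ∫⁻ x, ENNReal.ofReal (F x) ∂μ = ∫⁻ x, Filter.liminf (fun n => ENNReal.ofReal (f n x)) Filter.atTop ∂μ := by
          refine lintegral_congr_ae ?_
          filter_upwards [ht] with x hx
          exact ((ENNReal.continuous_ofReal.tendsto _).comp hx).liminf_eq.symm
      _ ≤ Filter.liminf (fun n => ∫⁻ x, ENNReal.ofReal (f n x) ∂μ) Filter.atTop :=
          lintegral_liminf_le' fun n => (hi n).1.aemeasurable.ennreal_ofReal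
      _ ≤ Filter.liminf (fun n => ENNReal.ofReal (c n)) Filter.atTop := by
          refine Filter.liminf_le_liminf (Filter.Eventually.of_forall fun n => ?_)
          rw [← ofReal_integral_eq_lintegral_ofReal (hi n) (hn n)]
          exact ENNReal.ofReal_le_ofReal (hc n)
      _ = ENNReal.ofReal c' := ((ENNReal.continuous_ofReal.tendsto _).comp hcc).liminf_eq
  have hI : Integrable F μ := ⟨hm, by
    rw [hasFiniteIntegral_iff_ofReal hF]; exact key.trans_lt ENNReal.ofReal_lt_top⟩
  refine ⟨hI, ?_⟩
  rw [← ofReal_integral_eq_lintegral_ofReal hI hF] at key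
  exact (ENNReal.ofReal_le_ofReal_iff hc0).1 key

lemma ae_off_plane : ∀ᵐ ζ : FF m, ζ.2 ≠ 0 := by
  have h0 : (volume : Measure ℝ) {0} = 0 := by simp
  have : (volume : Measure (FF m)) ((Set.univ : Set (QQ m)) ×ˢ ({0} : Set ℝ)) = 0 := by
    rw [Measure.volume_eq_prod, Measure.prod_prod, h0, mul_zero]
  rw [ae_iff]
  convert this using 2
  ext ζ; simp

lemma psi_th {a Y : ℝ} (ha : a < 1) {U : Set (FF m)} {ψ W : FF m → ℝ} (h : TestFn a U ψ W) :
    ContDiff ℝ 2 (fun ζ : FF m => ψ ζ * th a Y ζ.2) ∧ HasCompactSupport (fun ζ : FF m => ψ ζ * th a Y ζ.2) ∧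
    ∀ ζ ∈ tsupport (fun ζ : FF m => ψ ζ * th a Y ζ.2), ζ.2 ≠ 0 := by
  have hoff : ∀ ζ ∈ tsupport (fun ζ : FF m => ψ ζ * th a Y ζ.2), ζ.2 ≠ 0 := by
    intro ζ hz hy
    have h0 : ∀ᶠ x : FF m in nhds ζ, rr a Y x.2 < 1/2 := by
      have : Filter.Tendsto (fun x : FF m => x.2) (nhds ζ) (nhds 0) := by rw [← hy]; exact continuous_snd.tendsto ζ
      exact this.eventually (rr_small ha Y)
    refine (notMem_tsupport_iff_eventuallyEq.2 ?_) hz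
    filter_upwards [h0] with x hx
    simp [th, Th_zero hx.le]
  refine ⟨contDiff_of_tsup fun ζ hz => ?_, h.hcs.mul_right, hoff⟩
  have hy := hoff ζ hz
  refine (h.cd ζ hy).mul ?_
  have : ContDiffAt ℝ 2 (fun ζ : FF m => rr a Y ζ.2) ζ := (cdAt_abs_rpow (1 - a) hy (n := 2)).div_const _
  exact Th_cd.contDiffAt.comp ζ this

lemma Lst_zero_off {a : ℝ} {ψ : FF m → ℝ} {ζ : FF m} (h : ζ ∉ tsupport ψ) : Lst a ψ ζ = 0 := by
  have h1 : ∀ d : FF m, dd d ψ ζ = 0 := fun d => image_eq_zero_of_notMem_tsupport fun hh => h (tsupport_dd d hh)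
  have h2 : ∀ d : FF m, dd d (dd d ψ) ζ = 0 := fun d => image_eq_zero_of_notMem_tsupport fun hh => h (tsupport_dd d (tsupport_dd d hh))
  simp [Lst, h1, h2]

lemma v_Lst_int {a : ℝ} {U : Set (FF m)} {ψ W v : FF m → ℝ} (h : TestFn a U ψ W) (hv : Continuous v) :
    Integrable (fun ζ => v ζ * Lst a ψ ζ) := by
  obtain ⟨B, hB⟩ := h.hcs.isCompact.exists_bound_of_continuousOn hv.continuousOn
  refine (h.int.norm.const_mul B).mono' (hv.aestronglyMeasurable.mul h.int.1) (Filter.Eventually.of_forall fun ζ => ?_)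
  by_cases hz : ζ ∈ tsupport ψ
  · rw [norm_mul]; exact mul_le_mul_of_nonneg_right (hB ζ hz) (norm_nonneg _)
  · simp [Lst_zero_off hz]

theorem weak_ineq {a : ℝ} (ha1 : -1 < a) (ha : a < 1) {U : Set (FF m)} (hU : IsOpen U) {ψ W v : FF m → ℝ}
    (h : TestFn a U ψ W) (hs : SubSol a U v) :
    Integrable (fun ζ => ψ ζ * (-Lop a v ζ)) ∧ ∫ ζ, ψ ζ * (-Lop a v ζ) ≤ ∫ ζ, v ζ * Lst a ψ ζ := by
  have hE : ∀ n : ℕ, ∃ Y : ℝ, 0 < Y ∧ Y < 1 / ((n:ℝ) + 1) ∧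
      ∫ ζ : FF m, v ζ * (2 * W ζ * th1 a Y ζ.2 + ψ ζ * jj a Y ζ.2) ≤ 1 / ((n:ℝ) + 1) := by
    intro n
    have hn : 0 < 1 / ((n:ℝ) + 1) := by positivity
    obtain ⟨Y1, hY1, hh⟩ := E_small ha1 ha hU h hs hn
    have hp : 0 < min Y1 (1 / ((n:ℝ) + 1)) := lt_min hY1 hn
    refine ⟨min Y1 (1 / ((n:ℝ) + 1)) / 2, by positivity, ?_, hh _ (by positivity) ?_⟩
    · linarith [min_le_right Y1 (1 / ((n:ℝ) + 1))]
    · linarith [min_le_left Y1 (1 / ((n:ℝ) + 1))]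
  choose Y hY0 hY1 hYE using hE
  have t1 : Filter.Tendsto (fun n : ℕ => 1 / ((n:ℝ) + 1)) Filter.atTop (nhds 0) := tendsto_one_div_add_atTop_nhds_zero_nat
  have hth : ∀ ζ : FF m, ζ.2 ≠ 0 → ∀ᶠ n in Filter.atTop, th a (Y n) ζ.2 = 1 := by
    intro ζ hz
    filter_upwards [t1.eventually (gt_mem_nhds (abs_pos.2 hz))] with n hn
    exact th_big ha (hY0 n) ((hY1 n).trans hn).le
  have hthm : ∀ n, Continuous fun ζ : FF m => th a (Y n) ζ.2 := fun n => by
    have := rr_cont ha (Y n)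
    have h2 := Th_cd.continuous
    unfold th
    fun_prop
  have hvL := v_Lst_int h hs.cont
  have ib := fun n => ibp_off a (psi_th (Y := Y n) ha h).1 (psi_th ha h).2.1 (psi_th ha h).2.2
    (fun ζ hz => hs.cd ζ ((psi_th ha h).2.2 ζ hz))
  have hdom : ∀ n, Integrable (fun ζ : FF m => v ζ * (th a (Y n) ζ.2 * Lst a ψ ζ)) := fun n =>
    hvL.norm.mono' (by
      have := ((hthm n).aestronglyMeasurable (μ := volume)).mul hvL.1
      refine this.congr (Filter.Eventually.of_forall fun ζ => ?_)
      simp only [Pi.mul_apply]; ring) (Filter.Eventually.of_forall fun ζ => by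
      have := th_nonneg a (Y n) ζ.2
      have h2 := th_le a (Y n) ζ.2
      rw [norm_mul, norm_mul, norm_mul, Real.norm_of_nonneg this]
      exact mul_le_mul_of_nonneg_left (mul_le_of_le_one_left (norm_nonneg _) h2) (norm_nonneg _))
  have hlim : Filter.Tendsto (fun n => ∫ ζ : FF m, v ζ * (th a (Y n) ζ.2 * Lst a ψ ζ)) Filter.atTop (nhds (∫ ζ, v ζ * Lst a ψ ζ)) := by
    refine tendsto_integral_of_dominated_convergence (fun ζ => ‖v ζ * Lst a ψ ζ‖) (fun n => (hdom n).1) hvL.norm (fun n => Filter.Eventually.of_forall fun ζ => ?_) ?_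
    · have := th_nonneg a (Y n) ζ.2
      have h2 := th_le a (Y n) ζ.2
      rw [norm_mul, norm_mul, norm_mul, Real.norm_of_nonneg this]
      exact mul_le_mul_of_nonneg_left (mul_le_of_le_one_left (norm_nonneg _) h2) (norm_nonneg _)
    · filter_upwards [ae_off_plane] with ζ hz
      refine tendsto_const_nhds.congr' ?_
      filter_upwards [hth ζ hz] with n hn
      rw [hn, one_mul]
  have hsum : Filter.Tendsto (fun n : ℕ => (∫ ζ : FF m, v ζ * (th a (Y n) ζ.2 * Lst a ψ ζ)) + 1 / ((n:ℝ) + 1)) Filter.atTop (nhds (∫ ζ, v ζ * Lst a ψ ζ)) := by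
    simpa using hlim.add t1
  refine fatou_int (f := fun n ζ => (ψ ζ * th a (Y n) ζ.2) * (-Lop a v ζ)) (fun n => ?_) (fun n => ?_) ?_ (fun n => ?_) hsum
  · have := (ib n).1.neg
    refine this.congr (Filter.Eventually.of_forall fun ζ => ?_)
    simp
  · filter_upwards [ae_off_plane] with ζ hz
    by_cases hzz : ζ ∈ tsupport ψ
    · have := hs.le ζ (h.sub hzz) hz
      have h1 := h.nn ζ
      have h2 := th_nonneg a (Y n) ζ.2
      exact mul_nonneg (mul_nonneg h1 h2) (by linarith)
    · simp [image_eq_zero_of_notMem_tsupport hzz]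
  · filter_upwards [ae_off_plane] with ζ hz
    refine tendsto_const_nhds.congr' ?_
    filter_upwards [hth ζ hz] with n hn
    rw [hn, mul_one]
  · have e := (ib n).2.2
    rw [e]
    have i2 := (ib n).2.1
    have hE' : Integrable fun ζ : FF m => v ζ * (2 * W ζ * th1 a (Y n) ζ.2 + ψ ζ * jj a (Y n) ζ.2) := by
      refine (i2.sub (hdom n)).congr (Filter.Eventually.of_forall fun ζ => ?_)
      simp only [Pi.sub_apply]
      rw [Lst_mul_th ha h]; ring
    have : (fun ζ : FF m => v ζ * Lst a (fun ζ => ψ ζ * th a (Y n) ζ.2) ζ) = fun ζ =>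
        v ζ * (th a (Y n) ζ.2 * Lst a ψ ζ) + v ζ * (2 * W ζ * th1 a (Y n) ζ.2 + ψ ζ * jj a (Y n) ζ.2) := by
      funext ζ; rw [Lst_mul_th ha h]; ring
    rw [this, integral_add (hdom n) hE']
    linarith [hYE n]

end

set_option linter.all false
noncomputable section
open Real MeasureTheory
variable {m : ℕ}

def pt (c : ℝ) (k : ℕ) : ℝ := 1 / ((Nat.factorial k : ℝ) * Real.Gamma ((k : ℝ) + c))
def Pc (c w : ℝ) : ℝ := ∑' k : ℕ, pt c k * w ^ k

lemma Gam_pos {c : ℝ} (hc : 0 < c) (k : ℕ) : 0 < Real.Gamma ((k : ℝ) + c) := Real.Gamma_pos_of_pos (by positivity)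
lemma pt_pos {c : ℝ} (hc : 0 < c) (k : ℕ) : 0 < pt c k := by
  have := Gam_pos hc k
  unfold pt; positivity
lemma Gam_lb {c : ℝ} (hc : 0 < c) : ∃ d > 0, ∀ k : ℕ, d ≤ Real.Gamma ((k : ℝ) + c) := by
  refine ⟨min (Real.Gamma c) (Real.Gamma (c + 1)), lt_min (Real.Gamma_pos_of_pos hc) (Real.Gamma_pos_of_pos (by linarith)), fun k => ?_⟩
  rcases k with _ | k
  · simp
  · refine (min_le_right _ _).trans ?_
    induction k with
    | zero => simp [add_comm]
    | succ k ih =>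
      have e : ((k + 1 + 1 : ℕ) : ℝ) + c = (((k + 1 : ℕ) : ℝ) + c) + 1 := by push_cast; ring
      have h1 : 0 < Real.Gamma (((k + 1 : ℕ) : ℝ) + c) := Gam_pos hc (k + 1)
      rw [e, Real.Gamma_add_one (s := ((k + 1 : ℕ) : ℝ) + c) (by positivity)]
      refine ih.trans (le_mul_of_one_le_left h1.le ?_)
      push_cast
      have : (0:ℝ) ≤ k := by positivity
      linarith
lemma pt_ub {c : ℝ} (hc : 0 < c) : ∃ d > 0, ∀ k : ℕ, pt c k ≤ d / (Nat.factorial k : ℝ) := by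
  obtain ⟨d, hd, h⟩ := Gam_lb hc
  refine ⟨1 / d, by positivity, fun k => ?_⟩
  unfold pt
  rw [div_div, mul_comm]
  have := h k
  gcongr
lemma pt_summable {c : ℝ} (hc : 0 < c) (w : ℝ) : Summable fun k => pt c k * w ^ k := by
  obtain ⟨d, hd, h⟩ := pt_ub hc
  refine Summable.of_norm_bounded (g := fun k => d * (|w| ^ k / (Nat.factorial k : ℝ))) ((Real.summable_pow_div_factorial |w|).mul_left d) fun k => ?_
  rw [norm_mul, norm_pow, Real.norm_eq_abs, Real.norm_eq_abs, abs_of_pos (pt_pos hc k)]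
  calc pt c k * |w| ^ k ≤ d / (Nat.factorial k : ℝ) * |w| ^ k := by gcongr; exact h k
    _ = _ := by ring
lemma pt_succ {c : ℝ} (k : ℕ) : pt c (k + 1) * ((k:ℝ) + 1) = pt (c + 1) k := by
  unfold pt
  have e : ((k + 1 : ℕ) : ℝ) + c = (k:ℝ) + (c + 1) := by push_cast; ring
  rw [e, Nat.factorial_succ]
  push_cast
  have : (k:ℝ) + 1 ≠ 0 := by positivity
  field_simp
lemma pt_bessel {c : ℝ} (hc : 0 < c) (k : ℕ) : ((k:ℝ) + c) * pt (c + 1) k = pt c k := by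
  unfold pt
  have e : (k:ℝ) + (c + 1) = (k + c) + 1 := by ring
  have h : (k:ℝ) + c ≠ 0 := by positivity
  rw [e, Real.Gamma_add_one h]
  have := (Gam_pos hc k).ne'
  field_simp
lemma Pc_nonneg {c w : ℝ} (hc : 0 < c) (hw : 0 ≤ w) : 0 ≤ Pc c w :=
  tsum_nonneg fun k => mul_nonneg (pt_pos hc k).le (by positivity)

lemma Pc_der {c : ℝ} (hc : 0 < c) (w : ℝ) : HasDerivAt (Pc c) (Pc (c + 1) w) w := by
  obtain ⟨d, hd, h⟩ := pt_ub (c := c + 1) (by linarith)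
  set R := |w| + 1
  have key : HasDerivAt (fun w => ∑' k : ℕ, pt c (k + 1) * w ^ (k + 1)) (∑' k : ℕ, pt (c + 1) k * w ^ k) w := by
    refine hasDerivAt_tsum_of_isPreconnected (u := fun k => d * (R ^ k / (Nat.factorial k : ℝ))) (t := Metric.ball 0 R)
      (g := fun k w => pt c (k + 1) * w ^ (k + 1)) (g' := fun k w => pt (c + 1) k * w ^ k) (y₀ := 0)
      ((Real.summable_pow_div_factorial R).mul_left d) Metric.isOpen_ball (convex_ball _ _).isPreconnected (fun k y hy => ?_) (fun k y hy => ?_) ?_ ?_ ?_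
    · have := (hasDerivAt_pow (k + 1) y).const_mul (pt c (k + 1))
      refine this.congr_deriv ?_
      rw [← pt_succ]; push_cast; ring
    · rw [norm_mul, norm_pow, Real.norm_eq_abs, abs_of_pos (pt_pos (by linarith) k)]
      have hy' : ‖y‖ ≤ R := by simpa using (mem_ball_zero_iff.1 hy).le
      calc pt (c + 1) k * ‖y‖ ^ k ≤ d / (Nat.factorial k : ℝ) * R ^ k := by gcongr; exact h k
        _ = _ := by ring
    · exact Metric.mem_ball_self (by positivity)
    · simpa using summable_zero
    · simp [R]
  have e : Pc c = fun w => pt c 0 + ∑' k : ℕ, pt c (k + 1) * w ^ (k + 1) := by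
    funext w
    unfold Pc
    rw [(pt_summable hc w).tsum_eq_zero_add]; simp
  rw [e]
  exact key.const_add _

lemma Pc_cd (n : ℕ) : ∀ {c : ℝ}, 0 < c → ContDiff ℝ n (Pc c) := by
  induction n with
  | zero => exact fun hc => contDiff_zero.2 (Differentiable.continuous fun w => (Pc_der hc w).differentiableAt)
  | succ n ih =>
    intro c hc
    have : deriv (Pc c) = Pc (c + 1) := funext fun w => (Pc_der hc w).deriv
    have h := (contDiff_succ_iff_deriv (n := (n : WithTop ℕ∞)) (f := Pc c)).2
      ⟨fun w => (Pc_der hc w).differentiableAt, fun h => by simp at h, by rw [this]; exact ih (by linarith)⟩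
    exact_mod_cast h
lemma Pc_cont {c : ℝ} (hc : 0 < c) : Continuous (Pc c) := (Pc_cd 0 hc).continuous

lemma Pc_bessel {c : ℝ} (hc : 0 < c) (w : ℝ) : w * Pc (c + 2) w + c * Pc (c + 1) w = Pc c w := by
  have h1 := pt_summable (c := c + 1) (by linarith) w
  have h2 := pt_summable (c := c + 2) (by linarith) w
  have s1 : HasSum (fun k : ℕ => (k:ℝ) * pt (c + 1) k * w ^ k) (w * Pc (c + 2) w) := by
    rw [← hasSum_nat_add_iff' 1]
    simp only [Finset.range_one, Finset.sum_singleton, Nat.cast_zero, zero_mul, sub_zero]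
    have := h2.hasSum.mul_left w
    refine this.congr_fun ?_ |> fun h => h
    intro k
    have := pt_succ (c := c + 1) k
    rw [show c + 1 + 1 = c + 2 by ring] at this
    rw [← this]; push_cast; ring
  have s2 := s1.add (h1.hasSum.mul_left c)
  have : (fun k : ℕ => (k:ℝ) * pt (c + 1) k * w ^ k + c * (pt (c + 1) k * w ^ k)) = fun k => pt c k * w ^ k := by
    funext k; rw [← pt_bessel hc k]; ring
  rw [this] at s2
  exact s2.tsum_eq.symm

end

set_option linter.all false
noncomputable section
open Real MeasureTheory
variable {m : ℕ}

def ph (x0 M c s R y : ℝ) : ℝ := s ^ (-(M + c)) * Real.exp (-R / (4 * s)) * Pc c (x0 ^ 2 * y ^ 2 / (16 * s ^ 2))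

lemma ph_line {x0 M c : ℝ} (hc : 0 < c) {S R Y : ℝ → ℝ} {S' R' Y' r : ℝ} (hS : HasDerivAt S S' r) (hR : HasDerivAt R R' r)
    (hY : HasDerivAt Y Y' r) (h0 : 0 < S r) :
    HasDerivAt (fun r => ph x0 M c (S r) (R r) (Y r))
      ((-(M + c) / S r * S' - R' / (4 * S r) + R r * S' / (4 * S r ^ 2)) * ph x0 M c (S r) (R r) (Y r) +
        (x0 ^ 2 * Y r * Y' / (8 * S r) - x0 ^ 2 * Y r ^ 2 * S' / (8 * S r ^ 2)) * ph x0 M (c + 1) (S r) (R r) (Y r)) r := by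
  have h1 := hS.rpow_const (p := -(M + c)) (Or.inl h0.ne')
  have h2 := (hR.neg.div (hS.const_mul 4) (by positivity)).exp
  have h3 := (Pc_der hc (x0 ^ 2 * Y r ^ 2 / (16 * S r ^ 2))).comp r
    (((hY.pow 2).const_mul (x0 ^ 2)).div ((hS.pow 2).const_mul 16) (by simp; exact h0.ne'))
  have := (h1.mul h2).mul h3
  refine this.congr_deriv ?_
  have e1 : S r ^ (-(M + c) - 1) = S r ^ (-(M + c)) / S r := Real.rpow_sub_one h0.ne' _
  have e2 : S r ^ (-(M + (c + 1))) = S r ^ (-(M + c)) / S r := by rw [← e1]; congr 1; ring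
  simp only [Pi.mul_apply, Pi.div_apply, Pi.neg_apply, Pi.pow_apply, Function.comp, ph, e1, e2]
  have := h0.ne'
  field_simp
  push_cast
  ring

/-- time variable -/
def sv (t0 : ℝ) (ζ : FF m) : ℝ := t0 - ζ.1.2
def Rv (x0 : ℝ) (b : Fin m → ℝ) (ζ : FF m) : ℝ := (∑ i, (b i - ζ.1.1 i) ^ 2) + x0 ^ 2 + ζ.2 ^ 2
def Phi (x0 t0 : ℝ) (b : Fin m → ℝ) (c : ℝ) (ζ : FF m) : ℝ := ph x0 ((m:ℝ)/2) c (sv t0 ζ) (Rv x0 b ζ) ζ.2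

lemma dd_of_line {E : Type*} [NormedAddCommGroup E] [NormedSpace ℝ E] {f : E → ℝ} {x d : E} {D : ℝ}
    (h : DifferentiableAt ℝ f x) (hl : HasDerivAt (fun r : ℝ => f (x + r • d)) D 0) : dd d f x = D := by
  have h1 : DifferentiableAt ℝ f (x + (0:ℝ) • d) := by simpa using h
  have := (hasDerivAt_line (d := d) h1).unique hl
  simpa using this

lemma sv_cd (t0 : ℝ) {n : WithTop ℕ∞} : ContDiff ℝ n (sv (m := m) t0) := by unfold sv; fun_prop
lemma Rv_cd (x0 : ℝ) (b : Fin m → ℝ) {n : WithTop ℕ∞} : ContDiff ℝ n (Rv x0 b) := by unfold Rv; fun_prop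

lemma Phi_cd {x0 t0 : ℝ} {b : Fin m → ℝ} {c : ℝ} (hc : 0 < c) {ζ : FF m} (hs : 0 < sv t0 ζ) (n : ℕ) :
    ContDiffAt ℝ n (Phi x0 t0 b c) ζ := by
  have h1 : ContDiffAt ℝ n (sv (m := m) t0) ζ := (sv_cd t0).contDiffAt
  have h2 : ContDiffAt ℝ n (Rv x0 b) ζ := (Rv_cd x0 b).contDiffAt
  have h3 := Pc_cd n hc
  unfold Phi ph
  have a1 : ContDiffAt ℝ n (fun ζ : FF m => sv t0 ζ ^ (-((m:ℝ)/2 + c))) ζ := h1.rpow_const_of_ne hs.ne'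
  have a2 : ContDiffAt ℝ n (fun ζ : FF m => -Rv x0 b ζ / (4 * sv t0 ζ)) ζ := h2.neg.div (contDiffAt_const.mul h1) (by positivity)
  have a3 : ContDiffAt ℝ n (fun ζ : FF m => x0 ^ 2 * ζ.2 ^ 2 / (16 * sv t0 ζ ^ 2)) ζ :=
    (contDiffAt_const.mul (contDiffAt_snd.pow 2)).div (contDiffAt_const.mul (h1.pow 2)) (by positivity)
  exact (a1.mul a2.exp).mul (h3.contDiffAt.comp ζ a3)

lemma Phi_dd {x0 t0 : ℝ} {b : Fin m → ℝ} {c : ℝ} (hc : 0 < c) {ζ : FF m} (hs : 0 < sv t0 ζ) (d : FF m) :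
    dd d (Phi x0 t0 b c) ζ =
      (((m:ℝ)/2 + c) / sv t0 ζ * d.1.2 + (∑ i, (b i - ζ.1.1 i) * d.1.1 i) / (2 * sv t0 ζ) - ζ.2 * d.2 / (2 * sv t0 ζ)
        - Rv x0 b ζ * d.1.2 / (4 * sv t0 ζ ^ 2)) * Phi x0 t0 b c ζ +
      (x0 ^ 2 * ζ.2 * d.2 / (8 * sv t0 ζ) + x0 ^ 2 * ζ.2 ^ 2 * d.1.2 / (8 * sv t0 ζ ^ 2)) * Phi x0 t0 b (c + 1) ζ := by
  have hS : HasDerivAt (fun r : ℝ => sv t0 (ζ + r • d)) (-d.1.2) 0 := by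
    have := (((hasDerivAt_id (0:ℝ)).mul_const d.1.2).const_add ζ.1.2).const_sub t0
    simpa [sv] using this
  have hY : HasDerivAt (fun r : ℝ => (ζ + r • d).2) d.2 0 := by
    have := (((hasDerivAt_id (0:ℝ)).mul_const d.2).const_add ζ.2)
    simpa using this
  have hR : HasDerivAt (fun r : ℝ => Rv x0 b (ζ + r • d)) ((∑ i, 2 * (b i - ζ.1.1 i) * (- d.1.1 i)) + 2 * ζ.2 * d.2) 0 := by
    have h1 : HasDerivAt (fun r : ℝ => ∑ i, (b i - (ζ + r • d).1.1 i) ^ 2) (∑ i, 2 * (b i - ζ.1.1 i) * (- d.1.1 i)) 0 := by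
      refine HasDerivAt.fun_sum fun i _ => ?_
      have := ((((hasDerivAt_id (0:ℝ)).mul_const (d.1.1 i)).const_add (ζ.1.1 i)).const_sub (b i)).pow 2
      refine (this.congr_deriv ?_).congr_of_eventuallyEq (Filter.Eventually.of_forall fun r => ?_)
      · simp
      · simp
    have h2 := hY.pow 2
    refine ((h1.add_const (x0 ^ 2)).add h2).congr_deriv ?_
    simp
  have := ph_line (x0 := x0) (M := (m:ℝ)/2) hc hS hR hY (by simpa using hs)
  rw [dd_of_line (cdAt_da (Phi_cd hc hs 2)) this]
  have e : (∑ i, 2 * (b i - ζ.1.1 i) * (- d.1.1 i)) = -2 * ∑ i, (b i - ζ.1.1 i) * d.1.1 i := by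
    rw [Finset.mul_sum]; exact Finset.sum_congr rfl fun i _ => by ring
  simp only [zero_smul, add_zero, Phi, e]
  have := hs.ne'
  field_simp
  ring

lemma Phi_bessel {x0 t0 : ℝ} {b : Fin m → ℝ} {c : ℝ} (hc : 0 < c) {ζ : FF m} (hs : 0 < sv t0 ζ) :
    x0 ^ 2 * ζ.2 ^ 2 / 16 * Phi x0 t0 b (c + 1 + 1) ζ + c * sv t0 ζ * Phi x0 t0 b (c + 1) ζ = Phi x0 t0 b c ζ := by
  have := Pc_bessel hc (x0 ^ 2 * ζ.2 ^ 2 / (16 * sv t0 ζ ^ 2))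
  rw [show c + 2 = c + 1 + 1 by ring] at this
  unfold Phi ph
  rw [← this]
  have e1 : ∀ q : ℝ, sv t0 ζ ^ (-((m:ℝ)/2 + (q + 1))) = sv t0 ζ ^ (-((m:ℝ)/2 + q)) / sv t0 ζ := fun q => by
    rw [← Real.rpow_sub_one hs.ne']; congr 1; ring
  rw [e1 (c+1), e1 c]
  have := hs.ne'
  field_simp

lemma sv_nhds {t0 : ℝ} {ζ : FF m} (hs : 0 < sv t0 ζ) : ∀ᶠ x in nhds ζ, 0 < sv t0 x :=
  ((sv_cd (m := m) t0 (n := 0)).continuous.tendsto ζ).eventually (lt_mem_nhds hs)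

lemma Phi_dI {x0 t0 : ℝ} {b : Fin m → ℝ} {c : ℝ} (hc : 0 < c) {ζ : FF m} (hs : 0 < sv t0 ζ) (i : Fin m) :
    dd (dI i) (Phi x0 t0 b c) ζ = (b i - ζ.1.1 i) / (2 * sv t0 ζ) * Phi x0 t0 b c ζ := by
  rw [Phi_dd hc hs]; simp [dI, Pi.single_apply]
lemma Phi_dY {x0 t0 : ℝ} {b : Fin m → ℝ} {c : ℝ} (hc : 0 < c) {ζ : FF m} (hs : 0 < sv t0 ζ) :
    dd dY (Phi x0 t0 b c) ζ = ζ.2 * (-1 / (2 * sv t0 ζ) * Phi x0 t0 b c ζ + x0 ^ 2 / (8 * sv t0 ζ) * Phi x0 t0 b (c + 1) ζ) := by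
  rw [Phi_dd hc hs]; simp [dY]; ring
lemma da_div {E : Type*} [NormedAddCommGroup E] [NormedSpace ℝ E] {f g : E → ℝ} {x : E} (hf : ContDiffAt ℝ 1 f x) (hg : ContDiffAt ℝ 1 g x) (h : g x ≠ 0) :
    DifferentiableAt ℝ (fun x => f x / g x) x := (hf.div hg h).differentiableAt (by norm_num)
lemma Phi_dII {x0 t0 : ℝ} {b : Fin m → ℝ} {c : ℝ} (hc : 0 < c) {ζ : FF m} (hs : 0 < sv t0 ζ) (i : Fin m) :
    dd (dI i) (dd (dI i) (Phi x0 t0 b c)) ζ = (-1 / (2 * sv t0 ζ) + ((b i - ζ.1.1 i) / (2 * sv t0 ζ)) ^ 2) * Phi x0 t0 b c ζ := by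
  have ev : dd (dI i) (Phi x0 t0 b c) =ᶠ[nhds ζ] fun ζ => (b i - ζ.1.1 i) / (2 * sv t0 ζ) * Phi x0 t0 b c ζ := by
    filter_upwards [sv_nhds hs] with x hx using Phi_dI hc hx i
  have hd : DifferentiableAt ℝ (fun ζ : FF m => (b i - ζ.1.1 i) / (2 * sv t0 ζ)) ζ := by
    have : DifferentiableAt ℝ (sv (m := m) t0) ζ := (sv_cd t0 (n := 1)).differentiable (by norm_num) ζ
    exact da_div (f := fun ζ : FF m => b i - ζ.1.1 i) (g := fun ζ : FF m => 2 * sv t0 ζ) (by fun_prop) (contDiffAt_const.mul (sv_cd t0).contDiffAt) (by positivity)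
  have h2 : dd (dI i) (fun ζ : FF m => (b i - ζ.1.1 i) / (2 * sv t0 ζ)) ζ = -1 / (2 * sv t0 ζ) := by
    refine dd_of_line hd ?_
    have := (((hasDerivAt_id (0:ℝ)).const_add (ζ.1.1 i)).const_sub (b i)).div_const (2 * sv t0 ζ)
    refine this.congr_of_eventuallyEq (Filter.Eventually.of_forall fun r => ?_)
    simp [dI, sv]
  rw [dd_congr _ ev, dd_mul _ hd (cdAt_da (Phi_cd hc hs 2)), h2, Phi_dI hc hs]
  ring
lemma Phi_dYY {x0 t0 : ℝ} {b : Fin m → ℝ} {c : ℝ} (hc : 0 < c) {ζ : FF m} (hs : 0 < sv t0 ζ) :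
    dd dY (dd dY (Phi x0 t0 b c)) ζ = (-1 / (2 * sv t0 ζ) * Phi x0 t0 b c ζ + x0 ^ 2 / (8 * sv t0 ζ) * Phi x0 t0 b (c + 1) ζ)
     + ζ.2 * (-1 / (2 * sv t0 ζ) * (ζ.2 * (-1 / (2 * sv t0 ζ) * Phi x0 t0 b c ζ + x0 ^ 2 / (8 * sv t0 ζ) * Phi x0 t0 b (c + 1) ζ))
      + x0 ^ 2 / (8 * sv t0 ζ) * (ζ.2 * (-1 / (2 * sv t0 ζ) * Phi x0 t0 b (c + 1) ζ + x0 ^ 2 / (8 * sv t0 ζ) * Phi x0 t0 b (c + 1 + 1) ζ))) := by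
  have ev : dd dY (Phi x0 t0 b c) =ᶠ[nhds ζ] fun ζ => ζ.2 * (-1 / (2 * sv t0 ζ) * Phi x0 t0 b c ζ + x0 ^ 2 / (8 * sv t0 ζ) * Phi x0 t0 b (c + 1) ζ) := by
    filter_upwards [sv_nhds hs] with x hx using Phi_dY hc hx
  have hc1 : 0 < c + 1 := by linarith
  have hP := cdAt_da (Phi_cd (x0 := x0) (b := b) hc hs 2)
  have hP1 := cdAt_da (Phi_cd (x0 := x0) (b := b) hc1 hs 2)
  have hsd : DifferentiableAt ℝ (sv (m := m) t0) ζ := (sv_cd t0 (n := 1)).differentiable (by norm_num) ζ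
  have hq : ∀ k j : ℝ, j ≠ 0 → DifferentiableAt ℝ (fun ζ : FF m => k / (j * sv t0 ζ)) ζ ∧ dd dY (fun ζ : FF m => k / (j * sv t0 ζ)) ζ = 0 := by
    intro k j hj
    have hd : DifferentiableAt ℝ (fun ζ : FF m => k / (j * sv t0 ζ)) ζ := da_div (f := fun ζ : FF m => k) (g := fun ζ : FF m => j * sv t0 ζ) (by fun_prop) (contDiffAt_const.mul (sv_cd t0).contDiffAt) (mul_ne_zero hj hs.ne')
    refine ⟨hd, dd_of_line hd ?_⟩
    refine (hasDerivAt_const (0:ℝ) (k / (j * sv t0 ζ))).congr_of_eventuallyEq (Filter.Eventually.of_forall fun r => ?_)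
    simp [dY, sv]
  have e1 := hq (-1) 2 (by norm_num)
  have e2 := hq (x0 ^ 2) 8 (by norm_num)
  have hy : dd dY (fun ζ : FF m => ζ.2) ζ = 1 := by
    rw [dd_dir_fun (g := fun y => y) differentiableAt_id dY]; simp [dY]
  rw [dd_congr _ ev, dd_mul _ differentiableAt_snd ((e1.1.fun_mul hP).fun_add (e2.1.fun_mul hP1)), dd_add _ (e1.1.fun_mul hP) (e2.1.fun_mul hP1),
    dd_mul _ e1.1 hP, dd_mul _ e2.1 hP1, e1.2, e2.2, hy, Phi_dY hc hs, Phi_dY hc1 hs]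
  ring

lemma Phi_pde {x0 t0 : ℝ} {b : Fin m → ℝ} {c : ℝ} (hc : 0 < c) {ζ : FF m} (hs : 0 < sv t0 ζ) (hy : ζ.2 ≠ 0) :
    dd dT (Phi x0 t0 b c) ζ + (∑ i, dd (dI i) (dd (dI i) (Phi x0 t0 b c)) ζ) + dd dY (dd dY (Phi x0 t0 b c)) ζ
      + (2 * c - 1) / ζ.2 * dd dY (Phi x0 t0 b c) ζ = 0 := by
  have hB := Phi_bessel (x0 := x0) (b := b) hc hs
  have e : (∑ i, dd (dI i) (dd (dI i) (Phi x0 t0 b c)) ζ) =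
      (-(m:ℝ) / (2 * sv t0 ζ) + (∑ i, (b i - ζ.1.1 i) ^ 2) / (4 * sv t0 ζ ^ 2)) * Phi x0 t0 b c ζ := by
    simp only [Phi_dII hc hs, ← Finset.sum_mul, Finset.sum_add_distrib]
    congr 1
    congr 1
    · simp; ring
    · rw [Finset.sum_div]; exact Finset.sum_congr rfl fun i _ => by ring
  have hT : dd dT (Phi x0 t0 b c) ζ = (((m:ℝ)/2 + c) / sv t0 ζ - Rv x0 b ζ / (4 * sv t0 ζ ^ 2)) * Phi x0 t0 b c ζ +
      (x0 ^ 2 * ζ.2 ^ 2 / (8 * sv t0 ζ ^ 2)) * Phi x0 t0 b (c + 1) ζ := by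
    rw [Phi_dd hc hs]; simp [dT]
  rw [e, hT, Phi_dYY hc hs, Phi_dY hc hs]
  unfold Rv
  set S := sv t0 ζ
  set P := Phi x0 t0 b c ζ
  set P1 := Phi x0 t0 b (c + 1) ζ
  set P2 := Phi x0 t0 b (c + 1 + 1) ζ
  have hS := hs.ne'
  field_simp
  linear_combination (256 * x0 ^ 2) * hB

end

set_option linter.all false
noncomputable section
open Real MeasureTheory
variable {m : ℕ}

def sg (a y : ℝ) : ℝ := y * |y| ^ (-a)

lemma sg_abs {a y : ℝ} (ha : a < 1) : |sg a y| = |y| ^ (1 - a) := by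
  unfold sg
  by_cases h : y = 0
  · subst h; simp [Real.zero_rpow (by linarith : (1:ℝ) - a ≠ 0)]
  · have := abs_pos.2 h
    rw [abs_mul, abs_of_nonneg (by positivity : 0 ≤ |y| ^ (-a)), show 1 - a = 1 + -a by ring, Real.rpow_add this, Real.rpow_one]
lemma sg_cont {a : ℝ} (ha : a < 1) : Continuous (sg a) := by
  rw [continuous_iff_continuousAt]
  intro y
  by_cases h : y = 0
  · subst h
    have e0 : sg a 0 = 0 := by simp [sg]
    rw [ContinuousAt, e0, tendsto_zero_iff_abs_tendsto_zero]
    have : Continuous fun y : ℝ => |y| ^ (1 - a) := by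
      have := Real.continuous_rpow_const (q := 1 - a) (by linarith)
      fun_prop
    have h2 := this.tendsto 0
    simp only [abs_zero, Real.zero_rpow (by linarith : (1:ℝ) - a ≠ 0)] at h2
    refine h2.congr fun y => ?_
    simp [sg_abs ha]
  · exact continuousAt_id.mul ((hasDerivAt_absrpow (-a) h).continuousAt)
lemma sg_der (a : ℝ) {y : ℝ} (h : y ≠ 0) : HasDerivAt (sg a) ((1 - a) * |y| ^ (-a)) y := by
  have := (hasDerivAt_id y).mul (hasDerivAt_absrpow (-a) h)
  refine this.congr_deriv ?_
  simp only [id]; field_simp; ring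
lemma sg1_der (a : ℝ) {y : ℝ} (h : y ≠ 0) : HasDerivAt (fun y : ℝ => (1 - a) * |y| ^ (-a)) ((1 - a) * (-a / y * |y| ^ (-a))) y :=
  (hasDerivAt_absrpow (-a) h).const_mul _
lemma abs_rpow_mul_neg (a : ℝ) {y : ℝ} (h : y ≠ 0) : |y| ^ a * |y| ^ (-a) = 1 := by
  rw [← Real.rpow_add (abs_pos.2 h)]; simp
lemma sg_cd (a : ℝ) {ζ : FF m} (h : ζ.2 ≠ 0) : ContDiffAt ℝ 2 (fun ζ : FF m => sg a ζ.2) ζ :=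
  contDiffAt_snd.mul (cdAt_abs_rpow (-a) h (n := 2))
lemma sg_dd (a : ℝ) {ζ : FF m} (h : ζ.2 ≠ 0) (d : FF m) : dd d (fun ζ : FF m => sg a ζ.2) ζ = (1 - a) * |ζ.2| ^ (-a) * d.2 := by
  rw [dd_dir_fun (sg_der a h).differentiableAt, (sg_der a h).deriv]
lemma sg1_dd (a : ℝ) {ζ : FF m} (h : ζ.2 ≠ 0) (d : FF m) : dd d (fun ζ : FF m => (1 - a) * |ζ.2| ^ (-a)) ζ = (1 - a) * (-a / ζ.2 * |ζ.2| ^ (-a)) * d.2 := by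
  rw [dd_dir_fun (g := fun y => (1 - a) * |y| ^ (-a)) (sg1_der a h).differentiableAt, (sg1_der a h).deriv]

/-- the kernel parameters -/
structure KP (m : ℕ) where
  a : ℝ
  x0 : ℝ
  t0 : ℝ
  b : Fin m → ℝ
  c0 : ℝ
  kp : ℝ
  ha1 : -1 < a
  ha2 : a < 1
  hc0 : 0 < c0
  hkp : |kp| = |x0 / 4| ^ (1 - a)

namespace KP
variable (p : KP m)
def s (ζ : FF m) : ℝ := sv p.t0 ζ
def F1 : FF m → ℝ := Phi p.x0 p.t0 p.b ((1 + p.a) / 2)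
def F2 : FF m → ℝ := Phi p.x0 p.t0 p.b ((3 - p.a) / 2)
/-- the kernel -/
def G (ζ : FF m) : ℝ := p.c0 * (p.F1 ζ + p.kp * (sg p.a ζ.2 * p.F2 ζ))
def D1 (ζ : FF m) : ℝ := -1 / (2 * p.s ζ) * p.F1 ζ + p.x0 ^ 2 / (8 * p.s ζ) * Phi p.x0 p.t0 p.b ((1 + p.a) / 2 + 1) ζ
def D2 (ζ : FF m) : ℝ := -1 / (2 * p.s ζ) * p.F2 ζ + p.x0 ^ 2 / (8 * p.s ζ) * Phi p.x0 p.t0 p.b ((3 - p.a) / 2 + 1) ζ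
/-- the flux -/
def W (ζ : FF m) : ℝ := p.c0 * (sg (-p.a) ζ.2 * p.D1 ζ + p.kp * ((1 - p.a) * p.F2 ζ + ζ.2 ^ 2 * p.D2 ζ))

lemma h1 : 0 < (1 + p.a) / 2 := by have := p.ha1; linarith
lemma h2 : 0 < (3 - p.a) / 2 := by have := p.ha2; linarith

lemma Phi_ca {c : ℝ} (hc : 0 < c) {ζ : FF m} (hs : 0 < p.s ζ) : ContinuousAt (Phi p.x0 p.t0 p.b c) ζ :=
  (Phi_cd hc hs 0).continuousAt
lemma s_cont : Continuous p.s := (sv_cd p.t0 (n := 0)).continuous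
lemma sg_ca (ζ : FF m) : ContinuousAt (fun ζ : FF m => sg p.a ζ.2) ζ := ((sg_cont p.ha2).comp continuous_snd).continuousAt
lemma sgn_ca (ζ : FF m) : ContinuousAt (fun ζ : FF m => sg (-p.a) ζ.2) ζ := ((sg_cont (by have := p.ha1; linarith)).comp continuous_snd).continuousAt
lemma G_ca {ζ : FF m} (hs : 0 < p.s ζ) : ContinuousAt p.G ζ := by
  have h1 : ContinuousAt p.F1 ζ := p.Phi_ca p.h1 hs
  have h2 : ContinuousAt p.F2 ζ := p.Phi_ca p.h2 hs
  have h3 := p.sg_ca ζ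
  unfold G
  exact continuousAt_const.mul (h1.add (continuousAt_const.mul (h3.mul h2)))
lemma q_ca (k j : ℝ) (hj : j ≠ 0) {ζ : FF m} (hs : 0 < p.s ζ) : ContinuousAt (fun ζ => k / (j * p.s ζ)) ζ :=
  continuousAt_const.div (continuousAt_const.mul p.s_cont.continuousAt) (mul_ne_zero hj hs.ne')
lemma D1_ca {ζ : FF m} (hs : 0 < p.s ζ) : ContinuousAt p.D1 ζ := by
  unfold D1
  exact ((p.q_ca _ 2 (by norm_num) hs).mul (p.Phi_ca p.h1 hs)).add ((p.q_ca _ 8 (by norm_num) hs).mul (p.Phi_ca (by linarith [p.h1]) hs))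
lemma D2_ca {ζ : FF m} (hs : 0 < p.s ζ) : ContinuousAt p.D2 ζ := by
  unfold D2
  exact ((p.q_ca _ 2 (by norm_num) hs).mul (p.Phi_ca p.h2 hs)).add ((p.q_ca _ 8 (by norm_num) hs).mul (p.Phi_ca (by linarith [p.h2]) hs))
lemma W_ca {ζ : FF m} (hs : 0 < p.s ζ) : ContinuousAt p.W ζ := by
  unfold W
  exact continuousAt_const.mul (((p.sgn_ca ζ).mul (p.D1_ca hs)).add (continuousAt_const.mul ((continuousAt_const.mul (p.Phi_ca p.h2 hs)).add
    ((continuousAt_snd.pow 2).mul (p.D2_ca hs)))))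
lemma F1_cd {ζ : FF m} (hs : 0 < p.s ζ) : ContDiffAt ℝ 2 p.F1 ζ := Phi_cd p.h1 hs 2
lemma F2_cd {ζ : FF m} (hs : 0 < p.s ζ) : ContDiffAt ℝ 2 p.F2 ζ := Phi_cd p.h2 hs 2
lemma G_cd {ζ : FF m} (hs : 0 < p.s ζ) (hy : ζ.2 ≠ 0) : ContDiffAt ℝ 2 p.G ζ :=
  contDiffAt_const.mul ((p.F1_cd hs).add (contDiffAt_const.mul ((sg_cd p.a hy).mul (p.F2_cd hs))))

lemma sF_dd {ζ : FF m} (hs : 0 < p.s ζ) (hy : ζ.2 ≠ 0) (d : FF m) :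
    dd d (fun ζ => sg p.a ζ.2 * p.F2 ζ) ζ = sg p.a ζ.2 * dd d p.F2 ζ + p.F2 ζ * ((1 - p.a) * |ζ.2| ^ (-p.a) * d.2) := by
  rw [dd_mul d (cdAt_da (sg_cd p.a hy)) (cdAt_da (p.F2_cd hs)), sg_dd p.a hy]
lemma G_dd {ζ : FF m} (hs : 0 < p.s ζ) (hy : ζ.2 ≠ 0) (d : FF m) :
    dd d p.G ζ = p.c0 * (dd d p.F1 ζ + p.kp * (sg p.a ζ.2 * dd d p.F2 ζ + p.F2 ζ * ((1 - p.a) * |ζ.2| ^ (-p.a) * d.2))) := by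
  have a1 := cdAt_da (p.F1_cd hs)
  have a2 := cdAt_da ((sg_cd p.a hy).mul (p.F2_cd hs))
  unfold G
  rw [dd_const_mul d p.c0 (a1.fun_add (a2.const_mul _)), dd_add d a1 (a2.const_mul _), dd_const_mul d p.kp a2, p.sF_dd hs hy]
lemma G_dI {ζ : FF m} (hs : 0 < p.s ζ) (hy : ζ.2 ≠ 0) (i : Fin m) :
    dd (dI i) p.G ζ = (p.b i - ζ.1.1 i) / (2 * p.s ζ) * p.G ζ := by
  have e1 : dd (dI i) p.F1 ζ = (p.b i - ζ.1.1 i) / (2 * p.s ζ) * p.F1 ζ := Phi_dI p.h1 hs i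
  have e2 : dd (dI i) p.F2 ζ = (p.b i - ζ.1.1 i) / (2 * p.s ζ) * p.F2 ζ := Phi_dI p.h2 hs i
  rw [p.G_dd hs hy, e1, e2]
  simp only [dI, G]; ring
lemma G_W {ζ : FF m} (hs : 0 < p.s ζ) (hy : ζ.2 ≠ 0) : |ζ.2| ^ p.a * dd dY p.G ζ = p.W ζ := by
  have e1 : dd dY p.F1 ζ = ζ.2 * p.D1 ζ := Phi_dY p.h1 hs
  have e2 : dd dY p.F2 ζ = ζ.2 * p.D2 ζ := Phi_dY p.h2 hs
  have e3 := abs_rpow_mul_neg p.a hy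
  rw [p.G_dd hs hy, e1, e2]
  simp only [dY, W, sg, neg_neg]
  linear_combination (p.c0 * p.kp * (ζ.2 ^ 2 * p.D2 ζ + p.F2 ζ * (1 - p.a))) * e3
lemma G_pde {ζ : FF m} (hs : 0 < p.s ζ) (hy : ζ.2 ≠ 0) :
    dd dT p.G ζ + (∑ i, dd (dI i) (dd (dI i) p.G) ζ) + dd dY (dd dY p.G) ζ + p.a / ζ.2 * dd dY p.G ζ = 0 := by
  have d2 : ∀ d : FF m, dd d (dd d p.G) ζ = p.c0 * (dd d (dd d p.F1) ζ + p.kp * (sg p.a ζ.2 * dd d (dd d p.F2) ζ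
      + 2 * dd d p.F2 ζ * ((1 - p.a) * |ζ.2| ^ (-p.a) * d.2) + p.F2 ζ * ((1 - p.a) * (-p.a / ζ.2 * |ζ.2| ^ (-p.a)) * d.2 * d.2))) := by
    intro d
    have ev : dd d p.G =ᶠ[nhds ζ] fun ζ => p.c0 * (dd d p.F1 ζ + p.kp * (sg p.a ζ.2 * dd d p.F2 ζ + d.2 * (p.F2 ζ * ((1 - p.a) * |ζ.2| ^ (-p.a))))) := by
      filter_upwards [sv_nhds hs, ne_nhds hy] with x hx hx'
      rw [p.G_dd hx hx']; ring
    have a1 := cdAt_dda (p.F1_cd hs) d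
    have a2 := cdAt_dda (p.F2_cd hs) d
    have a3 := cdAt_da (p.F2_cd hs)
    have a4 := cdAt_da (sg_cd p.a hy)
    have a5 : DifferentiableAt ℝ (fun ζ : FF m => (1 - p.a) * |ζ.2| ^ (-p.a)) ζ := cdAt_da (contDiffAt_const.mul (cdAt_abs_rpow (-p.a) hy (n := 2)))
    have a6 := a3.fun_mul a5
    have a7 := a4.fun_mul a2
    rw [dd_congr d ev, dd_const_mul d p.c0 (a1.fun_add ((a7.fun_add (a6.const_mul _)).const_mul _)),
      dd_add d a1 ((a7.fun_add (a6.const_mul _)).const_mul _), dd_const_mul d p.kp (a7.fun_add (a6.const_mul _)),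
      dd_add d a7 (a6.const_mul _), dd_const_mul d d.2 a6, dd_mul d a4 a2, dd_mul d a3 a5, sg_dd p.a hy, sg1_dd p.a hy]
    ring
  have p1 : _ + (2 * ((1 + p.a) / 2) - 1) / ζ.2 * dd dY p.F1 ζ = 0 := Phi_pde (x0 := p.x0) (b := p.b) p.h1 hs hy
  have p2 : _ + (2 * ((3 - p.a) / 2) - 1) / ζ.2 * dd dY p.F2 ζ = 0 := Phi_pde (x0 := p.x0) (b := p.b) p.h2 hs hy
  simp only [d2, p.G_dd hs hy, show (dT : FF m).2 = 0 from rfl, show ∀ i, (dI i : FF m).2 = 0 from fun _ => rfl, show (dY : FF m).2 = 1 from rfl, mul_zero, zero_mul, add_zero, mul_one, ← Finset.mul_sum, Finset.sum_add_distrib]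
  change dd dT p.F1 ζ + (∑ i, dd (dI i) (dd (dI i) p.F1) ζ) + dd dY (dd dY p.F1) ζ + _ = 0 at p1
  change dd dT p.F2 ζ + (∑ i, dd (dI i) (dd (dI i) p.F2) ζ) + dd dY (dd dY p.F2) ζ + _ = 0 at p2
  unfold sg
  field_simp at p1 p2 ⊢
  linear_combination p.c0 * p1 + p.c0 * p.kp * ζ.2 * |ζ.2| ^ (-p.a) * p2
lemma G_plane {q : QQ m} : p.G (q, 0) = p.c0 * p.F1 (q, 0) := by simp [G, sg]
end KP

end

set_option linter.all false
noncomputable section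
open Real MeasureTheory
variable {m : ℕ}

lemma gau {x ν : ℝ} (hν : 0 < ν) (hν1 : ν < 1) (hx : 0 < x + ν) : (x + ν) ^ ν * Real.Gamma (x + 1) ≤ Real.Gamma (x + 1 + ν) := by
  have hg := Real.Gamma_pos_of_pos hx
  have e : Real.Gamma (x + 1 + ν) = (x + ν) * Real.Gamma (x + ν) := by rw [← Real.Gamma_add_one hx.ne']; congr 1; ring
  have h := Real.Gamma_mul_add_mul_le_rpow_Gamma_mul_rpow_Gamma (s := x + ν) (t := x + 1 + ν) (a := ν) (b := 1 - ν) hx (by linarith) hν (by linarith) (by ring)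
  rw [show ν * (x + ν) + (1 - ν) * (x + 1 + ν) = x + 1 by ring, e, Real.mul_rpow hx.le hg.le] at h
  have h2 : Real.Gamma (x + ν) ^ ν * Real.Gamma (x + ν) ^ (1 - ν) = Real.Gamma (x + ν) := by
    rw [← Real.rpow_add hg]; simp
  have h3 : (x + ν) ^ ν * (x + ν) ^ (1 - ν) = x + ν := by rw [← Real.rpow_add hx]; simp
  have h4 : Real.Gamma (x + 1) ≤ (x + ν) ^ (1 - ν) * Real.Gamma (x + ν) := by
    calc _ ≤ _ := h
      _ = (x + ν) ^ (1 - ν) * (Real.Gamma (x + ν) ^ ν * Real.Gamma (x + ν) ^ (1 - ν)) := by ring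
      _ = _ := by rw [h2]
  calc _ ≤ (x + ν) ^ ν * ((x + ν) ^ (1 - ν) * Real.Gamma (x + ν)) := by gcongr
    _ = ((x + ν) ^ ν * (x + ν) ^ (1 - ν)) * Real.Gamma (x + ν) := by ring
    _ = _ := by rw [h3, e]

lemma gk {ν : ℝ} (hν : 0 < ν) (hν1 : ν < 1) (k : ℕ) :
    ((k:ℝ) + 1) ^ (2 * ν) * Real.Gamma (k + (1 - ν)) ≤ 2 / (1 - ν) * Real.Gamma (k + (1 + ν)) := by
  have hk : (0:ℝ) ≤ k := by positivity
  have a1 := gau (x := (k:ℝ) + 1) hν hν1 (by positivity)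
  have a2 := gau (x := (k:ℝ) + 1 - ν) hν hν1 (by linarith)
  rw [show (k:ℝ) + 1 - ν + ν = k + 1 by ring, show (k:ℝ) + 1 - ν + 1 + ν = k + 1 + 1 by ring,
    show (k:ℝ) + 1 - ν + 1 = (k + (1 - ν)) + 1 by ring, Real.Gamma_add_one (s := (k:ℝ) + (1 - ν)) (by linarith)] at a2
  rw [show (k:ℝ) + 1 + 1 + ν = (k + (1 + ν)) + 1 by ring, Real.Gamma_add_one (s := (k:ℝ) + (1 + ν)) (by positivity)] at a1
  have g1 : 0 < Real.Gamma (k + (1 - ν)) := Real.Gamma_pos_of_pos (by linarith)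
  have g2 : 0 < Real.Gamma (k + (1 + ν)) := Real.Gamma_pos_of_pos (by linarith)
  have a3 : ((k:ℝ) + 1) ^ ν ≤ ((k:ℝ) + 1 + ν) ^ ν := Real.rpow_le_rpow (by positivity) (by linarith) hν.le
  have e : ((k:ℝ) + 1) ^ (2 * ν) = ((k:ℝ) + 1) ^ ν * ((k:ℝ) + 1) ^ ν := by rw [← Real.rpow_add (by positivity)]; congr 1; ring
  have hp : 0 < ((k:ℝ) + 1) ^ ν := by positivity
  have a4 : ((k:ℝ) + 1) ^ ν * (((k:ℝ) + 1) ^ ν * (((k:ℝ) + (1 - ν)) * Real.Gamma (k + (1 - ν)))) ≤ (k + (1 + ν)) * Real.Gamma (k + (1 + ν)) := by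
    calc _ ≤ ((k:ℝ) + 1) ^ ν * Real.Gamma (k + 1 + 1) := by gcongr
      _ ≤ ((k:ℝ) + 1 + ν) ^ ν * Real.Gamma (k + 1 + 1) := by
        have : 0 < Real.Gamma ((k:ℝ) + 1 + 1) := Real.Gamma_pos_of_pos (by positivity)
        gcongr
      _ ≤ _ := a1
  rw [div_mul_eq_mul_div, le_div_iff₀ (by linarith), e]
  set p := ((k:ℝ) + 1) ^ ν
  set g := Real.Gamma (k + (1 - ν))
  set g' := Real.Gamma (k + (1 + ν))
  have a5 : p * p * g * ((1 - ν) * (k + 1)) ≤ p * p * g * (k + (1 - ν)) := by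
    have : 0 ≤ p * p * g := by positivity
    refine mul_le_mul_of_nonneg_left ?_ this
    nlinarith
  have a6 : (k + (1 + ν)) * g' ≤ (2 * (k + 1)) * g' := by
    refine mul_le_mul_of_nonneg_right ?_ g2.le
    linarith
  have : (p * p * g * (1 - ν)) * (k + 1) ≤ (2 * g') * (k + 1) := by linarith
  exact le_of_mul_le_mul_right this (by positivity)

lemma pt_succ_lb {ν : ℝ} (hν : 0 < ν) (hν1 : ν < 1) (k : ℕ) : pt (1 - ν) k / ((k:ℝ) + 1) ^ 2 ≤ pt (1 - ν) (k + 1) := by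
  have hk0 : (0:ℝ) ≤ k := by positivity
  have e : pt (1 - ν) (k + 1) = pt (1 - ν) k / (((k:ℝ) + 1) * (k + (1 - ν))) := by
    unfold pt
    rw [show ((k + 1 : ℕ) : ℝ) + (1 - ν) = (k + (1 - ν)) + 1 by push_cast; ring, Real.Gamma_add_one (s := (k:ℝ) + (1 - ν)) (by linarith), Nat.factorial_succ]
    push_cast
    rw [div_div]; congr 1; ring
  rw [e]
  have hk : (0:ℝ) ≤ k := by positivity
  have := (pt_pos (c := 1 - ν) (by linarith) k).le
  refine div_le_div_of_nonneg_left this (mul_pos (by positivity) (by linarith)) ?_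
  rw [sq]; gcongr; linarith

lemma Pc_cmp {ν : ℝ} (hν : 0 < ν) (hν1 : ν < 1) {w : ℝ} (hw : 0 ≤ w) :
    w ^ ν * Pc (1 + ν) w ≤ 4 / (1 - ν) * Pc (1 - ν) w := by
  have h1ν : 0 < 1 - ν := by linarith
  have s1 := pt_summable (c := 1 + ν) (by linarith) w
  have s2 := pt_summable (c := 1 - ν) (by linarith) w
  have s3 := (summable_nat_add_iff 1).2 s2
  have hterm : ∀ k : ℕ, w ^ ν * (pt (1 + ν) k * w ^ k) ≤ 2 / (1 - ν) * (pt (1 - ν) k * w ^ k + pt (1 - ν) (k + 1) * w ^ (k + 1)) := by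
    intro k
    set j : ℝ := (k:ℝ) + 1
    have hj : 0 < j := by positivity
    have g1 : 0 < Real.Gamma (k + (1 - ν)) := Gam_pos h1ν k
    have g2 : 0 < Real.Gamma (k + (1 + ν)) := Gam_pos (by linarith) k
    have hA : w ^ ν ≤ j ^ (2 * ν) * (1 + w / j ^ 2) := by
      have hx : 0 ≤ w / j ^ 2 := by positivity
      have e : w ^ ν = j ^ (2 * ν) * (w / j ^ 2) ^ ν := by
        rw [Real.div_rpow hw (by positivity), ← Real.rpow_natCast, ← Real.rpow_mul hj.le]
        push_cast
        field_simp
      rw [e]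
      gcongr
      rcases le_total (w / j ^ 2) 1 with h | h
      · exact (Real.rpow_le_one hx h hν.le).trans (by linarith)
      · calc _ ≤ (w / j ^ 2) ^ (1:ℝ) := Real.rpow_le_rpow_of_exponent_le h hν1.le
          _ ≤ _ := by rw [Real.rpow_one]; linarith
    have hB : j ^ (2 * ν) * pt (1 + ν) k ≤ 2 / (1 - ν) * pt (1 - ν) k := by
      have := gk hν hν1 k
      unfold pt
      rw [mul_one_div, mul_one_div, div_le_div_iff₀ (by positivity) (by positivity)]
      calc _ = (Nat.factorial k : ℝ) * (j ^ (2 * ν) * Real.Gamma (k + (1 - ν))) := by ring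
        _ ≤ (Nat.factorial k : ℝ) * (2 / (1 - ν) * Real.Gamma (k + (1 + ν))) := by gcongr
        _ = _ := by ring
    have hC := pt_succ_lb hν hν1 k
    have p1 := (pt_pos (c := 1 + ν) (by linarith) k).le
    calc w ^ ν * (pt (1 + ν) k * w ^ k) ≤ (j ^ (2 * ν) * (1 + w / j ^ 2)) * (pt (1 + ν) k * w ^ k) := by gcongr
      _ = (j ^ (2 * ν) * pt (1 + ν) k) * ((1 + w / j ^ 2) * w ^ k) := by ring
      _ ≤ (2 / (1 - ν) * pt (1 - ν) k) * ((1 + w / j ^ 2) * w ^ k) := by gcongr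
      _ = 2 / (1 - ν) * (pt (1 - ν) k * w ^ k + pt (1 - ν) k / j ^ 2 * w ^ (k + 1)) := by field_simp; ring
      _ ≤ _ := by gcongr
  have e1 : w ^ ν * Pc (1 + ν) w = ∑' k, w ^ ν * (pt (1 + ν) k * w ^ k) := by unfold Pc; rw [tsum_mul_left]
  have e2 : ∑' k, 2 / (1 - ν) * (pt (1 - ν) k * w ^ k + pt (1 - ν) (k + 1) * w ^ (k + 1)) ≤ 2 / (1 - ν) * (Pc (1 - ν) w + Pc (1 - ν) w) := by
    rw [tsum_mul_left, s2.tsum_add s3]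
    have : ∑' k, pt (1 - ν) (k + 1) * w ^ (k + 1) ≤ Pc (1 - ν) w := by
      unfold Pc
      rw [s2.tsum_eq_zero_add]
      have := (pt_pos (c := 1 - ν) (by linarith) 0).le
      simpa using this
    unfold Pc at this ⊢
    gcongr
  rw [e1]
  refine ((s1.mul_left _).tsum_le_tsum hterm ((s2.add s3).mul_left _)).trans (e2.trans (le_of_eq ?_))
  ring

lemma Pc_crude {ν : ℝ} (hν : 0 < ν) (hν1 : ν < 1) {w : ℝ} (hw : 0 ≤ w) :
    Pc (1 - ν) w ≤ (1 + 2 * √w) * Real.exp (2 * √w) := by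
  set x := 2 * √w
  have hx : 0 ≤ x := by positivity
  have hxw : x ^ 2 = 4 * w := by simp only [x]; rw [mul_pow, Real.sq_sqrt hw]; norm_num
  have he : HasSum (fun j : ℕ => x ^ j / (Nat.factorial j : ℝ)) (Real.exp x) := by
    have := NormedSpace.expSeries_div_hasSum_exp (𝔸 := ℝ) x
    rwa [← Real.exp_eq_exp_ℝ] at this
  have hs1 : HasSum (fun j : ℕ => (j:ℝ) * (x ^ j / (Nat.factorial j : ℝ))) (x * Real.exp x) := by
    rw [← hasSum_nat_add_iff' 1]
    simp only [Finset.range_one, Finset.sum_singleton, Nat.cast_zero, zero_mul, sub_zero]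
    refine (he.mul_left x).congr_fun ?_ |> fun h => h
    intro k
    rw [Nat.factorial_succ]; push_cast
    field_simp
    ring
  have hs := he.add hs1
  set f : ℕ → ℝ := fun j => x ^ j / (Nat.factorial j : ℝ) + (j:ℝ) * (x ^ j / (Nat.factorial j : ℝ)) with hf
  have hf0 : ∀ j, 0 ≤ f j := fun j => by simp only [hf]; positivity
  have hterm : ∀ k : ℕ, pt (1 - ν) k * w ^ k ≤ f (2 * k) := by
    intro k
    have g1 : 0 < Real.Gamma (k + (1 - ν)) := Gam_pos (by linarith) k
    have hk : (0:ℝ) ≤ k := by positivity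
    have a1 := gau (x := (k:ℝ)) (ν := 1 - ν) (by linarith) (by linarith) (by linarith)
    rw [show (k:ℝ) + 1 + (1 - ν) = (k + (1 - ν)) + 1 by ring, Real.Gamma_add_one (s := (k:ℝ) + (1 - ν)) (by linarith), Real.Gamma_nat_eq_factorial] at a1
    have hkp : 0 < (k:ℝ) + (1 - ν) := by linarith
    have a2 : (Nat.factorial k : ℝ) ≤ ((k:ℝ) + 1) * Real.Gamma (k + (1 - ν)) := by
      have e : ((k:ℝ) + (1 - ν)) = ((k:ℝ) + (1 - ν)) ^ (1 - ν) * ((k:ℝ) + (1 - ν)) ^ ν := by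
        rw [← Real.rpow_add hkp]; simp
      have a3 : ((k:ℝ) + (1 - ν)) ^ ν ≤ (k:ℝ) + 1 := by
        calc ((k:ℝ) + (1 - ν)) ^ ν ≤ ((k:ℝ) + 1) ^ ν := Real.rpow_le_rpow hkp.le (by linarith) hν.le
          _ ≤ ((k:ℝ) + 1) ^ (1:ℝ) := Real.rpow_le_rpow_of_exponent_le (by linarith) hν1.le
          _ = _ := Real.rpow_one _
      have hp : 0 < ((k:ℝ) + (1 - ν)) ^ (1 - ν) := by positivity
      have : ((k:ℝ) + (1 - ν)) ^ (1 - ν) * (Nat.factorial k : ℝ) ≤ ((k:ℝ) + (1 - ν)) ^ (1 - ν) * (((k:ℝ) + (1 - ν)) ^ ν * Real.Gamma (k + (1 - ν))) := by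
        rw [← mul_assoc, ← e]; exact a1
      have := le_of_mul_le_mul_left this hp
      exact this.trans (by gcongr)
    have a4 : (Nat.factorial (2 * k) : ℝ) ≤ 4 ^ k * ((Nat.factorial k : ℝ) * (Nat.factorial k : ℝ)) := by
      have h1 := Nat.choose_mul_factorial_mul_factorial (show k ≤ 2 * k by omega)
      rw [show 2 * k - k = k by omega] at h1
      have h2 := Nat.choose_le_two_pow (2 * k) k
      rw [pow_mul] at h2
      have h3 : Nat.factorial (2 * k) ≤ 4 ^ k * (Nat.factorial k * Nat.factorial k) := by
        rw [← h1, mul_assoc]; exact Nat.mul_le_mul_right _ (by simpa using h2)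
      exact_mod_cast h3
    have a5 : pt (1 - ν) k ≤ ((k:ℝ) + 1) * 4 ^ k / (Nat.factorial (2 * k) : ℝ) := by
      unfold pt
      rw [div_le_div_iff₀ (by positivity) (by positivity), one_mul]
      calc (Nat.factorial (2 * k) : ℝ) ≤ 4 ^ k * ((Nat.factorial k : ℝ) * (Nat.factorial k : ℝ)) := a4
        _ ≤ 4 ^ k * ((Nat.factorial k : ℝ) * (((k:ℝ) + 1) * Real.Gamma (k + (1 - ν)))) := by gcongr
        _ = _ := by ring
    calc pt (1 - ν) k * w ^ k ≤ ((k:ℝ) + 1) * 4 ^ k / (Nat.factorial (2 * k) : ℝ) * w ^ k := by gcongr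
      _ = ((k:ℝ) + 1) * (x ^ (2 * k) / (Nat.factorial (2 * k) : ℝ)) := by rw [pow_mul, hxw, mul_pow]; ring
      _ ≤ (1 + ((2 * k : ℕ) : ℝ)) * (x ^ (2 * k) / (Nat.factorial (2 * k) : ℝ)) := by
        refine mul_le_mul_of_nonneg_right ?_ (by positivity)
        push_cast; linarith
      _ = _ := by simp only [hf]; ring
  have inj : Function.Injective fun k : ℕ => 2 * k := fun a b h => by simpa using h
  have s2 := hs.summable.comp_injective inj
  calc Pc (1 - ν) w ≤ ∑' k, f (2 * k) := (pt_summable (by linarith) w).tsum_le_tsum hterm s2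
    _ ≤ ∑' j, f j := Summable.tsum_le_tsum_of_inj (fun k : ℕ => 2 * k) inj (fun c _ => hf0 c) (fun k => le_rfl) s2 hs.summable
    _ = _ := by rw [hs.tsum_eq]; ring

end

set_option linter.all false
noncomputable section
open Real MeasureTheory
variable {m : ℕ}

namespace KP
variable (p : KP m)
def N : ℝ := (m:ℝ) / 2 + (1 + p.a) / 2
lemma N_pos : 0 < p.N := by have := p.h1; unfold N; positivity
def DD (ζ : FF m) : ℝ := (∑ i, (p.b i - ζ.1.1 i) ^ 2) + (|ζ.2| - |p.x0|) ^ 2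
lemma DD_nonneg (ζ : FF m) : 0 ≤ p.DD ζ := by unfold DD; positivity
lemma F1_nonneg {ζ : FF m} (hs : 0 < p.s ζ) : 0 ≤ p.F1 ζ := by
  unfold F1 Phi ph
  have : 0 < sv p.t0 ζ := hs
  have := Pc_nonneg p.h1 (w := p.x0 ^ 2 * ζ.2 ^ 2 / (16 * (sv p.t0 ζ) ^ 2)) (by positivity)
  positivity
lemma F2_cmp {ζ : FF m} (hs : 0 < p.s ζ) : |p.kp * (sg p.a ζ.2 * p.F2 ζ)| ≤ 4 / (1 - (1 - p.a) / 2) * p.F1 ζ := by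
  have ha1 := p.ha1
  have ha2 := p.ha2
  have hs' : 0 < sv p.t0 ζ := hs
  set s := sv p.t0 ζ with hsd
  set w := p.x0 ^ 2 * ζ.2 ^ 2 / (16 * s ^ 2) with hw
  have hw0 : 0 ≤ w := by positivity
  have hc := Pc_cmp (ν := (1 - p.a) / 2) (by linarith) (by linarith) hw0
  have e1 : (1:ℝ) - (1 - p.a) / 2 = (1 + p.a) / 2 := by ring
  have e2 : (1:ℝ) + (1 - p.a) / 2 = (3 - p.a) / 2 := by ring
  rw [e1, e2] at hc
  rw [e1]
  have hP := Pc_nonneg p.h2 hw0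
  have hF2 : p.F2 ζ = s ^ (-p.N) * s ^ (-(1 - p.a)) * Real.exp (-Rv p.x0 p.b ζ / (4 * s)) * Pc ((3 - p.a) / 2) w := by
    unfold F2 Phi ph
    rw [← Real.rpow_add hs']
    congr 3
    unfold N; ring
  have hF1 : p.F1 ζ = s ^ (-p.N) * Real.exp (-Rv p.x0 p.b ζ / (4 * s)) * Pc ((1 + p.a) / 2) w := rfl
  have hk : |p.kp| * |sg p.a ζ.2| * s ^ (-(1 - p.a)) = w ^ ((1 - p.a) / 2) := by
    rw [p.hkp, sg_abs ha2, Real.rpow_neg hs'.le, ← div_eq_mul_inv, ← Real.mul_rpow (by positivity) (by positivity), ← Real.div_rpow (by positivity) hs'.le]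
    have : w = (|p.x0 / 4| * |ζ.2| / s) ^ (2:ℝ) := by
      rw [Real.rpow_two, div_pow, mul_pow, sq_abs, sq_abs, hw]; field_simp; ring
    rw [this, ← Real.rpow_mul (by positivity)]
    congr 1; ring
  rw [abs_mul, abs_mul, hF2, hF1, abs_of_nonneg (by positivity : 0 ≤ s ^ (-p.N) * s ^ (-(1 - p.a)) * Real.exp (-Rv p.x0 p.b ζ / (4 * s)) * Pc ((3 - p.a) / 2) w)]
  calc _ = s ^ (-p.N) * Real.exp (-Rv p.x0 p.b ζ / (4 * s)) * ((|p.kp| * |sg p.a ζ.2| * s ^ (-(1 - p.a))) * Pc ((3 - p.a) / 2) w) := by ring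
    _ ≤ s ^ (-p.N) * Real.exp (-Rv p.x0 p.b ζ / (4 * s)) * (4 / ((1 + p.a) / 2) * Pc ((1 + p.a) / 2) w) := by
      rw [hk]; gcongr
    _ = _ := by ring
def CG : ℝ := p.c0 * (1 + 4 / (1 - (1 - p.a) / 2))
lemma CG_pos : 0 < p.CG := by
  have ha1 := p.ha1
  have : 0 < 1 - (1 - p.a) / 2 := by linarith
  have := p.hc0
  unfold CG; positivity
lemma G_le {ζ : FF m} (hs : 0 < p.s ζ) : |p.G ζ| ≤ p.CG * p.F1 ζ := by
  have h1 := p.F2_cmp hs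
  have h2 := p.F1_nonneg hs
  have h3 := p.hc0
  unfold G CG
  rw [abs_mul, abs_of_pos h3, mul_assoc]
  gcongr
  refine (abs_add_le _ _).trans ?_
  rw [abs_of_nonneg h2]; linarith
lemma F1_crude {ζ : FF m} (hs : 0 < p.s ζ) : p.F1 ζ ≤ (3 + p.x0 ^ 2) * (p.s ζ ^ (-p.N) * (1 + 1 / p.s ζ) * Real.exp (-(p.DD ζ / (8 * p.s ζ)))) := by
  have ha1 := p.ha1
  have ha2 := p.ha2
  have hs' : 0 < sv p.t0 ζ := hs
  have e0 : p.s ζ = sv p.t0 ζ := rfl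
  rw [e0]
  set s := sv p.t0 ζ with hsd
  set w := p.x0 ^ 2 * ζ.2 ^ 2 / (16 * s ^ 2) with hw
  have hw0 : 0 ≤ w := by positivity
  have hc := Pc_crude (ν := (1 - p.a) / 2) (by linarith) (by linarith) hw0
  rw [show (1:ℝ) - (1 - p.a) / 2 = (1 + p.a) / 2 by ring] at hc
  have hF1 : p.F1 ζ = s ^ (-p.N) * Real.exp (-Rv p.x0 p.b ζ / (4 * s)) * Pc ((1 + p.a) / 2) w := rfl
  have hsq : 2 * √w = |p.x0| * |ζ.2| / (2 * s) := by
    have : w = (|p.x0| * |ζ.2| / (4 * s)) ^ 2 := by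
      rw [div_pow, mul_pow, sq_abs, sq_abs, hw]; congr 1; ring
    rw [this, Real.sqrt_sq (by positivity)]; field_simp; ring
  rw [hsq] at hc
  set d := |ζ.2| - |p.x0| with hd
  have hxx : p.x0 ^ 2 = |p.x0| ^ 2 := (sq_abs _).symm
  have hDd : d ^ 2 ≤ p.DD ζ := by
    unfold DD
    have : 0 ≤ ∑ i, (p.b i - ζ.1.1 i) ^ 2 := by positivity
    linarith
  have hB : 1 + |p.x0| * |ζ.2| / (2 * s) ≤ (3 + p.x0 ^ 2 / s) * Real.exp (p.DD ζ / (8 * s)) := by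
    have hE1 : 1 ≤ Real.exp (p.DD ζ / (8 * s)) := Real.one_le_exp (by have := p.DD_nonneg ζ; positivity)
    have hE2 : d ^ 2 / (8 * s) ≤ Real.exp (p.DD ζ / (8 * s)) := by
      have h1 := Real.add_one_le_exp (p.DD ζ / (8 * s))
      have : d ^ 2 / (8 * s) ≤ p.DD ζ / (8 * s) := by gcongr
      linarith
    have h3 : |p.x0| * |ζ.2| / (2 * s) ≤ p.x0 ^ 2 / s + 2 * (d ^ 2 / (8 * s)) := by
      rw [show p.x0 ^ 2 / s + 2 * (d ^ 2 / (8 * s)) = (2 * |p.x0| ^ 2 + d ^ 2 / 2) / (2 * s) by rw [hxx]; field_simp; ring]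
      gcongr
      have : |ζ.2| = d + |p.x0| := by rw [hd]; ring
      rw [this]
      nlinarith [sq_nonneg (|p.x0| - d)]
    have h4 : 0 ≤ p.x0 ^ 2 / s := by positivity
    nlinarith
  have hexp : Real.exp (-Rv p.x0 p.b ζ / (4 * s)) * Real.exp (|p.x0| * |ζ.2| / (2 * s)) * Real.exp (p.DD ζ / (8 * s)) = Real.exp (-(p.DD ζ / (8 * s))) := by
    rw [← Real.exp_add, ← Real.exp_add]
    congr 1
    have : Rv p.x0 p.b ζ = p.DD ζ + 2 * (|p.x0| * |ζ.2|) := by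
      unfold Rv DD
      rw [← sq_abs ζ.2, hxx]; ring
    rw [this]; field_simp; ring
  rw [hF1]
  calc _ ≤ s ^ (-p.N) * Real.exp (-Rv p.x0 p.b ζ / (4 * s)) * ((1 + |p.x0| * |ζ.2| / (2 * s)) * Real.exp (|p.x0| * |ζ.2| / (2 * s))) := by gcongr
    _ ≤ s ^ (-p.N) * Real.exp (-Rv p.x0 p.b ζ / (4 * s)) * (((3 + p.x0 ^ 2 / s) * Real.exp (p.DD ζ / (8 * s))) * Real.exp (|p.x0| * |ζ.2| / (2 * s))) := by gcongr
    _ = s ^ (-p.N) * (3 + p.x0 ^ 2 / s) * (Real.exp (-Rv p.x0 p.b ζ / (4 * s)) * Real.exp (|p.x0| * |ζ.2| / (2 * s)) * Real.exp (p.DD ζ / (8 * s))) := by ring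
    _ = s ^ (-p.N) * (3 + p.x0 ^ 2 / s) * Real.exp (-(p.DD ζ / (8 * s))) := by rw [hexp]
    _ ≤ s ^ (-p.N) * ((3 + p.x0 ^ 2) * (1 + 1 / s)) * Real.exp (-(p.DD ζ / (8 * s))) := by
      gcongr
      have : (3 + p.x0 ^ 2) * (1 + 1 / s) = 3 + p.x0 ^ 2 / s + (p.x0 ^ 2 + 3 / s) := by ring
      rw [this]
      have : 0 ≤ p.x0 ^ 2 + 3 / s := by positivity
      linarith
    _ = _ := by ring
lemma G_crude : ∃ C, 0 < C ∧ ∀ ζ, 0 < p.s ζ → |p.G ζ| ≤ C * (p.s ζ ^ (-p.N) * (1 + 1 / p.s ζ) * Real.exp (-(p.DD ζ / (8 * p.s ζ)))) := by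
  refine ⟨p.CG * (3 + p.x0 ^ 2), by have := p.CG_pos; positivity, fun ζ hs => (p.G_le hs).trans ?_⟩
  rw [mul_assoc]
  exact mul_le_mul_of_nonneg_left (p.F1_crude hs) p.CG_pos.le

/-- control of the superlevel sets -/
lemma bdd {l : ℝ} (hl : 0 < l) : ∃ C, 0 < C ∧ ∀ ζ, 0 < p.s ζ → l ≤ p.G ζ →
    p.s ζ ≤ C ∧ p.DD ζ ≤ C * p.s ζ ^ (4/5:ℝ) ∧ Real.log (p.G ζ / l) ≤ C * p.s ζ ^ (-(1/5):ℝ) := by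
  obtain ⟨C, hC, hb⟩ := p.G_crude
  have hN := p.N_pos
  set S := max 1 ((2 * C / l) ^ (1 / p.N)) with hS
  have hS1 : 1 ≤ S := le_max_left _ _
  have hs1 : ∀ ζ, 0 < p.s ζ → l ≤ p.G ζ → p.s ζ ≤ S := by
    intro ζ hs hG
    rcases le_total (p.s ζ) 1 with h | h
    · exact h.trans hS1
    · refine le_trans ?_ (le_max_right _ _)
      have h1 := (hG.trans (le_abs_self _)).trans (hb ζ hs)
      have h2 : Real.exp (-(p.DD ζ / (8 * p.s ζ))) ≤ 1 := Real.exp_le_one_iff.2 (by have := p.DD_nonneg ζ; simp only [Left.neg_nonpos_iff]; positivity)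
      have h3 : 1 / p.s ζ ≤ 1 := by rw [div_le_one hs]; exact h
      have h4 : l ≤ C * (p.s ζ ^ (-p.N) * (1 + 1) * 1) := h1.trans (by gcongr)
      have h5 : p.s ζ ^ p.N ≤ 2 * C / l := by
        rw [le_div_iff₀ hl]
        have e : p.s ζ ^ p.N * p.s ζ ^ (-p.N) = 1 := by rw [← Real.rpow_add hs]; simp
        calc p.s ζ ^ p.N * l ≤ p.s ζ ^ p.N * (C * (p.s ζ ^ (-p.N) * (1 + 1) * 1)) := by gcongr
          _ = (p.s ζ ^ p.N * p.s ζ ^ (-p.N)) * (2 * C) := by ring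
          _ = _ := by rw [e, one_mul]
      calc p.s ζ = (p.s ζ ^ p.N) ^ (1 / p.N) := by rw [← Real.rpow_mul hs.le, mul_one_div_cancel hN.ne', Real.rpow_one]
        _ ≤ _ := Real.rpow_le_rpow (by positivity) h5 (by positivity)
  set e : ℝ := 1 / (5 * (p.N + 1)) with he
  have he0 : 0 < e := by positivity
  set K := (C / l * (S + 1)) ^ e / e with hK
  have hK0 : 0 < K := by positivity
  have key : ∀ ζ, 0 < p.s ζ → l ≤ p.G ζ → p.DD ζ / (8 * p.s ζ) + Real.log (p.G ζ / l) ≤ K * p.s ζ ^ (-(1/5):ℝ) := by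
    intro ζ hs hG
    have hG0 : 0 < p.G ζ := hl.trans_le hG
    have h1 := (le_abs_self _).trans (hb ζ hs)
    have h2 : p.G ζ / l * Real.exp (p.DD ζ / (8 * p.s ζ)) ≤ (C / l * (S + 1)) * p.s ζ ^ (-(p.N + 1)) := by
      have e1 : Real.exp (-(p.DD ζ / (8 * p.s ζ))) * Real.exp (p.DD ζ / (8 * p.s ζ)) = 1 := by rw [← Real.exp_add]; simp
      have e2 : p.s ζ ^ (-p.N) * (1 + 1 / p.s ζ) = p.s ζ ^ (-(p.N + 1)) * (p.s ζ + 1) := by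
        rw [show -(p.N + 1) = -p.N - 1 by ring, Real.rpow_sub_one hs.ne']; field_simp
      calc _ ≤ C * (p.s ζ ^ (-p.N) * (1 + 1 / p.s ζ) * Real.exp (-(p.DD ζ / (8 * p.s ζ)))) / l * Real.exp (p.DD ζ / (8 * p.s ζ)) := by gcongr
        _ = C / l * (p.s ζ ^ (-p.N) * (1 + 1 / p.s ζ)) * (Real.exp (-(p.DD ζ / (8 * p.s ζ))) * Real.exp (p.DD ζ / (8 * p.s ζ))) := by ring
        _ = C / l * (p.s ζ + 1) * p.s ζ ^ (-(p.N + 1)) := by rw [e1, e2]; ring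
        _ ≤ _ := by have := hs1 ζ hs hG; gcongr
    have h3 : p.DD ζ / (8 * p.s ζ) + Real.log (p.G ζ / l) = Real.log (p.G ζ / l * Real.exp (p.DD ζ / (8 * p.s ζ))) := by
      rw [Real.log_mul (by positivity) (by positivity), Real.log_exp, add_comm]
    rw [h3]
    refine (Real.log_le_rpow_div (by positivity) he0).trans ?_
    rw [show K * p.s ζ ^ (-(1/5):ℝ) = (C / l * (S + 1)) ^ e * p.s ζ ^ (-(1/5):ℝ) / e by rw [hK]; ring]
    refine div_le_div_of_nonneg_right ?_ he0.le
    refine (Real.rpow_le_rpow (by positivity) h2 he0.le).trans (le_of_eq ?_)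
    rw [Real.mul_rpow (by positivity) (by positivity), ← Real.rpow_mul hs.le]
    congr 2
    rw [he]; field_simp
  refine ⟨S + 8 * K, by positivity, fun ζ hs hG => ⟨(hs1 ζ hs hG).trans (by linarith), ?_, ?_⟩⟩
  · have h1 := key ζ hs hG
    have h2 : 0 ≤ Real.log (p.G ζ / l) := Real.log_nonneg (by rw [le_div_iff₀ hl]; linarith)
    have h3 : p.DD ζ / (8 * p.s ζ) ≤ K * p.s ζ ^ (-(1/5):ℝ) := by linarith
    rw [div_le_iff₀ (by positivity)] at h3
    have e1 : p.s ζ ^ (4/5:ℝ) = p.s ζ ^ (-(1/5):ℝ) * p.s ζ := by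
      nth_rw 3 [← Real.rpow_one (p.s ζ)]; rw [← Real.rpow_add hs]; norm_num
    calc p.DD ζ ≤ _ := h3
      _ = 8 * K * p.s ζ ^ (4/5:ℝ) := by rw [e1]; ring
      _ ≤ _ := by gcongr; linarith
  · have h1 := key ζ hs hG
    have h2 : 0 ≤ p.DD ζ / (8 * p.s ζ) := by have := p.DD_nonneg ζ; positivity
    calc _ ≤ K * p.s ζ ^ (-(1/5):ℝ) := by linarith
      _ ≤ _ := by gcongr; linarith
end KP
end

set_option linter.all false
noncomputable section
open Real MeasureTheory
variable {m : ℕ}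

lemma ypow {a s : ℝ} (ha : -1 < a) (hs : 0 < s) (k : ℕ) :
    ∫⁻ y : ℝ, ENNReal.ofReal (|y| ^ a * y ^ (2 * k) * Real.exp (-y ^ 2 / (4 * s))) =
      ENNReal.ofReal (Real.Gamma ((k:ℝ) + (1 + a) / 2) * (4 * s) ^ ((k:ℝ) + (1 + a) / 2)) := by
  have hq : -1 < a + 2 * k := by have : (0:ℝ) ≤ k := by positivity
                                 linarith
  have h1 := integral_rpow_mul_exp_neg_mul_rpow (p := 2) (q := a + 2 * k) (b := 1 / (4 * s)) (by norm_num) hq (by positivity)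
  have h2 := integral_comp_abs (f := fun x => x ^ (a + 2 * (k:ℝ)) * Real.exp (-(1 / (4 * s)) * x ^ (2:ℝ)))
  have e : (a + 2 * k + 1) / 2 = (k:ℝ) + (1 + a) / 2 := by ring
  have e' : -(a + 2 * k + 1) / 2 = -((k:ℝ) + (1 + a) / 2) := by ring
  rw [h1, e, e', one_div (4 * s), Real.inv_rpow (by positivity), Real.rpow_neg (by positivity), inv_inv] at h2
  have hG : 0 < Real.Gamma ((k:ℝ) + (1 + a) / 2) := Gam_pos (by linarith) k
  have e3 : (fun y : ℝ => |y| ^ a * y ^ (2 * k) * Real.exp (-y ^ 2 / (4 * s))) =ᵐ[volume] fun x => |x| ^ (a + 2 * (k:ℝ)) * Real.exp (-(4 * s)⁻¹ * |x| ^ (2:ℝ)) := by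
    have : ∀ᵐ y : ℝ, y ≠ 0 := by simp [ae_iff, measure_singleton]
    filter_upwards [this] with y hy
    rw [Real.rpow_add (abs_pos.2 hy), Real.rpow_two, sq_abs, show |y| ^ (2 * (k:ℝ)) = y ^ (2 * k) by
      rw [show (2 * (k:ℝ)) = ((2 * k : ℕ) : ℝ) by push_cast; ring, Real.rpow_natCast, pow_mul, sq_abs, ← pow_mul]]
    congr 2
    field_simp
  have hi : Integrable fun x : ℝ => |x| ^ (a + 2 * (k:ℝ)) * Real.exp (-(4 * s)⁻¹ * |x| ^ (2:ℝ)) := by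
    by_contra hn
    rw [integral_undef hn] at h2
    have : 0 < 2 * ((4 * s) ^ ((k:ℝ) + (1 + a) / 2) * (1 / 2) * Real.Gamma ((k:ℝ) + (1 + a) / 2)) := by positivity
    linarith
  rw [lintegral_congr_ae (e3.mono fun y hy => congrArg ENNReal.ofReal hy)]
  rw [← ofReal_integral_eq_lintegral_ofReal hi (ae_of_all _ fun x => by positivity), h2]
  congr 1; ring

lemma ymass {a s x0 : ℝ} (ha : -1 < a) (hs : 0 < s) :
    ∫⁻ y : ℝ, ENNReal.ofReal (|y| ^ a * Real.exp (-y ^ 2 / (4 * s)) * Pc ((1 + a) / 2) (x0 ^ 2 * y ^ 2 / (16 * s ^ 2))) =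
      ENNReal.ofReal ((4 * s) ^ ((1 + a) / 2) * Real.exp (x0 ^ 2 / (4 * s))) := by
  have hc : 0 < (1 + a) / 2 := by linarith
  have e1 : ∀ y : ℝ, ENNReal.ofReal (|y| ^ a * Real.exp (-y ^ 2 / (4 * s)) * Pc ((1 + a) / 2) (x0 ^ 2 * y ^ 2 / (16 * s ^ 2)))
      = ∑' k : ℕ, ENNReal.ofReal (pt ((1 + a) / 2) k * (x0 ^ 2 / (16 * s ^ 2)) ^ k) * ENNReal.ofReal (|y| ^ a * y ^ (2 * k) * Real.exp (-y ^ 2 / (4 * s))) := by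
    intro y
    have hsm := pt_summable hc (x0 ^ 2 * y ^ 2 / (16 * s ^ 2))
    unfold Pc
    rw [← tsum_mul_left, ENNReal.ofReal_tsum_of_nonneg (fun k => by have := (pt_pos hc k).le; positivity) (hsm.mul_left _)]
    refine tsum_congr fun k => ?_
    rw [← ENNReal.ofReal_mul (by have := (pt_pos hc k).le; positivity)]
    congr 1
    rw [pow_mul, mul_div_right_comm, mul_pow]; ring
  simp_rw [e1]
  have hmeas : ∀ k : ℕ, Measurable fun y : ℝ => ENNReal.ofReal (|y| ^ a * y ^ (2 * k) * Real.exp (-y ^ 2 / (4 * s))) := fun k => by fun_prop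
  rw [lintegral_tsum fun k => ((hmeas k).const_mul _).aemeasurable]
  simp_rw [lintegral_const_mul _ (hmeas _), ypow ha hs]
  have e2 : ∀ k : ℕ, ENNReal.ofReal (pt ((1 + a) / 2) k * (x0 ^ 2 / (16 * s ^ 2)) ^ k) * ENNReal.ofReal (Real.Gamma ((k:ℝ) + (1 + a) / 2) * (4 * s) ^ ((k:ℝ) + (1 + a) / 2))
      = ENNReal.ofReal ((4 * s) ^ ((1 + a) / 2) * ((x0 ^ 2 / (4 * s)) ^ k / (Nat.factorial k : ℝ))) := by
    intro k
    have hg := Gam_pos hc k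
    rw [← ENNReal.ofReal_mul (by have := (pt_pos hc k).le; positivity)]
    congr 1
    rw [Real.rpow_add (by positivity), Real.rpow_natCast]
    have : (x0 ^ 2 / (4 * s)) ^ k = (x0 ^ 2 / (16 * s ^ 2)) ^ k * (4 * s) ^ k := by rw [← mul_pow]; congr 1; field_simp; ring
    rw [this]
    unfold pt
    generalize Real.Gamma ((k:ℝ) + (1 + a) / 2) = g at *
    field_simp
  simp_rw [e2]
  rw [← ENNReal.ofReal_tsum_of_nonneg (fun k => by positivity) ((Real.summable_pow_div_factorial _).mul_left _), tsum_mul_left]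
  congr 2
  have := (NormedSpace.expSeries_div_hasSum_exp (𝔸 := ℝ) (x0 ^ 2 / (4 * s))).tsum_eq
  rw [← Real.exp_eq_exp_ℝ] at this
  exact this

lemma pmass {s : ℝ} (hs : 0 < s) (b : Fin m → ℝ) :
    ∫⁻ p : Fin m → ℝ, ENNReal.ofReal (Real.exp (-(∑ i, (b i - p i) ^ 2) / (4 * s))) = ENNReal.ofReal (√(4 * π * s) ^ m) := by
  have e : ∀ p : Fin m → ℝ, Real.exp (-(∑ i, (b i - p i) ^ 2) / (4 * s)) = ∏ i, Real.exp (-(1 / (4 * s)) * (p i - b i) ^ 2) := by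
    intro p
    rw [← Real.exp_sum]; congr 1
    rw [neg_div, Finset.sum_div, ← Finset.sum_neg_distrib]
    refine Finset.sum_congr rfl fun i _ => ?_
    field_simp; ring
  have hi : ∀ i, Integrable fun x : ℝ => Real.exp (-(1 / (4 * s)) * (x - b i) ^ 2) := fun i =>
    (integrable_exp_neg_mul_sq (b := 1 / (4 * s)) (by positivity)).comp_sub_right (b i)
  have hI : Integrable fun p : Fin m → ℝ => ∏ i, Real.exp (-(1 / (4 * s)) * (p i - b i) ^ 2) := by
    exact Integrable.fintype_prod (f := fun i x => Real.exp (-(1 / (4 * s)) * (x - b i) ^ 2)) hi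
  simp_rw [e]
  rw [← ofReal_integral_eq_lintegral_ofReal hI (ae_of_all _ fun x => by positivity),
    integral_fintype_prod_volume_eq_prod (f := fun i x => Real.exp (-(1 / (4 * s)) * (x - b i) ^ 2))]
  have : ∀ i, ∫ x : ℝ, Real.exp (-(1 / (4 * s)) * (x - b i) ^ 2) = √(4 * π * s) := by
    intro i
    rw [integral_sub_right_eq_self (fun x : ℝ => Real.exp (-(1 / (4 * s)) * x ^ 2)) (b i), integral_gaussian]
    congr 1; field_simp
  simp_rw [this]
  simp

/-- time cutoff derivative -/
lemma Th1_nonneg (s : ℝ) : 0 ≤ Th1 s := div_nonneg (bp_nonneg s) bc_pos.le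
lemma cutoff_int (t0 : ℝ) {k : ℝ} (hk : 0 < k) : ∫⁻ t : ℝ, ENNReal.ofReal (k * Th1 (k * (t0 - t))) = 1 := by
  have hT : HasCompactSupport Th1 := by
    refine HasCompactSupport.of_support_subset_isCompact (K := Set.Icc (1/2:ℝ) 1) isCompact_Icc fun x hx => ?_
    by_contra h
    rw [Set.mem_Icc, not_and_or] at h
    push Not at h
    rcases h with h | h
    · exact hx (Th1_lo h.le)
    · exact hx (Th1_hi h.le)
  have hi : Integrable Th1 := Th1_cont.integrable_of_hasCompactSupport hT
  have e0 : ∫ x, Th1 x = 1 := by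
    have h1 : ∫ x, Th1 x = ∫ x in (1/2:ℝ)..1, Th1 x := by
      rw [intervalIntegral.integral_of_le (by norm_num)]
      rw [← integral_indicator measurableSet_Ioc]
      congr 1; funext x
      by_cases h : x ∈ Set.Ioc (1/2:ℝ) 1
      · rw [Set.indicator_of_mem h]
      · rw [Set.indicator_of_notMem h]
        rw [Set.mem_Ioc, not_and_or] at h
        push Not at h
        rcases h with h | h
        · exact Th1_lo h
        · exact Th1_hi h.le
    rw [h1, intervalIntegral.integral_eq_sub_of_hasDerivAt (fun x _ => Th_der x) (Th1_cont.intervalIntegrable _ _), Th_one le_rfl, Th_zero le_rfl, sub_zero]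
  have i2 : Integrable fun x : ℝ => k * Th1 (k * x) := ((integrable_comp_mul_left_iff Th1 hk.ne').2 hi).const_mul k
  have e2 : ∫ x : ℝ, k * Th1 (k * x) = 1 := by
    rw [integral_const_mul, Measure.integral_comp_mul_left, e0, abs_of_pos (by positivity)]; simp [hk.ne']
  have i3 : Integrable fun t : ℝ => k * Th1 (k * (t0 - t)) := i2.comp_sub_left t0
  have e3 : ∫ t : ℝ, k * Th1 (k * (t0 - t)) = 1 := by
    rw [integral_sub_left_eq_self (fun x => k * Th1 (k * x)) volume t0, e2]
  rw [← ofReal_integral_eq_lintegral_ofReal i3 (ae_of_all _ fun x => by have := Th1_nonneg (k * (t0 - x)); positivity), e3]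
  simp

namespace KP
variable (p : KP m)
lemma F1_meas : Measurable p.F1 := by
  have h := (Pc_cont p.h1).measurable
  have h3 := (sv_cd (m := m) p.t0 (n := 0)).continuous.measurable
  have h4 := (Rv_cd p.x0 p.b (n := 0)).continuous.measurable
  unfold F1 Phi ph
  have h5 : Measurable fun ζ : FF m => Pc ((1 + p.a) / 2) (p.x0 ^ 2 * ζ.2 ^ 2 / (16 * sv p.t0 ζ ^ 2)) := h.comp (by fun_prop)
  fun_prop

def Mass : ℝ := 4 ^ ((1 + p.a) / 2) * √(4 * π) ^ m
lemma mass {k : ℝ} (hk : 0 < k) :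
    Integrable (fun ζ : FF m => |ζ.2| ^ p.a * (k * Th1 (k * p.s ζ)) * p.F1 ζ) ∧
    ∫ ζ : FF m, |ζ.2| ^ p.a * (k * Th1 (k * p.s ζ)) * p.F1 ζ ≤ p.Mass := by
  have hnn : ∀ ζ : FF m, 0 ≤ |ζ.2| ^ p.a * (k * Th1 (k * p.s ζ)) * p.F1 ζ := by
    intro ζ
    by_cases hs : 0 < p.s ζ
    · have := p.F1_nonneg hs
      have := Th1_nonneg (k * p.s ζ)
      positivity
    · rw [Th1_lo (by push Not at hs; nlinarith)]; simp
  have hm : Measurable (fun ζ : FF m => |ζ.2| ^ p.a * (k * Th1 (k * p.s ζ)) * p.F1 ζ) := by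
    have h1 := p.F1_meas
    have h2 : Measurable fun ζ : FF m => Th1 (k * p.s ζ) := (Th1_cont.comp (continuous_const.mul p.s_cont)).measurable
    fun_prop
  have hM : 0 ≤ p.Mass := by unfold Mass; positivity
  have key : ∫⁻ ζ : FF m, ENNReal.ofReal (|ζ.2| ^ p.a * (k * Th1 (k * p.s ζ)) * p.F1 ζ) ≤ ENNReal.ofReal p.Mass := by
    rw [Measure.volume_eq_prod, lintegral_prod _ hm.ennreal_ofReal.aemeasurable]
    have inner : ∀ q : (Fin m → ℝ) × ℝ, ∫⁻ y : ℝ, ENNReal.ofReal (|y| ^ p.a * (k * Th1 (k * p.s (q, y))) * p.F1 (q, y))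
        = ENNReal.ofReal (k * Th1 (k * (p.t0 - q.2)) * (4 ^ ((1 + p.a) / 2) * (p.t0 - q.2) ^ (-((m:ℝ)/2)))) * ENNReal.ofReal (Real.exp (-(∑ i, (p.b i - q.1 i) ^ 2) / (4 * (p.t0 - q.2)))) := by
      intro q
      have es : ∀ y : ℝ, p.s (q, y) = p.t0 - q.2 := fun y => rfl
      by_cases hs : 0 < p.t0 - q.2
      · have hT := Th1_nonneg (k * (p.t0 - q.2))
        have e : ∀ y : ℝ, ENNReal.ofReal (|y| ^ p.a * (k * Th1 (k * p.s (q, y))) * p.F1 (q, y)) =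
            ENNReal.ofReal (k * Th1 (k * (p.t0 - q.2)) * ((p.t0 - q.2) ^ (-((m:ℝ)/2 + (1 + p.a)/2)) * Real.exp (-(∑ i, (p.b i - q.1 i) ^ 2) / (4 * (p.t0 - q.2))) * Real.exp (-p.x0 ^ 2 / (4 * (p.t0 - q.2))))) *
            ENNReal.ofReal (|y| ^ p.a * Real.exp (-y ^ 2 / (4 * (p.t0 - q.2))) * Pc ((1 + p.a) / 2) (p.x0 ^ 2 * y ^ 2 / (16 * (p.t0 - q.2) ^ 2))) := by
          intro y
          rw [← ENNReal.ofReal_mul (by positivity), es]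
          congr 1
          have : p.F1 (q, y) = (p.t0 - q.2) ^ (-((m:ℝ)/2 + (1 + p.a)/2)) * (Real.exp (-(∑ i, (p.b i - q.1 i) ^ 2) / (4 * (p.t0 - q.2))) * Real.exp (-p.x0 ^ 2 / (4 * (p.t0 - q.2))) * Real.exp (-y ^ 2 / (4 * (p.t0 - q.2)))) * Pc ((1 + p.a) / 2) (p.x0 ^ 2 * y ^ 2 / (16 * (p.t0 - q.2) ^ 2)) := by
            rw [← Real.exp_add, ← Real.exp_add]
            unfold F1 Phi ph
            congr 3
            simp only [Rv, sv]
            ring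
          rw [this]; ring
        simp_rw [e]
        rw [lintegral_const_mul' _ _ ENNReal.ofReal_ne_top, ymass p.ha1 hs, ← ENNReal.ofReal_mul (by positivity), ← ENNReal.ofReal_mul (by positivity)]
        congr 1
        have e2 : Real.exp (-p.x0 ^ 2 / (4 * (p.t0 - q.2))) * Real.exp (p.x0 ^ 2 / (4 * (p.t0 - q.2))) = 1 := by
          rw [← Real.exp_add, neg_div]; simp
        have e3 : (p.t0 - q.2) ^ (-((m:ℝ)/2 + (1 + p.a)/2)) * (4 * (p.t0 - q.2)) ^ ((1 + p.a) / 2) = 4 ^ ((1 + p.a) / 2) * (p.t0 - q.2) ^ (-((m:ℝ)/2)) := by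
          rw [Real.mul_rpow (by norm_num) hs.le, mul_left_comm, ← Real.rpow_add hs]; congr 2; ring
        calc _ = k * Th1 (k * (p.t0 - q.2)) * ((p.t0 - q.2) ^ (-((m:ℝ)/2 + (1 + p.a)/2)) * (4 * (p.t0 - q.2)) ^ ((1 + p.a) / 2)) * Real.exp (-(∑ i, (p.b i - q.1 i) ^ 2) / (4 * (p.t0 - q.2))) * (Real.exp (-p.x0 ^ 2 / (4 * (p.t0 - q.2))) * Real.exp (p.x0 ^ 2 / (4 * (p.t0 - q.2)))) := by ring
          _ = _ := by rw [e2, e3]; ring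
      · simp only [es]
        rw [Th1_lo (by push Not at hs; nlinarith)]; simp
    simp_rw [inner]
    rw [Measure.volume_eq_prod, lintegral_prod_symm]
    · have inner2 : ∀ t : ℝ, ∫⁻ q : Fin m → ℝ, ENNReal.ofReal (k * Th1 (k * (p.t0 - t)) * (4 ^ ((1 + p.a) / 2) * (p.t0 - t) ^ (-((m:ℝ)/2)))) * ENNReal.ofReal (Real.exp (-(∑ i, (p.b i - q i) ^ 2) / (4 * (p.t0 - t))))
          = ENNReal.ofReal (k * Th1 (k * (p.t0 - t))) * ENNReal.ofReal p.Mass := by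
        intro t
        by_cases hs : 0 < p.t0 - t
        · have hT := Th1_nonneg (k * (p.t0 - t))
          rw [lintegral_const_mul' _ _ ENNReal.ofReal_ne_top, pmass hs, ← ENNReal.ofReal_mul (by positivity), ← ENNReal.ofReal_mul (by positivity)]
          congr 1
          have : (p.t0 - t) ^ (-((m:ℝ)/2)) * √(4 * π * (p.t0 - t)) ^ m = √(4 * π) ^ m := by
            rw [Real.sqrt_mul (by positivity), mul_pow, mul_left_comm]
            have : √(p.t0 - t) ^ m = (p.t0 - t) ^ ((m:ℝ)/2) := by
              rw [Real.sqrt_eq_rpow, ← Real.rpow_natCast, ← Real.rpow_mul hs.le]; congr 1; ring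
            rw [this, ← Real.rpow_add hs]; simp
          unfold Mass
          rw [← this]; ring
        · rw [Th1_lo (by push Not at hs; nlinarith)]; simp
      simp_rw [inner2]
      rw [lintegral_mul_const' _ _ ENNReal.ofReal_ne_top, cutoff_int p.t0 hk, one_mul]
    · have h2 : Measurable fun q : (Fin m → ℝ) × ℝ => Th1 (k * (p.t0 - q.2)) := (Th1_cont.comp (by fun_prop)).measurable
      refine Measurable.aemeasurable ?_
      fun_prop
  have hI : Integrable (fun ζ : FF m => |ζ.2| ^ p.a * (k * Th1 (k * p.s ζ)) * p.F1 ζ) := by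
    refine ⟨hm.aestronglyMeasurable, ?_⟩
    rw [hasFiniteIntegral_iff_ofReal (ae_of_all _ hnn)]
    exact key.trans_lt ENNReal.ofReal_lt_top
  refine ⟨hI, ?_⟩
  rw [integral_eq_lintegral_of_nonneg_ae (ae_of_all _ hnn) hm.aestronglyMeasurable]
  exact ENNReal.toReal_le_of_le_ofReal hM key
end KP
end

set_option linter.all false
noncomputable section
open Real MeasureTheory

/-- profile density -/
def pj (k x : ℝ) : ℝ := Th (k * (x - 1)) / x ^ 2
def pA (k x : ℝ) : ℝ := ∫ t in (1:ℝ)..x, pj k t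
def pH (k x : ℝ) : ℝ := ∫ t in (1:ℝ)..x, pA k t

lemma pj_zero {k x : ℝ} (hk : 0 < k) (h : x ≤ 1 + 1 / (2 * k)) : pj k x = 0 := by
  unfold pj
  rw [Th_zero, zero_div]
  calc k * (x - 1) ≤ k * (1 / (2 * k)) := by gcongr; linarith
    _ = 1 / 2 := by field_simp
lemma pj_cont {k : ℝ} (hk : 0 < k) : Continuous (pj k) := by
  rw [continuous_iff_continuousAt]
  intro x
  by_cases hx : x = 0
  · subst hx
    have : pj k =ᶠ[nhds 0] fun _ => 0 := by
      filter_upwards [Iio_mem_nhds (show (0:ℝ) < 1 by norm_num)] with y hy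
      exact pj_zero hk (by have : 0 < 1 / (2 * k) := by positivity
                           linarith [Set.mem_Iio.1 hy])
    exact (continuousAt_congr this).2 continuousAt_const
  · have h1 : Continuous Th := Th_cd.continuous
    unfold pj
    exact ContinuousAt.div (by fun_prop) (by fun_prop) (by positivity)
lemma pj_nonneg (k x : ℝ) : 0 ≤ pj k x := div_nonneg (Th_nonneg _) (sq_nonneg _)
lemma pj_le (k x : ℝ) : pj k x ≤ 1 / x ^ 2 := by
  unfold pj; gcongr; exact Th_le _
lemma pA_der {k : ℝ} (hk : 0 < k) (x : ℝ) : HasDerivAt (pA k) (pj k x) x :=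
  intervalIntegral.integral_hasDerivAt_right ((pj_cont hk).intervalIntegrable _ _) (pj_cont hk).aestronglyMeasurable.stronglyMeasurableAtFilter (pj_cont hk).continuousAt
lemma pA_cont {k : ℝ} (hk : 0 < k) : Continuous (pA k) := continuous_iff_continuousAt.2 fun x => (pA_der hk x).continuousAt
lemma pH_der {k : ℝ} (hk : 0 < k) (x : ℝ) : HasDerivAt (pH k) (pA k x) x :=
  intervalIntegral.integral_hasDerivAt_right ((pA_cont hk).intervalIntegrable _ _) (pA_cont hk).aestronglyMeasurable.stronglyMeasurableAtFilter (pA_cont hk).continuousAt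
lemma pA_mono {k : ℝ} (hk : 0 < k) : Monotone (pA k) :=
  monotone_of_deriv_nonneg (fun x => (pA_der hk x).differentiableAt) fun x => by rw [(pA_der hk x).deriv]; exact pj_nonneg k x
lemma pA_zero {k x : ℝ} (hk : 0 < k) (h : x ≤ 1 + 1 / (2 * k)) : pA k x = 0 := by
  unfold pA
  rw [intervalIntegral.integral_congr (g := fun _ => (0:ℝ)), intervalIntegral.integral_zero]
  intro t ht
  refine pj_zero hk (ht.2.trans ?_)
  have : 0 < 1 / (2 * k) := by positivity
  exact max_le (by linarith) h
lemma pA_nonneg {k : ℝ} (hk : 0 < k) (x : ℝ) : 0 ≤ pA k x := by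
  rcases le_total x 1 with h | h
  · rw [pA_zero hk]; have : 0 < 1 / (2 * k) := by positivity
    linarith
  · have h0 : pA k 1 = 0 := by simp [pA]
    rw [← h0]; exact pA_mono hk h
lemma pH_zero {k x : ℝ} (hk : 0 < k) (h : x ≤ 1 + 1 / (2 * k)) : pH k x = 0 := by
  unfold pH
  rw [intervalIntegral.integral_congr (g := fun _ => (0:ℝ)), intervalIntegral.integral_zero]
  intro t ht
  refine pA_zero hk (ht.2.trans ?_)
  have : 0 < 1 / (2 * k) := by positivity
  exact max_le (by linarith) h
lemma inv_int {x y : ℝ} (hx : 0 < x) (hxy : x ≤ y) : IntervalIntegrable (fun t : ℝ => 1 / t ^ 2) volume x y ∧ ∫ t in x..y, 1 / t ^ 2 = 1 / x - 1 / y := by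
  have hpos : ∀ t ∈ Set.uIcc x y, 0 < t := fun t ht => by rw [Set.uIcc_of_le hxy] at ht; linarith [ht.1]
  have hi : IntervalIntegrable (fun t : ℝ => 1 / t ^ 2) volume x y := by
    refine ContinuousOn.intervalIntegrable fun t ht => ?_
    have := hpos t ht
    exact (ContinuousAt.div (by fun_prop) (by fun_prop) (by positivity)).continuousWithinAt
  refine ⟨hi, ?_⟩
  rw [intervalIntegral.integral_eq_sub_of_hasDerivAt (f := fun t => -(1 / t)) (fun t ht => ?_) hi]
  · ring
  · have := hpos t ht
    refine ((hasDerivAt_inv this.ne').neg.congr_deriv (by field_simp)).congr_of_eventuallyEq ?_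
    filter_upwards with t; simp
lemma pA_sub {k : ℝ} (hk : 0 < k) (x y : ℝ) : pA k y - pA k x = ∫ t in x..y, pj k t :=
  (intervalIntegral.integral_eq_sub_of_hasDerivAt (fun t _ => pA_der hk t) ((pj_cont hk).intervalIntegrable _ _)).symm
lemma pA_sub_le {k x y : ℝ} (hk : 0 < k) (hx : 0 < x) (hxy : x ≤ y) : pA k y - pA k x ≤ 1 / x - 1 / y := by
  rw [pA_sub hk, ← (inv_int hx hxy).2]
  exact intervalIntegral.integral_mono_on hxy ((pj_cont hk).intervalIntegrable _ _) (inv_int hx hxy).1 fun t _ => pj_le k t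
lemma pA_sub_eq {k x y : ℝ} (hk : 0 < k) (hx : 1 + 1 / k ≤ x) (hxy : x ≤ y) : pA k y - pA k x = 1 / x - 1 / y := by
  have h0 : 0 < 1 / k := by positivity
  rw [pA_sub hk, ← (inv_int (by linarith) hxy).2]
  refine intervalIntegral.integral_congr fun t ht => ?_
  rw [Set.uIcc_of_le hxy] at ht
  change pj k t = _
  unfold pj
  rw [Th_one]
  have : 1 / k ≤ t - 1 := by linarith [ht.1]
  calc 1 = k * (1 / k) := by field_simp
    _ ≤ _ := by gcongr
lemma pA_le_one {k : ℝ} (hk : 0 < k) (x : ℝ) : pA k x ≤ 1 := by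
  rcases le_total x 1 with h | h
  · rw [pA_zero hk]
    · norm_num
    · have : 0 < 1 / (2 * k) := by positivity
      linarith
  · have := pA_sub_le hk one_pos h
    have h0 : pA k 1 = 0 := by simp [pA]
    have h3 : 0 ≤ 1 / x := by positivity
    rw [h0] at this
    rw [div_one] at this
    linarith
lemma pH_nonneg {k : ℝ} (hk : 0 < k) (x : ℝ) : 0 ≤ pH k x := by
  have hm : Monotone (pH k) := monotone_of_deriv_nonneg (fun x => (pH_der hk x).differentiableAt) fun x => by rw [(pH_der hk x).deriv]; exact pA_nonneg hk x
  rcases le_total x 1 with h | h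
  · rw [pH_zero hk]; have : 0 < 1 / (2 * k) := by positivity
    linarith
  · have h0 : pH k 1 = 0 := by simp [pH]
    rw [← h0]; exact hm h
lemma pH_le {k x : ℝ} (hk : 0 < k) (hx : 0 ≤ x) : pH k x ≤ x := by
  rcases le_total x 1 with h | h
  · rw [pH_zero hk]
    · exact hx
    · have : 0 < 1 / (2 * k) := by positivity
      linarith
  · have : Monotone fun x => x - pH k x := monotone_of_deriv_nonneg (fun x => differentiableAt_id.sub (pH_der hk x).differentiableAt) fun x => by
      have := ((hasDerivAt_id x).sub (pH_der hk x)).deriv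
      have h2 := pA_le_one hk x
      have e : deriv (fun x => x - pH k x) x = 1 - pA k x := this
      rw [e]; linarith
    have h1 := this h
    have h0 : pH k 1 = 0 := by simp [pH]
    simp only [h0] at h1
    linarith

/-- abstract profile: vanishing below `l'` -/
structure Prof (l' : ℝ) (g g1 g2 : ℝ → ℝ) : Prop where
  d1 : ∀ x, HasDerivAt g (g1 x) x
  d2 : ∀ x, HasDerivAt g1 (g2 x) x
  c2 : Continuous g2
  z : ∀ x, x ≤ l' → g x = 0
  nn : ∀ x, 0 ≤ g x
lemma Prof.cd {l' : ℝ} {g g1 g2 : ℝ → ℝ} (h : Prof l' g g1 g2) : ContDiff ℝ 2 g := by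
  have e1 : deriv g = g1 := funext fun x => (h.d1 x).deriv
  have e2 : deriv g1 = g2 := funext fun x => (h.d2 x).deriv
  rw [show (2 : WithTop ℕ∞) = 1 + 1 by norm_num, contDiff_succ_iff_deriv]
  refine ⟨fun x => (h.d1 x).differentiableAt, by simp, ?_⟩
  rw [e1, contDiff_one_iff_deriv, e2]
  exact ⟨fun x => (h.d2 x).differentiableAt, h.c2⟩

/-- one-level profile -/
lemma prof1 {k l : ℝ} (hk : 0 < k) (hl : 0 < l) :
    Prof (l * (1 + 1 / (2 * k))) (fun x => l * pH k (x / l)) (fun x => pA k (x / l)) (fun x => pj k (x / l) / l) where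
  d1 x := by
    have := ((pH_der hk (x / l)).comp x ((hasDerivAt_id x).div_const l)).const_mul l
    exact this.congr_deriv (by field_simp)
  d2 x := by
    have := (pA_der hk (x / l)).comp x ((hasDerivAt_id x).div_const l)
    exact this.congr_deriv (by field_simp)
  c2 := by have := pj_cont hk; fun_prop
  z x hx := by
    have : pH k (x / l) = 0 := pH_zero hk (by rw [div_le_iff₀ hl]; linarith)
    simp [this]
  nn x := mul_nonneg hl.le (pH_nonneg hk _)

def pG (k l1 l2 x : ℝ) : ℝ := l2 * pH k (x / l2) - l1 * pH k (x / l1)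
def pG1 (k l1 l2 x : ℝ) : ℝ := pA k (x / l2) - pA k (x / l1)
def pG2 (k l1 l2 x : ℝ) : ℝ := pj k (x / l2) / l2 - pj k (x / l1) / l1
lemma pG_der {k l1 l2 : ℝ} (hk : 0 < k) (h2 : 0 < l2) (h1 : 0 < l1) (x : ℝ) : HasDerivAt (pG k l1 l2) (pG1 k l1 l2 x) x :=
  ((prof1 hk h2).d1 x).sub ((prof1 hk h1).d1 x)
lemma pG1_nonneg {k l1 l2 : ℝ} (hk : 0 < k) (h2 : 0 < l2) (h12 : l2 < l1) (x : ℝ) : 0 ≤ pG1 k l1 l2 x := by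
  have h1 : 0 < l1 := h2.trans h12
  unfold pG1
  rcases le_total x 0 with h | h
  · have : 0 < 1 / (2 * k) := by positivity
    rw [pA_zero hk, pA_zero hk]
    · simp
    · have := div_nonpos_of_nonpos_of_nonneg h h1.le
      linarith
    · have := div_nonpos_of_nonpos_of_nonneg h h2.le
      linarith
  · have : x / l1 ≤ x / l2 := by gcongr
    linarith [pA_mono hk this]
lemma pG_mono {k l1 l2 : ℝ} (hk : 0 < k) (h2 : 0 < l2) (h12 : l2 < l1) : Monotone (pG k l1 l2) :=
  monotone_of_deriv_nonneg (fun x => (pG_der hk h2 (h2.trans h12) x).differentiableAt) fun x => by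
    rw [(pG_der hk h2 (h2.trans h12) x).deriv]; exact pG1_nonneg hk h2 h12 x
lemma pG_zero {k l1 l2 x : ℝ} (hk : 0 < k) (h2 : 0 < l2) (h12 : l2 < l1) (hx : x ≤ l2 * (1 + 1 / (2 * k))) : pG k l1 l2 x = 0 := by
  have h1 : 0 < l1 := h2.trans h12
  have e2 := (prof1 hk h2).z x hx
  have e1 := (prof1 hk h1).z x (hx.trans (by gcongr))
  change l2 * pH k (x / l2) = 0 at e2
  change l1 * pH k (x / l1) = 0 at e1
  unfold pG; rw [e1, e2, sub_zero]
lemma pG_nonneg {k l1 l2 : ℝ} (hk : 0 < k) (h2 : 0 < l2) (h12 : l2 < l1) (x : ℝ) : 0 ≤ pG k l1 l2 x := by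
  have h0 : pG k l1 l2 l2 = 0 := pG_zero hk h2 h12 (by have : 0 < 1 / (2 * k) := by positivity
                                                       nlinarith)
  rcases le_total x l2 with h | h
  · rw [pG_zero hk h2 h12 (h.trans (by have : 0 < 1 / (2 * k) := by positivity
                                       nlinarith))]
  · rw [← h0]; exact pG_mono hk h2 h12 h
/-- two-level profile -/
lemma prof2 {k l1 l2 : ℝ} (hk : 0 < k) (h2 : 0 < l2) (h12 : l2 < l1) :
    Prof (l2 * (1 + 1 / (2 * k))) (pG k l1 l2) (pG1 k l1 l2) (pG2 k l1 l2) where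
  d1 x := pG_der hk h2 (h2.trans h12) x
  d2 x := ((prof1 hk h2).d2 x).sub ((prof1 hk (h2.trans h12)).d2 x)
  c2 := (prof1 hk h2).c2.sub (prof1 hk (h2.trans h12)).c2
  z x hx := pG_zero hk h2 h12 hx
  nn x := pG_nonneg hk h2 h12 x
lemma log_der (c : ℝ) {l x : ℝ} (hl : 0 < l) (hx : 0 < x) : HasDerivAt (fun x => c * Real.log (x / l)) (c / x) x := by
  have := ((Real.hasDerivAt_log (x := x / l) (by positivity)).comp x ((hasDerivAt_id x).div_const l)).const_mul c
  exact this.congr_deriv (by field_simp)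
lemma pG_le {k l1 l2 x : ℝ} (hk : 0 < k) (h2 : 0 < l2) (h12 : l2 < l1) (hx : l2 ≤ x) : pG k l1 l2 x ≤ (l1 - l2) * Real.log (x / l2) := by
  have h1 : 0 < l1 := h2.trans h12
  have hd : ∀ x, 0 < x → HasDerivAt (fun x => (l1 - l2) * Real.log (x / l2) - pG k l1 l2 x) ((l1 - l2) / x - pG1 k l1 l2 x) x :=
    fun x hx => (log_der _ h2 hx).sub (pG_der hk h2 h1 x)
  have hm : MonotoneOn (fun x => (l1 - l2) * Real.log (x / l2) - pG k l1 l2 x) (Set.Ici l2) := by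
    refine monotoneOn_of_deriv_nonneg (convex_Ici l2) (fun x hx => ?_) (fun x hx => ?_) (fun x hx => ?_)
    · exact (hd x (h2.trans_le hx)).continuousAt.continuousWithinAt
    · rw [interior_Ici] at hx
      exact (hd x (h2.trans hx)).differentiableAt.differentiableWithinAt
    · rw [interior_Ici] at hx
      have hx0 : 0 < x := h2.trans hx
      rw [(hd x hx0).deriv]
      have := pA_sub_le hk (x := x / l1) (y := x / l2) (by positivity) (by gcongr)
      have e : 1 / (x / l1) - 1 / (x / l2) = (l1 - l2) / x := by field_simp
      unfold pG1
      linarith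
  have := hm (Set.mem_Ici.2 le_rfl) (Set.mem_Ici.2 hx) hx
  have h0 : pG k l1 l2 l2 = 0 := pG_zero hk h2 h12 (by have : 0 < 1 / (2 * k) := by positivity
                                                       nlinarith)
  simp only [h0, div_self h2.ne', Real.log_one] at this
  linarith
lemma pG_ge {k l1 l2 x : ℝ} (hk : 0 < k) (h2 : 0 < l2) (h12 : l2 < l1) (hx : l1 * (1 + 1 / k) ≤ x) : (l1 - l2) * Real.log (x / (l1 * (1 + 1 / k))) ≤ pG k l1 l2 x := by
  have h1 : 0 < l1 := h2.trans h12
  set l := l1 * (1 + 1 / k) with hl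
  have hl0 : 0 < l := by positivity
  have hd : ∀ x, 0 < x → HasDerivAt (fun x => pG k l1 l2 x - (l1 - l2) * Real.log (x / l)) (pG1 k l1 l2 x - (l1 - l2) / x) x :=
    fun x hx => (pG_der hk h2 h1 x).sub (log_der _ hl0 hx)
  have hm : MonotoneOn (fun x => pG k l1 l2 x - (l1 - l2) * Real.log (x / l)) (Set.Ici l) := by
    refine monotoneOn_of_deriv_nonneg (convex_Ici l) (fun x hx => ?_) (fun x hx => ?_) (fun x hx => ?_)
    · exact (hd x (hl0.trans_le hx)).continuousAt.continuousWithinAt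
    · rw [interior_Ici] at hx
      exact (hd x (hl0.trans hx)).differentiableAt.differentiableWithinAt
    · rw [interior_Ici] at hx
      have hx0 : 0 < x := hl0.trans hx
      rw [(hd x hx0).deriv]
      have := pA_sub_eq hk (x := x / l1) (y := x / l2) (by rw [le_div_iff₀ h1]; linarith [Set.mem_Ioi.1 hx]) (by gcongr)
      have e : 1 / (x / l1) - 1 / (x / l2) = (l1 - l2) / x := by field_simp
      unfold pG1
      linarith
  have := hm (Set.mem_Ici.2 le_rfl) (Set.mem_Ici.2 hx) hx
  have h0 := pG_nonneg hk h2 h12 l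
  simp only [div_self hl0.ne', Real.log_one] at this
  linarith
end

set_option linter.all false
noncomputable section
open Real MeasureTheory
variable {m : ℕ}

lemma dd_comp {E : Type*} [NormedAddCommGroup E] [NormedSpace ℝ E] {g : ℝ → ℝ} {g' : ℝ} {f : E → ℝ} {x : E} (d : E)
    (hg : HasDerivAt g g' (f x)) (hf : DifferentiableAt ℝ f x) : dd d (fun x => g (f x)) x = g' * dd d f x := by
  have := (hg.comp_hasFDerivAt x hf.hasFDerivAt).fderiv
  unfold dd
  change fderiv ℝ (g ∘ f) x d = _
  rw [this]; simp

lemma rpow_mul_int {b : ℝ} (hb : -1 < b) {c : FF m → ℝ} (hc : Continuous c) (hs : HasCompactSupport c) :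
    Integrable (fun ζ : FF m => |ζ.2| ^ b * c ζ) := by
  obtain ⟨M, hM⟩ := hc.bounded_above_of_compact_support hs
  obtain ⟨R, hR⟩ := (Metric.isBounded_iff_subset_closedBall (0 : FF m)).1 hs.isCompact.isBounded
  have hY : 0 < max R 1 := by positivity
  set Y := max R 1
  have i1 := (abs_rpow_int (a := -b) (by linarith) hY).1
  rw [neg_neg, intervalIntegrable_iff_integrableOn_Icc_of_le (by linarith)] at i1
  have i2 : Integrable (Set.indicator (Set.Icc (-Y) Y) fun y : ℝ => |y| ^ b) := (integrable_indicator_iff measurableSet_Icc).2 i1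
  have i3 : Integrable (Set.indicator (Metric.closedBall (0 : QQ m) Y) fun _ => M) :=
    (integrable_indicator_iff Metric.isClosed_closedBall.measurableSet).2 (integrableOn_const (isCompact_closedBall _ _).measure_lt_top.ne)
  have i4 := i3.mul_prod i2
  rw [← Measure.volume_eq_prod] at i4
  refine i4.mono' ?_ (Filter.Eventually.of_forall fun ζ => ?_)
  · have : Measurable fun ζ : FF m => |ζ.2| ^ b := by fun_prop
    exact (this.mul hc.measurable).aestronglyMeasurable
  · by_cases hz : c ζ = 0
    · rw [hz]; simp only [mul_zero, norm_zero]
      refine mul_nonneg (Set.indicator_nonneg (fun _ _ => (norm_nonneg _).trans (hM ζ)) _) (Set.indicator_nonneg (fun _ _ => by positivity) _)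
    · have h1 : ζ ∈ Metric.closedBall (0 : FF m) R := hR (subset_tsupport _ hz)
      rw [mem_closedBall_zero_iff, Prod.norm_def] at h1
      have h2 : ‖ζ.1‖ ≤ Y := (le_max_left _ _).trans (h1.trans (le_max_left _ _))
      have h3 : ‖ζ.2‖ ≤ Y := (le_max_right _ _).trans (h1.trans (le_max_left _ _))
      rw [Set.indicator_of_mem (by simpa using h2), Set.indicator_of_mem (by simpa [abs_le] using h3), norm_mul, Real.norm_of_nonneg (by positivity), mul_comm]
      gcongr
      exact hM ζ

namespace KP
variable (p : KP m)
lemma region_bdd {l : ℝ} (hl : 0 < l) : Bornology.IsBounded {ζ : FF m | 0 < p.s ζ ∧ l ≤ p.G ζ} := by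
  obtain ⟨C, hC, hb⟩ := p.bdd hl
  set B := √(C * C ^ (4/5:ℝ)) with hB
  have hB0 : 0 ≤ B := Real.sqrt_nonneg _
  set R := |p.t0| + C + B + |p.x0| + ∑ i, |p.b i| with hR
  have hsum : 0 ≤ ∑ i, |p.b i| := Finset.sum_nonneg fun i _ => abs_nonneg _
  have hR0 : 0 ≤ R := by positivity
  refine (Metric.isBounded_iff_subset_closedBall (0 : FF m)).2 ⟨R, ?_⟩
  rintro ζ ⟨hs, hG⟩
  obtain ⟨h1, h2, -⟩ := hb ζ hs hG
  have h3 : p.DD ζ ≤ C * C ^ (4/5:ℝ) := h2.trans (by gcongr)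
  rw [mem_closedBall_zero_iff, Prod.norm_def, Prod.norm_def]
  refine max_le (max_le ?_ ?_) ?_
  · rw [pi_norm_le_iff_of_nonneg hR0]
    intro i
    have h4 : (p.b i - ζ.1.1 i) ^ 2 ≤ p.DD ζ := by
      have := Finset.single_le_sum (f := fun i => (p.b i - ζ.1.1 i) ^ 2) (fun i _ => sq_nonneg _) (Finset.mem_univ i)
      unfold DD; nlinarith [sq_nonneg (|ζ.2| - |p.x0|)]
    have h5 : |p.b i - ζ.1.1 i| ≤ B := Real.abs_le_sqrt (h4.trans h3)
    have h6 : |p.b i| ≤ ∑ i, |p.b i| := Finset.single_le_sum (f := fun i => |p.b i|) (fun i _ => abs_nonneg _) (Finset.mem_univ i)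
    have h7 : |ζ.1.1 i| ≤ |p.b i| + |p.b i - ζ.1.1 i| := by
      have := abs_sub (p.b i) (p.b i - ζ.1.1 i); simpa using this
    rw [Real.norm_eq_abs]
    linarith [abs_nonneg p.t0, abs_nonneg p.x0]
  · have e : ζ.1.2 = p.t0 - p.s ζ := by unfold s sv; ring
    rw [Real.norm_eq_abs, e]
    have := abs_sub p.t0 (p.s ζ)
    rw [abs_of_pos hs] at this
    linarith [abs_nonneg p.x0]
  · have h4 : (|ζ.2| - |p.x0|) ^ 2 ≤ p.DD ζ := by
      unfold DD
      have : 0 ≤ ∑ i, (p.b i - ζ.1.1 i) ^ 2 := by positivity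
      linarith
    have h5 := Real.abs_le_sqrt (h4.trans h3)
    rw [Real.norm_eq_abs]
    have := le_abs_self (|ζ.2| - |p.x0|)
    linarith [abs_nonneg p.t0]

def reg (k l : ℝ) : Set (FF m) := {ζ | 1 / (2 * k) ≤ p.s ζ ∧ l ≤ p.G ζ}
lemma reg_compact {k l : ℝ} (hk : 0 < k) (hl : 0 < l) : IsCompact (p.reg k l) := by
  have h0 : 0 < 1 / (2 * k) := by positivity
  refine Metric.isCompact_of_isClosed_isBounded ?_ ((p.region_bdd hl).subset fun ζ h => ⟨h0.trans_le h.1, h.2⟩)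
  have hc : ContinuousOn p.G {ζ | 1 / (2 * k) ≤ p.s ζ} := fun ζ hζ => (p.G_ca (h0.trans_le hζ)).continuousWithinAt
  have := hc.preimage_isClosed_of_isClosed (isClosed_le continuous_const p.s_cont) (isClosed_Ici (a := l))
  exact this

lemma kle {k s : ℝ} (hk : 0 < k) (h : s ≤ 1 / (2 * k)) : k * s ≤ 1 / 2 := by
  calc k * s ≤ k * (1 / (2 * k)) := by gcongr
    _ = 1 / 2 := by field_simp
lemma lo_nhds {k : ℝ} {ζ : FF m} (h : p.s ζ < 1 / (2 * k)) : ∀ᶠ x in nhds ζ, p.s x < 1 / (2 * k) :=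
  p.s_cont.continuousAt.eventually (gt_mem_nhds h)
/-- cut-off continuity -/
lemma cutc {k : ℝ} (hk : 0 < k) {T : ℝ → ℝ} (hT : Continuous T) (hT0 : ∀ s, s ≤ 1 / 2 → T s = 0) {h : FF m → ℝ} (hh : ∀ ζ, 0 < p.s ζ → ContinuousAt h ζ) :
    Continuous fun ζ => T (k * p.s ζ) * h ζ := by
  rw [continuous_iff_continuousAt]
  intro ζ
  by_cases hs : 0 < p.s ζ
  · have := p.s_cont
    have h2 : Continuous fun ζ => T (k * p.s ζ) := by fun_prop
    exact h2.continuousAt.mul (hh ζ hs)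
  · have h0 : p.s ζ < 1 / (2 * k) := lt_of_le_of_lt (not_lt.1 hs) (by positivity)
    refine (continuousAt_congr (f := fun ζ => T (k * p.s ζ) * h ζ) (g := fun _ => 0) ?_).2 continuousAt_const
    filter_upwards [p.lo_nhds h0] with x hx
    rw [hT0 _ (kle hk hx.le), zero_mul]
lemma cut_hcs {k l : ℝ} (hk : 0 < k) (hl : 0 < l) {T : ℝ → ℝ} (hT0 : ∀ s, s ≤ 1 / 2 → T s = 0) {h : FF m → ℝ} (hh : ∀ ζ, p.G ζ ≤ l → h ζ = 0) :
    HasCompactSupport fun ζ => T (k * p.s ζ) * h ζ := by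
  refine HasCompactSupport.intro (p.reg_compact hk hl) fun ζ hz => ?_
  by_cases h1 : 1 / (2 * k) ≤ p.s ζ
  · rw [hh, mul_zero]
    by_contra h2
    exact hz ⟨h1, (not_le.1 h2).le⟩
  · rw [hT0 _ (kle hk (not_le.1 h1).le), zero_mul]

/-- spatial gradient squared -/
def gr (ζ : FF m) : ℝ := (∑ i, dd (dI i) p.G ζ ^ 2) + dd dY p.G ζ ^ 2
def U (l : ℝ) : Set (FF m) := {ζ | 0 < p.s ζ ∧ l < p.G ζ}
lemma U_open (l : ℝ) : IsOpen (p.U l) := by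
  rw [isOpen_iff_mem_nhds]
  rintro ζ ⟨h1, h2⟩
  filter_upwards [sv_nhds h1, (p.G_ca h1).eventually (lt_mem_nhds h2)] with x hx hx'
  exact ⟨hx, hx'⟩
def ps (k : ℝ) (g : ℝ → ℝ) (ζ : FF m) : ℝ := Th (k * p.s ζ) * g (p.G ζ)
end KP
lemma Prof.z1 {l' : ℝ} {g g1 g2 : ℝ → ℝ} (h : Prof l' g g1 g2) {x : ℝ} (hx : x ≤ l') : g1 x = 0 := by
  have hc : Continuous g1 := continuous_iff_continuousAt.2 fun x => (h.d2 x).continuousAt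
  have : ∀ y ∈ Set.Iio l', g1 y = 0 := fun y hy => by
    have e : g =ᶠ[nhds y] fun _ => 0 := by
      filter_upwards [Iio_mem_nhds hy] with z hz
      exact h.z z hz.le
    rw [← (h.d1 y).deriv, e.deriv_eq]; simp
  have h2 : closure (Set.Iio l') ⊆ {y | g1 y = 0} := closure_minimal this (isClosed_eq hc continuous_const)
  rw [closure_Iio] at h2
  exact h2 hx
lemma Prof.z2 {l' : ℝ} {g g1 g2 : ℝ → ℝ} (h : Prof l' g g1 g2) {x : ℝ} (hx : x ≤ l') : g2 x = 0 := by
  have : ∀ y ∈ Set.Iio l', g2 y = 0 := fun y hy => by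
    have e : g1 =ᶠ[nhds y] fun _ => 0 := by
      filter_upwards [Iio_mem_nhds hy] with z hz
      exact h.z1 hz.le
    rw [← (h.d2 y).deriv, e.deriv_eq]; simp
  have h2 : closure (Set.Iio l') ⊆ {y | g2 y = 0} := closure_minimal this (isClosed_eq h.c2 continuous_const)
  rw [closure_Iio] at h2
  exact h2 hx
namespace KP
variable (p : KP m)
variable {k l' : ℝ} {g g1 g2 : ℝ → ℝ}
lemma ps_lo (hk : 0 < k) {ζ : FF m} (h : ¬ 0 < p.s ζ) : p.ps k g =ᶠ[nhds ζ] fun _ => 0 := by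
  have h0 : p.s ζ < 1 / (2 * k) := lt_of_le_of_lt (not_lt.1 h) (by positivity)
  filter_upwards [p.lo_nhds h0] with x hx
  rw [ps, Th_zero (kle hk hx.le), zero_mul]
lemma chi_cd (ζ : FF m) : ContDiffAt ℝ 2 (fun ζ => Th (k * p.s ζ)) ζ :=
  (Th_cd.comp (contDiff_const.mul (sv_cd p.t0 (n := 2)))).contDiffAt
lemma s_dd (d ζ : FF m) : dd d p.s ζ = -d.1.2 := by
  have : HasFDerivAt p.s (-((ContinuousLinearMap.snd ℝ (Fin m → ℝ) ℝ).comp (ContinuousLinearMap.fst ℝ (QQ m) ℝ))) ζ := by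
    have h2 := ((ContinuousLinearMap.snd ℝ (Fin m → ℝ) ℝ).comp (ContinuousLinearMap.fst ℝ (QQ m) ℝ)).hasFDerivAt (x := ζ)
    exact h2.const_sub p.t0
  unfold dd; rw [this.fderiv]; simp
lemma chi_dd (d ζ : FF m) : dd d (fun ζ => Th (k * p.s ζ)) ζ = -(k * Th1 (k * p.s ζ)) * d.1.2 := by
  have hs : DifferentiableAt ℝ p.s ζ := cdAt_da (sv_cd p.t0 (n := 2)).contDiffAt
  rw [dd_comp d (f := fun ζ => k * p.s ζ) (Th_der _) (hs.const_mul k), dd_const_mul d k hs, s_dd]; ring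
lemma ps_dd (hg : Prof l' g g1 g2) {ζ : FF m} (hs : 0 < p.s ζ) (hy : ζ.2 ≠ 0) (d : FF m) :
    dd d (p.ps k g) ζ = Th (k * p.s ζ) * (g1 (p.G ζ) * dd d p.G ζ) - k * Th1 (k * p.s ζ) * d.1.2 * g (p.G ζ) := by
  have a1 := cdAt_da (p.chi_cd (k := k) ζ)
  have a2 := cdAt_da (p.G_cd hs hy)
  have a3 : DifferentiableAt ℝ (fun ζ => g (p.G ζ)) ζ := (hg.d1 _).differentiableAt.comp ζ a2
  change dd d (fun ζ => Th (k * p.s ζ) * g (p.G ζ)) ζ = _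
  rw [dd_mul d a1 a3, dd_comp d (hg.d1 _) a2, chi_dd]; ring
lemma ps_ddd (hg : Prof l' g g1 g2) {ζ : FF m} (hs : 0 < p.s ζ) (hy : ζ.2 ≠ 0) (d : FF m) (hd : d.1.2 = 0) :
    dd d (dd d (p.ps k g)) ζ = Th (k * p.s ζ) * (g2 (p.G ζ) * dd d p.G ζ ^ 2 + g1 (p.G ζ) * dd d (dd d p.G) ζ) := by
  have ev : dd d (p.ps k g) =ᶠ[nhds ζ] fun ζ => Th (k * p.s ζ) * (g1 (p.G ζ) * dd d p.G ζ) := by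
    filter_upwards [sv_nhds hs, ne_nhds hy] with x hx hx'
    rw [p.ps_dd hg hx hx', hd]; ring
  have a1 := cdAt_da (p.chi_cd (k := k) ζ)
  have a2 := cdAt_da (p.G_cd hs hy)
  have a4 := cdAt_dda (p.G_cd hs hy) d
  have a3 : DifferentiableAt ℝ (fun ζ => g1 (p.G ζ)) ζ := (hg.d2 _).differentiableAt.comp ζ a2
  rw [dd_congr d ev, dd_mul d a1 (a3.fun_mul a4), dd_mul d a3 a4, dd_comp d (hg.d2 _) a2, chi_dd, hd]; ring
lemma ps_Lst (hk : 0 < k) (hg : Prof l' g g1 g2) {ζ : FF m} (hy : ζ.2 ≠ 0) :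
    Lst p.a (p.ps k g) ζ = Th (k * p.s ζ) * g2 (p.G ζ) * (|ζ.2| ^ p.a * p.gr ζ) - |ζ.2| ^ p.a * (k * Th1 (k * p.s ζ)) * g (p.G ζ) := by
  by_cases hs : 0 < p.s ζ
  · have h := p.G_pde hs hy
    unfold Lst gr
    rw [p.ps_dd hg hs hy, p.ps_dd hg hs hy, p.ps_ddd hg hs hy _ rfl, Finset.sum_congr rfl fun i _ => p.ps_ddd hg hs hy (dI i) rfl]
    simp only [mul_add, Finset.sum_add_distrib, ← Finset.mul_sum, show (dT : FF m).1.2 = 1 from rfl, show (dY : FF m).1.2 = 0 from rfl]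
    linear_combination |ζ.2| ^ p.a * Th (k * p.s ζ) * g1 (p.G ζ) * h
  · have h1 := p.ps_lo (g := g) hk hs
    have h2 : ζ ∉ tsupport (p.ps k g) := notMem_tsupport_iff_eventuallyEq.2 h1
    have h3 : p.s ζ ≤ 1 / (2 * k) := (not_lt.1 hs).trans (by positivity)
    rw [Lst_zero_off h2, Th_zero (kle hk h3), Th1_lo (kle hk h3)]; ring
lemma gr_eq {ζ : FF m} (hs : 0 < p.s ζ) (hy : ζ.2 ≠ 0) :
    |ζ.2| ^ p.a * p.gr ζ = |ζ.2| ^ p.a * ((∑ i, ((p.b i - ζ.1.1 i) / (2 * p.s ζ)) ^ 2) * p.G ζ ^ 2) + |ζ.2| ^ (-p.a) * p.W ζ ^ 2 := by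
  unfold gr
  rw [← p.G_W hs hy, Finset.sum_mul]
  simp only [p.G_dI hs hy, mul_pow]
  have e3 := abs_rpow_mul_neg p.a hy
  linear_combination (-|ζ.2| ^ p.a * dd dY p.G ζ ^ 2) * e3
lemma ps_int (hk : 0 < k) (hl : 0 < l') (hg : Prof l' g g1 g2) :
    Integrable (fun ζ : FF m => Th (k * p.s ζ) * g2 (p.G ζ) * (|ζ.2| ^ p.a * p.gr ζ)) ∧
    Integrable (fun ζ : FF m => |ζ.2| ^ p.a * (k * Th1 (k * p.s ζ)) * g (p.G ζ)) := by
  have hgc : Continuous g := hg.cd.continuous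
  constructor
  · have i1 := rpow_mul_int (b := p.a) p.ha1 (p.cutc hk (T := Th) Th_cd.continuous (fun s h => Th_zero h)
      (h := fun ζ => g2 (p.G ζ) * ((∑ i, ((p.b i - ζ.1.1 i) / (2 * p.s ζ)) ^ 2) * p.G ζ ^ 2)) (fun ζ hs => by
        have h1 := p.G_ca hs
        have h2 := p.s_cont
        have h3 : ContinuousAt (fun ζ => g2 (p.G ζ)) ζ := hg.c2.continuousAt.comp h1
        refine h3.mul (ContinuousAt.mul (tendsto_finset_sum _ fun i _ => ?_) (h1.pow 2))
        refine ContinuousAt.pow (ContinuousAt.div (by fun_prop) (by fun_prop) (by positivity)) 2))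
      (p.cut_hcs hk hl (fun s h => Th_zero h) fun ζ h => by rw [hg.z2 h, zero_mul])
    have i2 := rpow_mul_int (b := -p.a) (by have := p.ha2; linarith) (p.cutc hk (T := Th) Th_cd.continuous (fun s h => Th_zero h)
      (h := fun ζ => g2 (p.G ζ) * p.W ζ ^ 2) (fun ζ hs => by
        have h1 := p.G_ca hs
        have h3 : ContinuousAt (fun ζ => g2 (p.G ζ)) ζ := hg.c2.continuousAt.comp h1
        exact h3.mul ((p.W_ca hs).pow 2)))
      (p.cut_hcs hk hl (fun s h => Th_zero h) fun ζ h => by rw [hg.z2 h, zero_mul])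
    refine (i1.add i2).congr ?_
    filter_upwards [ae_off_plane] with ζ hy
    simp only [Pi.add_apply]
    by_cases hs : 0 < p.s ζ
    · rw [p.gr_eq hs hy]; ring
    · have h3 : p.s ζ ≤ 1 / (2 * k) := (not_lt.1 hs).trans (by positivity)
      rw [Th_zero (kle hk h3)]; ring
  · have i1 := rpow_mul_int (b := p.a) p.ha1 (p.cutc hk (T := fun s => k * Th1 s) (by have := Th1_cont; fun_prop) (fun s h => by simp [Th1_lo h])
      (h := fun ζ => g (p.G ζ)) (fun ζ hs => ContinuousAt.comp (g := g) (f := p.G) hgc.continuousAt (p.G_ca hs)))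
      (p.cut_hcs hk hl (T := fun s => k * Th1 s) (h := fun ζ => g (p.G ζ)) (fun s h => by simp [Th1_lo h]) fun ζ h => hg.z _ h)
    refine i1.congr (Filter.Eventually.of_forall fun ζ => ?_)
    simp only; ring
lemma ps_test {l : ℝ} (hk : 0 < k) (hl : 0 < l) (hll : l < l') (hg : Prof l' g g1 g2) :
    TestFn p.a (p.U l) (p.ps k g) (fun ζ => Th (k * p.s ζ) * (g1 (p.G ζ) * p.W ζ)) where
  cont := p.cutc hk Th_cd.continuous (fun s h => Th_zero h) (h := fun ζ => g (p.G ζ)) fun ζ hs => hg.cd.continuous.continuousAt.comp (p.G_ca hs)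
  hcs := p.cut_hcs hk (hl.trans hll) (fun s h => Th_zero h) fun ζ h => hg.z _ h
  nn ζ := mul_nonneg (Th_nonneg _) (hg.nn _)
  sub := by
    have : tsupport (p.ps k g) ⊆ p.reg k l' := by
      refine closure_minimal (fun ζ hz => ?_) (p.reg_compact hk (hl.trans hll)).isClosed
      by_contra hn
      refine hz ?_
      by_cases h1 : 1 / (2 * k) ≤ p.s ζ
      · rw [ps, hg.z, mul_zero]
        by_contra h2
        exact hn ⟨h1, (not_le.1 h2).le⟩
      · rw [ps, Th_zero (kle hk (not_le.1 h1).le), zero_mul]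
    exact this.trans fun ζ h => ⟨lt_of_lt_of_le (by positivity) h.1, hll.trans_le h.2⟩
  cd ζ hy := by
    by_cases hs : 0 < p.s ζ
    · exact (p.chi_cd ζ).mul (hg.cd.contDiffAt.comp ζ (p.G_cd hs hy))
    · exact contDiffAt_const.congr_of_eventuallyEq (p.ps_lo hk hs)
  Wc := p.cutc hk Th_cd.continuous (fun s h => Th_zero h) (h := fun ζ => g1 (p.G ζ) * p.W ζ) fun ζ hs =>
    ContinuousAt.mul ((hg.d2 _).continuousAt.comp (f := p.G) (g := g1) (p.G_ca hs)) (p.W_ca hs)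
  Weq ζ hy := by
    by_cases hs : 0 < p.s ζ
    · rw [p.ps_dd hg hs hy, ← p.G_W hs hy]; simp only [show (dY : FF m).1.2 = 0 from rfl]; ring
    · have h3 : p.s ζ ≤ 1 / (2 * k) := (not_lt.1 hs).trans (by positivity)
      rw [dd_congr dY (p.ps_lo hk hs), Th_zero (kle hk h3)]; simp [dd]
  eta := by
    rw [contDiff_iff_contDiffAt]
    intro q
    have hq : ContDiff ℝ 2 (fun q : QQ m => ((q, 0) : FF m)) := by fun_prop
    by_cases hs : 0 < p.s (q, 0)
    · have h1 : ContDiffAt ℝ 2 (fun q : QQ m => Th (k * p.s (q, 0))) q := ContDiffAt.comp q (g := fun ζ => Th (k * p.s ζ)) (p.chi_cd (q, 0)) hq.contDiffAt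
      have h2 : ContDiffAt ℝ 2 (fun q : QQ m => p.c0 * p.F1 (q, 0)) q := contDiffAt_const.mul ((p.F1_cd hs).comp q hq.contDiffAt)
      have := h1.mul (hg.cd.contDiffAt.comp q h2)
      refine this.congr_of_eventuallyEq (Filter.Eventually.of_forall fun q => ?_)
      simp only [ps, G_plane]; rfl
    · exact contDiffAt_const.congr_of_eventuallyEq (hq.continuous.continuousAt.eventually (p.ps_lo hk hs))
  int := by
    obtain ⟨i1, i2⟩ := p.ps_int hk (hl.trans hll) hg
    refine (i1.sub i2).congr ?_
    filter_upwards [ae_off_plane] with ζ hy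
    rw [p.ps_Lst hk hg hy]; rfl
end KP
end

set_option linter.all false
noncomputable section
open Real MeasureTheory
variable {m : ℕ}

lemma Lop_negone (a : ℝ) (ζ : FF m) : Lop a (fun _ => (-1:ℝ)) ζ = 0 := by
  have h : ∀ d : FF m, dd d (fun _ : FF m => (-1:ℝ)) = fun _ => 0 := fun d => by funext x; simp [dd]
  have h' : ∀ d : FF m, dd d (fun _ : FF m => (0:ℝ)) = fun _ => 0 := fun d => by funext x; simp [dd]
  simp [Lop, h, h']
lemma negone_sub (a : ℝ) (U : Set (FF m)) : SubSol a U (fun _ => (-1:ℝ)) where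
  cont := continuous_const
  cd ζ _ := contDiffAt_const
  sym q := by
    intro ε hε
    filter_upwards [self_mem_nhdsWithin] with y hy
    have : 0 ≤ ε * y ^ (1 - a) := mul_nonneg hε.le (Real.rpow_nonneg (le_of_lt hy) _)
    norm_num; exact this
  le ζ _ _ := (Lop_negone a ζ).le
lemma pj_eq (k l x : ℝ) (hl : 0 < l) : pj k (x / l) / l = l * Th (k * (x / l - 1)) / x ^ 2 := by
  unfold pj
  by_cases hx : x = 0
  · subst hx; simp
  · field_simp
lemma Th_ev {f : ℕ → ℝ} (hf : Filter.Tendsto f Filter.atTop Filter.atTop) {s : ℝ} (hs : 0 < s) :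
    ∀ᶠ n in Filter.atTop, Th (f n * s) = 1 := by
  filter_upwards [hf.eventually_ge_atTop (1 / s)] with n hn
  refine Th_one ?_
  calc 1 = 1 / s * s := by field_simp
    _ ≤ _ := by gcongr
lemma kk_tendsto (N : ℝ) : Filter.Tendsto (fun n : ℕ => (n:ℝ) + N) Filter.atTop Filter.atTop :=
  Filter.tendsto_atTop_add_const_right _ _ tendsto_natCast_atTop_atTop
namespace KP
variable (p : KP m)
def K (ζ : FF m) : ℝ := |ζ.2| ^ p.a * p.gr ζ / p.G ζ ^ 2
lemma gr_nonneg (ζ : FF m) : 0 ≤ p.gr ζ := by unfold gr; positivity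
lemma K_nonneg (ζ : FF m) : 0 ≤ p.K ζ := by have := p.gr_nonneg ζ; unfold K; positivity
/-- cut-off level sets converge -/
lemma cut_tendsto {f : ℕ → ℝ} (hf : Filter.Tendsto f Filter.atTop Filter.atTop) (hf0 : ∀ n, 0 < f n) {l : ℝ} (hl : 0 < l) (ζ : FF m) (c : ℝ) :
    Filter.Tendsto (fun n => Th (f n * p.s ζ) * (Th (f n * (p.G ζ / l - 1)) * c)) Filter.atTop (nhds ((p.U l).indicator (fun _ => c) ζ)) := by
  by_cases h : ζ ∈ p.U l
  · rw [Set.indicator_of_mem h]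
    refine tendsto_const_nhds.congr' ?_
    have h2 : 0 < p.G ζ / l - 1 := by rw [sub_pos, lt_div_iff₀ hl]; linarith [h.2]
    filter_upwards [Th_ev hf h.1, Th_ev hf h2] with n h1 h2
    rw [h1, h2]; ring
  · rw [Set.indicator_of_notMem h]
    refine tendsto_const_nhds.congr fun n => ?_
    by_cases hs : 0 < p.s ζ
    · have hG : p.G ζ ≤ l := by by_contra hh; exact h ⟨hs, not_le.1 hh⟩
      have h2 : p.G ζ / l - 1 ≤ 0 := by rw [sub_nonpos, div_le_iff₀ hl]; linarith
      rw [Th_zero (s := f n * (p.G ζ / l - 1)) ((mul_nonpos_of_nonneg_of_nonpos (hf0 n).le h2).trans (by norm_num))]; ring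
    · rw [Th_zero (s := f n * p.s ζ) ((mul_nonpos_of_nonneg_of_nonpos (hf0 n).le (not_lt.1 hs)).trans (by norm_num))]; ring
lemma K_step {k l : ℝ} (hk : 0 < k) (hl : 0 < l) :
    Integrable (fun ζ : FF m => Th (k * p.s ζ) * (Th (k * (p.G ζ / l - 1)) * (l * p.K ζ))) ∧
    ∫ ζ : FF m, Th (k * p.s ζ) * (Th (k * (p.G ζ / l - 1)) * (l * p.K ζ)) ≤ p.CG * p.Mass := by
  have hP := prof1 hk hl
  have hl' : l < l * (1 + 1 / (2 * k)) := by
    have : 0 < l * (1 / (2 * k)) := by positivity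
    linarith
  obtain ⟨i1, i2⟩ := p.ps_int hk (hl.trans hl') hP
  have ht := p.ps_test hk hl hl' hP
  obtain ⟨-, hw⟩ := weak_ineq p.ha1 p.ha2 (p.U_open l) ht (negone_sub p.a _)
  have e0 : ∀ ζ : FF m, Lop p.a (fun _ => (-1:ℝ)) ζ = 0 := fun ζ => Lop_negone _ ζ
  have e1 : (fun ζ : FF m => Th (k * p.s ζ) * (Th (k * (p.G ζ / l - 1)) * (l * p.K ζ))) = fun ζ : FF m => Th (k * p.s ζ) * (pj k (p.G ζ / l) / l) * (|ζ.2| ^ p.a * p.gr ζ) := by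
    funext ζ
    rw [pj_eq k l _ hl]; unfold K; ring
  rw [e1]
  refine ⟨i1, ?_⟩
  have e2 : ∫ ζ : FF m, (-1) * Lst p.a (p.ps k fun x => l * pH k (x / l)) ζ = (∫ ζ : FF m, |ζ.2| ^ p.a * (k * Th1 (k * p.s ζ)) * (l * pH k (p.G ζ / l))) - ∫ ζ : FF m, Th (k * p.s ζ) * (pj k (p.G ζ / l) / l) * (|ζ.2| ^ p.a * p.gr ζ) := by
    rw [← integral_sub i2 i1]
    refine integral_congr_ae ?_
    filter_upwards [ae_off_plane] with ζ hy
    rw [p.ps_Lst hk hP hy]; ring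
  simp only [e0, neg_zero, mul_zero, integral_zero] at hw
  rw [e2] at hw
  obtain ⟨m1, m2⟩ := p.mass hk
  have h3 : (∫ ζ : FF m, |ζ.2| ^ p.a * (k * Th1 (k * p.s ζ)) * (l * pH k (p.G ζ / l))) ≤ ∫ ζ : FF m, p.CG * (|ζ.2| ^ p.a * (k * Th1 (k * p.s ζ)) * p.F1 ζ) := by
    refine integral_mono i2 (m1.const_mul _) fun ζ => ?_
    have hT := Th1_nonneg (k * p.s ζ)
    by_cases hs : 0 < p.s ζ
    · have h4 := p.G_le hs
      have h5 : l * pH k (p.G ζ / l) ≤ p.CG * p.F1 ζ := by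
        rcases le_total 0 (p.G ζ) with h | h
        · have := pH_le hk (x := p.G ζ / l) (by positivity)
          have e : l * (p.G ζ / l) = p.G ζ := by field_simp
          have h6 := mul_le_mul_of_nonneg_left this hl.le
          linarith [le_abs_self (p.G ζ)]
        · have e : l * pH k (p.G ζ / l) = 0 := hP.z _ (by linarith)
          rw [e]; linarith [abs_nonneg (p.G ζ)]
      calc _ ≤ |ζ.2| ^ p.a * (k * Th1 (k * p.s ζ)) * (p.CG * p.F1 ζ) := by gcongr
        _ = _ := by ring
    · have h3 : p.s ζ ≤ 1 / (2 * k) := (not_lt.1 hs).trans (by positivity)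
      simp [Th1_lo (kle hk h3)]
  rw [integral_const_mul] at h3
  have h6 := mul_le_mul_of_nonneg_left m2 p.CG_pos.le
  linarith
lemma K_int {l : ℝ} (hl : 0 < l) : IntegrableOn p.K (p.U l) := by
  have hf := kk_tendsto 1
  have hf0 : ∀ n : ℕ, (0:ℝ) < n + 1 := fun n => by positivity
  obtain ⟨h, -⟩ := fatou_int (f := fun n ζ => Th (((n:ℝ) + 1) * p.s ζ) * (Th (((n:ℝ) + 1) * (p.G ζ / l - 1)) * (l * p.K ζ)))
    (F := (p.U l).indicator fun ζ => l * p.K ζ) (c := fun _ => p.CG * p.Mass) (fun n => (p.K_step (hf0 n) hl).1)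
    (fun n => Filter.Eventually.of_forall fun ζ => mul_nonneg (Th_nonneg _) (mul_nonneg (Th_nonneg _) (mul_nonneg hl.le (p.K_nonneg ζ))))
    (Filter.Eventually.of_forall fun ζ => p.cut_tendsto hf hf0 hl ζ (l * p.K ζ)) (fun n => (p.K_step (hf0 n) hl).2) tendsto_const_nhds
  rw [integrable_indicator_iff (p.U_open l).measurableSet] at h
  have := h.const_mul l⁻¹
  refine this.congr (Filter.Eventually.of_forall fun ζ => ?_)
  simp only; field_simp
end KP
end

set_option linter.all false
noncomputable section
open Real MeasureTheory
variable {m : ℕ}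

lemma cutoff_int' (t0 : ℝ) {k : ℝ} (hk : 0 < k) : Integrable (fun t : ℝ => k * Th1 (k * (t0 - t))) ∧ ∫ t : ℝ, k * Th1 (k * (t0 - t)) = 1 := by
  have h := cutoff_int t0 hk
  have hc : Continuous fun t : ℝ => k * Th1 (k * (t0 - t)) := by have := Th1_cont; fun_prop
  have hn : ∀ t : ℝ, 0 ≤ k * Th1 (k * (t0 - t)) := fun t => mul_nonneg hk.le (Th1_nonneg _)
  constructor
  · rw [← lintegral_ofReal_ne_top_iff_integrable hc.aestronglyMeasurable (Filter.Eventually.of_forall hn), h]; simp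
  · rw [integral_eq_lintegral_of_nonneg_ae (Filter.Eventually.of_forall hn) hc.aestronglyMeasurable, h]; simp

namespace KP
variable (p : KP m)
lemma bdry_bound (hm : 1 ≤ m) {l1 l2 : ℝ} (h2 : 0 < l2) (h12 : l2 < l1) {u : FF m → ℝ} (hu : Continuous u) :
    ∃ B : ℝ, ∀ k : ℝ, 1 ≤ k → ‖∫ ζ : FF m, u ζ * (|ζ.2| ^ p.a * (k * Th1 (k * p.s ζ)) * pG k l1 l2 (p.G ζ))‖ ≤ B * k ^ (-(1/5):ℝ) := by
  obtain ⟨C, hC, hb⟩ := p.bdd h2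
  obtain ⟨R0, hR0⟩ := (Metric.isBounded_iff_subset_closedBall (0 : FF m)).1 (p.region_bdd h2)
  set R := max R0 1 with hRd
  have hR1 : 0 < R := by positivity
  have hR : {ζ : FF m | 0 < p.s ζ ∧ l2 ≤ p.G ζ} ⊆ Metric.closedBall 0 R := hR0.trans (Metric.closedBall_subset_closedBall (le_max_left _ _))
  obtain ⟨M, hM⟩ := (isCompact_closedBall (0 : FF m) R).exists_bound_of_continuousOn hu.continuousOn
  have hM0 : 0 ≤ M := (norm_nonneg _).trans (hM 0 (by simp [hR1.le]))
  have i1 := (abs_rpow_int (a := -p.a) (by have := p.ha1; linarith) hR1).1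
  rw [neg_neg, intervalIntegrable_iff_integrableOn_Icc_of_le (by linarith)] at i1
  have iY : Integrable (Set.indicator (Set.Icc (-R) R) fun y : ℝ => |y| ^ p.a) := (integrable_indicator_iff measurableSet_Icc).2 i1
  set Y := ∫ y : ℝ, Set.indicator (Set.Icc (-R) R) (fun y : ℝ => |y| ^ p.a) y with hYd
  have hY0 : 0 ≤ Y := integral_nonneg fun y => Set.indicator_nonneg (fun _ _ => by positivity) _
  refine ⟨M * (l1 - l2) * C * 2 ^ (1/5:ℝ) * (2 * √C) ^ m * Y, fun k hk1 => ?_⟩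
  have hk : 0 < k := by linarith
  set ρ := √C * (1 / k) ^ (2/5:ℝ) with hρ
  have hρ0 : 0 ≤ ρ := by positivity
  set E := M * (l1 - l2) * C * (2 * k) ^ (1/5:ℝ) with hE
  have hl : 0 ≤ l1 - l2 := by linarith
  have hE0 : 0 ≤ E := by positivity
  obtain ⟨c1, c2⟩ := cutoff_int' p.t0 hk
  have i3 : Integrable (Set.indicator (Metric.closedBall p.b ρ) fun _ => (1:ℝ)) :=
    (integrable_indicator_iff Metric.isClosed_closedBall.measurableSet).2 (integrableOn_const (isCompact_closedBall _ _).measure_lt_top.ne)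
  have v3 : ∫ x, Set.indicator (Metric.closedBall p.b ρ) (fun _ => (1:ℝ)) x = (2 * ρ) ^ m := by
    rw [integral_indicator_const _ Metric.isClosed_closedBall.measurableSet, measureReal_def, Real.volume_pi_closedBall _ hρ0]
    simp [ENNReal.toReal_ofReal (by positivity : 0 ≤ (2 * ρ) ^ m)]
  have i4 := i3.mul_prod c1
  have v4 := integral_prod_mul (μ := volume) (ν := volume) (Set.indicator (Metric.closedBall p.b ρ) fun _ => (1:ℝ)) (fun t : ℝ => k * Th1 (k * (p.t0 - t)))
  rw [← Measure.volume_eq_prod] at i4 v4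
  have i5 := i4.mul_prod iY
  have v5 := integral_prod_mul (μ := volume) (ν := volume) (fun z : QQ m => Set.indicator (Metric.closedBall p.b ρ) (fun _ => (1:ℝ)) z.1 * (k * Th1 (k * (p.t0 - z.2)))) (Set.indicator (Set.Icc (-R) R) fun y : ℝ => |y| ^ p.a)
  rw [← Measure.volume_eq_prod] at i5 v5
  have key : ‖∫ ζ : FF m, u ζ * (|ζ.2| ^ p.a * (k * Th1 (k * p.s ζ)) * pG k l1 l2 (p.G ζ))‖ ≤ E * ((2 * ρ) ^ m * 1 * Y) := by
    rw [v3, c2] at v4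
    rw [hYd, ← v4, ← v5, ← integral_const_mul]
    refine norm_integral_le_of_norm_le (i5.const_mul E) (Filter.Eventually.of_forall fun ζ => ?_)
    have hT := Th1_nonneg (k * p.s ζ)
    have es : p.t0 - ζ.1.2 = p.s ζ := rfl
    simp only [es]
    have hnn : 0 ≤ E * (Set.indicator (Metric.closedBall p.b ρ) (fun _ => (1:ℝ)) ζ.1.1 * (k * Th1 (k * p.s ζ)) * Set.indicator (Set.Icc (-R) R) (fun y : ℝ => |y| ^ p.a) ζ.2) := by
      have a1 : 0 ≤ Set.indicator (Metric.closedBall p.b ρ) (fun _ => (1:ℝ)) ζ.1.1 := Set.indicator_nonneg (fun _ _ => by positivity) _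
      have a2 : 0 ≤ Set.indicator (Set.Icc (-R) R) (fun y : ℝ => |y| ^ p.a) ζ.2 := Set.indicator_nonneg (fun _ _ => by positivity) _
      positivity
    by_cases hlo : p.s ζ ≤ 1 / (2 * k)
    · rw [Th1_lo (kle hk hlo)] at hnn ⊢; simpa using hnn
    by_cases hhi : 1 ≤ k * p.s ζ
    · rw [Th1_hi hhi] at hnn ⊢; simpa using hnn
    by_cases hG : p.G ζ ≤ l2 * (1 + 1 / (2 * k))
    · rw [pG_zero hk h2 h12 hG]; simpa using hnn
    push Not at hlo hhi hG
    have hs : 0 < p.s ζ := lt_trans (by positivity) hlo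
    have hG' : l2 ≤ p.G ζ := by
      have : 0 < l2 * (1 / (2 * k)) := by positivity
      linarith
    have hs1 : p.s ζ ≤ 1 / k := by rw [le_div_iff₀ hk]; linarith
    obtain ⟨-, b2, b3⟩ := hb ζ hs hG'
    have hζR := hR ⟨hs, hG'⟩
    have hu1 := hM ζ hζR
    rw [mem_closedBall_zero_iff, Prod.norm_def] at hζR
    have h3 : ‖ζ.2‖ ≤ R := (le_max_right _ _).trans hζR
    have h4 : ζ.1.1 ∈ Metric.closedBall p.b ρ := by
      rw [mem_closedBall_iff_norm, pi_norm_le_iff_of_nonneg hρ0]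
      intro i
      have h4 : (p.b i - ζ.1.1 i) ^ 2 ≤ p.DD ζ := by
        have := Finset.single_le_sum (f := fun i => (p.b i - ζ.1.1 i) ^ 2) (fun i _ => sq_nonneg _) (Finset.mem_univ i)
        unfold DD; nlinarith [sq_nonneg (|ζ.2| - |p.x0|)]
      have h5 : p.DD ζ ≤ ρ ^ 2 := by
        rw [hρ, mul_pow, Real.sq_sqrt hC.le, ← Real.rpow_natCast, ← Real.rpow_mul (by positivity)]
        refine b2.trans ?_
        norm_num
        rw [← one_div]
        gcongr
      have := Real.abs_le_sqrt (h4.trans h5)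
      rw [Real.sqrt_sq hρ0] at this
      simp only [Pi.sub_apply, Real.norm_eq_abs]
      rwa [abs_sub_comm]
    rw [Set.indicator_of_mem h4, Set.indicator_of_mem (by simpa [abs_le] using h3)]
    have g1 := pG_le hk h2 h12 hG'
    have g0 := pG_nonneg hk h2 h12 (p.G ζ)
    have g2 : pG k l1 l2 (p.G ζ) ≤ (l1 - l2) * (C * (2 * k) ^ (1/5:ℝ)) := by
      refine g1.trans ?_
      gcongr
      refine b3.trans ?_
      gcongr
      calc p.s ζ ^ (-(1/5):ℝ) ≤ (1 / (2 * k)) ^ (-(1/5):ℝ) := Real.rpow_le_rpow_of_nonpos (by positivity) hlo.le (by norm_num)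
        _ = _ := by rw [one_div, Real.inv_rpow (by positivity), Real.rpow_neg (by positivity), inv_inv]
    rw [norm_mul, Real.norm_of_nonneg (by positivity : 0 ≤ |ζ.2| ^ p.a * (k * Th1 (k * p.s ζ)) * pG k l1 l2 (p.G ζ))]
    calc _ ≤ M * (|ζ.2| ^ p.a * (k * Th1 (k * p.s ζ)) * ((l1 - l2) * (C * (2 * k) ^ (1/5:ℝ)))) := by gcongr
      _ = _ := by rw [hE]; ring
  refine key.trans ?_
  have e1 : (1 / k) ^ (2/5:ℝ) = k ^ (-(2/5):ℝ) := by rw [one_div, Real.inv_rpow hk.le, Real.rpow_neg hk.le]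
  have e2 : (k ^ (-(2/5):ℝ)) ^ m ≤ k ^ (-(2/5):ℝ) := pow_le_of_le_one (by positivity) (Real.rpow_le_one_of_one_le_of_nonpos hk1 (by norm_num)) (by omega)
  have e3 : k ^ (1/5:ℝ) * k ^ (-(2/5):ℝ) = k ^ (-(1/5):ℝ) := by rw [← Real.rpow_add hk]; norm_num
  have e4 : (2 * k) ^ (1/5:ℝ) = 2 ^ (1/5:ℝ) * k ^ (1/5:ℝ) := Real.mul_rpow (by norm_num) hk.le
  rw [hE, hρ, e1, e4, ← e3]
  calc _ = M * (l1 - l2) * C * 2 ^ (1/5:ℝ) * (2 * √C) ^ m * Y * (k ^ (1/5:ℝ) * (k ^ (-(2/5):ℝ)) ^ m) := by rw [← mul_assoc 2, mul_pow]; ring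
    _ ≤ _ := by gcongr
end KP
end

set_option linter.all false
noncomputable section
open Real MeasureTheory
variable {m : ℕ}
namespace KP
variable (p : KP m)
/-- the right-hand side converges -/
lemma rhs_tendsto (hm : 1 ≤ m) {l1 l2 N0 : ℝ} (hN : 1 ≤ N0) (h2 : 0 < l2) (h12 : l2 < l1) {u : FF m → ℝ} (hu : Continuous u) :
    Filter.Tendsto (fun n : ℕ => ∫ ζ : FF m, u ζ * Lst p.a (p.ps ((n:ℝ) + N0) (pG ((n:ℝ) + N0) l1 l2)) ζ) Filter.atTop
      (nhds (l2 * (∫ ζ in p.U l2, u ζ * p.K ζ) - l1 * ∫ ζ in p.U l1, u ζ * p.K ζ)) := by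
  have h1 : 0 < l1 := h2.trans h12
  have hf := kk_tendsto N0
  have hf0 : ∀ n : ℕ, (0:ℝ) < n + N0 := fun n => by linarith [Nat.cast_nonneg (α := ℝ) n]
  have hf1 : ∀ n : ℕ, (1:ℝ) ≤ n + N0 := fun n => by linarith [Nat.cast_nonneg (α := ℝ) n]
  have hsub : p.U l1 ⊆ p.U l2 := fun ζ h => ⟨h.1, h12.trans h.2⟩
  obtain ⟨R, hR⟩ := (Metric.isBounded_iff_subset_closedBall (0 : FF m)).1 (p.region_bdd h2)
  obtain ⟨M, hM⟩ := (isCompact_closedBall (0 : FF m) R).exists_bound_of_continuousOn hu.continuousOn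
  have hM' : ∀ ζ ∈ p.U l2, ‖u ζ‖ ≤ M := fun ζ h => hM ζ (hR ⟨h.1, h.2.le⟩)
  -- integrability of uK
  have iK : ∀ l, l2 ≤ l → IntegrableOn (fun ζ => u ζ * p.K ζ) (p.U l) := fun l hl => by
    refine Integrable.bdd_mul (c := M) (p.K_int (h2.trans_le hl)) hu.aestronglyMeasurable ?_
    rw [ae_restrict_iff' (p.U_open l).measurableSet]
    exact Filter.Eventually.of_forall fun ζ h => hM' ζ ⟨h.1, hl.trans_lt h.2⟩
  obtain ⟨B, hB⟩ := p.bdry_bound hm h2 h12 hu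
  have t1 : Filter.Tendsto (fun n : ℕ => ∫ ζ : FF m, u ζ * (|ζ.2| ^ p.a * (((n:ℝ) + N0) * Th1 (((n:ℝ) + N0) * p.s ζ)) * pG ((n:ℝ) + N0) l1 l2 (p.G ζ)))
      Filter.atTop (nhds 0) := by
    refine squeeze_zero_norm (fun n => hB _ (hf1 n)) ?_
    have := ((tendsto_rpow_neg_atTop (y := 1/5) (by norm_num)).comp hf).const_mul B
    simpa using this
  have eK : ∀ (n : ℕ) (ζ : FF m), u ζ * (Th (((n:ℝ) + N0) * p.s ζ) * pG2 ((n:ℝ) + N0) l1 l2 (p.G ζ) * (|ζ.2| ^ p.a * p.gr ζ)) =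
      Th (((n:ℝ) + N0) * p.s ζ) * (Th (((n:ℝ) + N0) * (p.G ζ / l2 - 1)) * (l2 * (u ζ * p.K ζ))) -
      Th (((n:ℝ) + N0) * p.s ζ) * (Th (((n:ℝ) + N0) * (p.G ζ / l1 - 1)) * (l1 * (u ζ * p.K ζ))) := fun n ζ => by
    unfold pG2
    rw [pj_eq _ _ _ h2, pj_eq _ _ _ h1]; unfold K; ring
  have iP := fun n : ℕ => p.ps_int (hf0 n) (by have := hf0 n; positivity) (prof2 (hf0 n) h2 h12)
  have t2 : Filter.Tendsto (fun n : ℕ => ∫ ζ : FF m, u ζ * (Th (((n:ℝ) + N0) * p.s ζ) * pG2 ((n:ℝ) + N0) l1 l2 (p.G ζ) * (|ζ.2| ^ p.a * p.gr ζ)))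
      Filter.atTop (nhds (l2 * (∫ ζ in p.U l2, u ζ * p.K ζ) - l1 * ∫ ζ in p.U l1, u ζ * p.K ζ)) := by
    have e : l2 * (∫ ζ in p.U l2, u ζ * p.K ζ) - l1 * (∫ ζ in p.U l1, u ζ * p.K ζ) =
        ∫ ζ : FF m, ((p.U l2).indicator (fun ζ => l2 * (u ζ * p.K ζ)) ζ - (p.U l1).indicator (fun ζ => l1 * (u ζ * p.K ζ)) ζ) := by
      rw [integral_sub, integral_indicator (p.U_open _).measurableSet, integral_indicator (p.U_open _).measurableSet, integral_const_mul, integral_const_mul]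
      · exact (integrable_indicator_iff (p.U_open _).measurableSet).2 ((iK l2 le_rfl).const_mul _)
      · exact (integrable_indicator_iff (p.U_open _).measurableSet).2 ((iK l1 h12.le).const_mul _)
    rw [e]
    refine tendsto_integral_of_dominated_convergence ((p.U l2).indicator fun ζ => (l2 + l1) * ‖u ζ * p.K ζ‖) (fun n => hu.aestronglyMeasurable.mul (iP n).1.1) ?_ ?_ ?_
    · exact (integrable_indicator_iff (p.U_open _).measurableSet).2 ((iK l2 le_rfl).norm.const_mul _)
    · intro n
      refine Filter.Eventually.of_forall fun ζ => ?_
      rw [eK]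
      have hz : ∀ l, 0 < l → l2 ≤ l → ζ ∉ p.U l2 → Th (((n:ℝ) + N0) * p.s ζ) * (Th (((n:ℝ) + N0) * (p.G ζ / l - 1)) * (l * (u ζ * p.K ζ))) = 0 := by
        intro l hl hll h
        by_cases hs : 0 < p.s ζ
        · have hG : p.G ζ ≤ l2 := by by_contra hh; exact h ⟨hs, not_le.1 hh⟩
          have h2 : p.G ζ / l - 1 ≤ 0 := by rw [sub_nonpos, div_le_iff₀ hl]; linarith
          rw [Th_zero (s := ((n:ℝ) + N0) * (p.G ζ / l - 1)) ((mul_nonpos_of_nonneg_of_nonpos (hf0 n).le h2).trans (by norm_num))]; ring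
        · rw [Th_zero (s := ((n:ℝ) + N0) * p.s ζ) ((mul_nonpos_of_nonneg_of_nonpos (hf0 n).le (not_lt.1 hs)).trans (by norm_num))]; ring
      by_cases h : ζ ∈ p.U l2
      · rw [Set.indicator_of_mem h]
        have hb : ∀ l, 0 < l → ‖Th (((n:ℝ) + N0) * p.s ζ) * (Th (((n:ℝ) + N0) * (p.G ζ / l - 1)) * (l * (u ζ * p.K ζ)))‖ ≤ l * ‖u ζ * p.K ζ‖ := by
          intro l hl
          rw [norm_mul, norm_mul, norm_mul l, Real.norm_of_nonneg (Th_nonneg _), Real.norm_of_nonneg (Th_nonneg _), Real.norm_of_nonneg hl.le]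
          calc _ ≤ 1 * (1 * (l * ‖u ζ * p.K ζ‖)) := by
                gcongr
                · exact mul_nonneg (Th_nonneg _) (by positivity)
                · exact Th_le _
                · exact Th_le _
            _ = _ := by ring
        refine (norm_sub_le _ _).trans ?_
        linarith [hb l2 h2, hb l1 h1]
      · rw [Set.indicator_of_notMem h, hz l2 h2 le_rfl h, hz l1 h1 h12.le h]; simp
    · refine Filter.Eventually.of_forall fun ζ => ?_
      simp only [eK]
      exact (p.cut_tendsto hf hf0 h2 ζ _).sub (p.cut_tendsto hf hf0 h1 ζ _)
  have t3 := t2.sub t1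
  rw [sub_zero] at t3
  refine t3.congr fun n => ?_
  have iu : ∀ f : FF m → ℝ, Integrable f → (∀ ζ, ζ ∉ p.U l2 → f ζ = 0) → Integrable (fun ζ => u ζ * f ζ) := by
    intro f hfi hz
    refine (hfi.norm.const_mul M).mono' (hu.aestronglyMeasurable.mul hfi.1) (Filter.Eventually.of_forall fun ζ => ?_)
    by_cases h : ζ ∈ p.U l2
    · rw [norm_mul]; gcongr; exact hM' ζ h
    · rw [hz ζ h]; simp
  have hz0 : ∀ ζ, ζ ∉ p.U l2 → ¬ 0 < p.s ζ ∨ p.G ζ ≤ l2 := fun ζ h => by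
    by_contra hh; push Not at hh; exact h ⟨hh.1, hh.2⟩
  have hk := hf0 n
  have hll : l2 ≤ l2 * (1 + 1 / (2 * ((n:ℝ) + N0))) := by
    have : 0 < l2 * (1 / (2 * ((n:ℝ) + N0))) := by positivity
    linarith
  have hP := prof2 hk h2 h12
  have j1 := iu _ (iP n).1 fun ζ h => by
    rcases hz0 ζ h with h | h
    · rw [Th_zero (s := ((n:ℝ) + N0) * p.s ζ) ((mul_nonpos_of_nonneg_of_nonpos hk.le (not_lt.1 h)).trans (by norm_num))]; ring
    · rw [hP.z2 (h.trans hll)]; ring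
  have j2 := iu _ (iP n).2 fun ζ h => by
    rcases hz0 ζ h with h | h
    · rw [Th1_lo (s := ((n:ℝ) + N0) * p.s ζ) ((mul_nonpos_of_nonneg_of_nonpos hk.le (not_lt.1 h)).trans (by norm_num))]; ring
    · rw [hP.z _ (h.trans hll)]; ring
  rw [← integral_sub j1 j2]
  refine integral_congr_ae ?_
  filter_upwards [ae_off_plane] with ζ hy
  rw [p.ps_Lst hk hP hy]; ring

theorem main_FF (hm : 1 ≤ m) {l0 l1 l2 : ℝ} (h2 : 0 < l2) (h12 : l2 < l1) (h01 : l1 < l0) {u : FF m → ℝ} (hu : SubSol p.a (p.U l2) u) :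
    (l1 - l2) * Real.log (l0 / l1) * (∫ ζ in p.U l0, -Lop p.a u ζ) ≤
      l2 * (∫ ζ in p.U l2, u ζ * p.K ζ) - l1 * ∫ ζ in p.U l1, u ζ * p.K ζ := by
  have h1 : 0 < l1 := h2.trans h12
  set N0 := max 1 (l1 / (l0 - l1)) with hN0
  have hN : 1 ≤ N0 := le_max_left _ _
  have hf := kk_tendsto N0
  have hf0 : ∀ n : ℕ, (0:ℝ) < n + N0 := fun n => by linarith [Nat.cast_nonneg (α := ℝ) n]
  have hlk : ∀ n : ℕ, l1 * (1 + 1 / ((n:ℝ) + N0)) ≤ l0 := fun n => by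
    have h3 : l1 / (l0 - l1) ≤ (n:ℝ) + N0 := by
      have : (0:ℝ) ≤ n := n.cast_nonneg
      linarith [le_max_right 1 (l1 / (l0 - l1))]
    rw [div_le_iff₀ (by linarith)] at h3
    have hk := hf0 n
    have : l1 * (1 / ((n:ℝ) + N0)) ≤ l0 - l1 := by
      rw [mul_one_div, div_le_iff₀ hk]; linarith
    linarith
  set c : ℕ → ℝ := fun n => (l1 - l2) * Real.log (l0 / (l1 * (1 + 1 / ((n:ℝ) + N0)))) with hc
  have hc0 : ∀ n, 0 ≤ c n := fun n => by
    have hk := hf0 n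
    refine mul_nonneg (by linarith) (Real.log_nonneg ?_)
    rw [le_div_iff₀ (by positivity)]; linarith [hlk n]
  have hct : Filter.Tendsto c Filter.atTop (nhds ((l1 - l2) * Real.log (l0 / l1))) := by
    have t1 : Filter.Tendsto (fun n : ℕ => 1 / ((n:ℝ) + N0)) Filter.atTop (nhds 0) := by
      simp only [one_div]; exact hf.inv_tendsto_atTop
    have t2 : Filter.Tendsto (fun n : ℕ => l0 / (l1 * (1 + 1 / ((n:ℝ) + N0)))) Filter.atTop (nhds (l0 / (l1 * (1 + 0)))) :=
      tendsto_const_nhds.div (tendsto_const_nhds.mul (tendsto_const_nhds.add t1)) (by simpa using h1.ne')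
    rw [add_zero, mul_one] at t2
    exact tendsto_const_nhds.mul (t2.log (by have : 0 < l0 := by linarith
                                             positivity))
  have hll : ∀ n : ℕ, l2 < l2 * (1 + 1 / (2 * ((n:ℝ) + N0))) := fun n => by
    have hk := hf0 n
    have : 0 < l2 * (1 / (2 * ((n:ℝ) + N0))) := by positivity
    linarith
  have hw := fun n : ℕ => weak_ineq p.ha1 p.ha2 (p.U_open l2) (p.ps_test (hf0 n) h2 (hll n) (prof2 (hf0 n) h2 h12)) hu
  have hsub : p.U l0 ⊆ p.U l2 := fun ζ h => ⟨h.1, by have := h.2; linarith⟩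
  have hU0 := (p.U_open l0).measurableSet
  have hLn : ∀ᵐ ζ : FF m, ζ ∈ p.U l2 → 0 ≤ -Lop p.a u ζ := by
    filter_upwards [ae_off_plane] with ζ hy h
    have := hu.le ζ h hy
    linarith
  -- global nonnegativity
  have hpn : ∀ n : ℕ, 0 ≤ᵐ[volume] fun ζ => p.ps ((n:ℝ) + N0) (pG ((n:ℝ) + N0) l1 l2) ζ * (-Lop p.a u ζ) := fun n => by
    filter_upwards [hLn] with ζ h
    by_cases hz : ζ ∈ p.U l2
    · exact mul_nonneg (mul_nonneg (Th_nonneg _) (pG_nonneg (hf0 n) h2 h12 _)) (h hz)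
    · have : p.ps ((n:ℝ) + N0) (pG ((n:ℝ) + N0) l1 l2) ζ = 0 := by
        by_contra hh
        exact hz ((p.ps_test (hf0 n) h2 (hll n) (prof2 (hf0 n) h2 h12)).sub (subset_tsupport _ hh))
      simp [this]
  have hge : ∀ (n : ℕ), ∀ ζ ∈ p.U l0, c n ≤ pG ((n:ℝ) + N0) l1 l2 (p.G ζ) := fun n ζ hz =>
    (pG_ge (hf0 n) h2 h12 (hlk n)).trans (pG_mono (hf0 n) h2 h12 hz.2.le)
  set f : ℕ → FF m → ℝ := fun n ζ => c n / pG ((n:ℝ) + N0) l1 l2 (p.G ζ) * (p.ps ((n:ℝ) + N0) (pG ((n:ℝ) + N0) l1 l2) ζ * (-Lop p.a u ζ)) with hfd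
  have hr : ∀ (n : ℕ), ∀ ζ ∈ p.U l0, 0 ≤ c n / pG ((n:ℝ) + N0) l1 l2 (p.G ζ) ∧ c n / pG ((n:ℝ) + N0) l1 l2 (p.G ζ) ≤ 1 := fun n ζ hz => by
    have h3 := hge n ζ hz
    have h4 := hc0 n
    exact ⟨div_nonneg h4 (h4.trans h3), div_le_one_of_le₀ h3 (h4.trans h3)⟩
  have hfi : ∀ n, Integrable (f n) (volume.restrict (p.U l0)) := fun n => by
    refine Integrable.bdd_mul (c := 1) (hw n).1.restrict ?_ ?_
    · have hG : AEMeasurable p.G (volume.restrict (p.U l0)) := 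
        (ContinuousOn.aemeasurable (fun ζ hz => (p.G_ca hz.1).continuousWithinAt) hU0)
      have hp : Measurable (pG ((n:ℝ) + N0) l1 l2) := (prof2 (hf0 n) h2 h12).cd.continuous.measurable
      exact ((hp.comp_aemeasurable hG).const_div (c n)).aestronglyMeasurable
    · rw [ae_restrict_iff' hU0]
      refine Filter.Eventually.of_forall fun ζ hz => ?_
      rw [Real.norm_of_nonneg (hr n ζ hz).1]
      exact (hr n ζ hz).2
  have hfat := fatou_int (μ := volume.restrict (p.U l0)) (f := f) (F := fun ζ => (l1 - l2) * Real.log (l0 / l1) * (-Lop p.a u ζ))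
    (c := fun n : ℕ => ∫ ζ : FF m, u ζ * Lst p.a (p.ps ((n:ℝ) + N0) (pG ((n:ℝ) + N0) l1 l2)) ζ) hfi ?_ ?_ ?_ (p.rhs_tendsto hm hN h2 h12 hu.cont)
  · have := hfat.2
    rwa [integral_const_mul] at this
  · intro n
    filter_upwards [ae_restrict_mem hU0, ae_restrict_of_ae (hpn n)] with ζ hz hh
    exact mul_nonneg (hr n ζ hz).1 hh
  · filter_upwards [ae_restrict_mem hU0] with ζ hz
    have hcp : 0 < (l1 - l2) * Real.log (l0 / l1) := mul_pos (by linarith) (Real.log_pos (by rw [lt_div_iff₀ h1]; linarith))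
    refine (hct.mul_const (-Lop p.a u ζ)).congr' ?_
    filter_upwards [hct.eventually (lt_mem_nhds hcp), Th_ev hf hz.1] with n h5 h6
    have h7 := hge n ζ hz
    have h8 : pG ((n:ℝ) + N0) l1 l2 (p.G ζ) ≠ 0 := by linarith
    simp only [hfd, ps, h6]
    field_simp
  · intro n
    refine le_trans ?_ (hw n).2
    calc ∫ ζ in p.U l0, f n ζ ≤ ∫ ζ in p.U l0, p.ps ((n:ℝ) + N0) (pG ((n:ℝ) + N0) l1 l2) ζ * (-Lop p.a u ζ) := by
          refine integral_mono_ae (hfi n) (hw n).1.restrict ?_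
          filter_upwards [ae_restrict_mem hU0, ae_restrict_of_ae (hpn n)] with ζ hz hh
          exact mul_le_of_le_one_left hh (hr n ζ hz).2
      _ ≤ _ := setIntegral_le_integral (hw n).1 (hpn n)
end KP
end

set_option linter.all false
noncomputable section
open Real MeasureTheory
variable {m : ℕ}

/-! ### Part 24: transport to the original coordinates -/

abbrev EE (m : ℕ) := (Fin (m + 1) → ℝ) × ℝ

def pr (X : Fin (m + 1) → ℝ) (t : ℝ) : FF m := ((fun i => X i.castSucc, t), X (Fin.last m))
def emb (ζ : FF m) : EE m := (Fin.snoc (α := fun _ => ℝ) ζ.1.1 ζ.2, ζ.1.2)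

lemma pr_emb (ζ : FF m) : pr (emb ζ).1 (emb ζ).2 = ζ := by
  simp [pr, emb]

lemma emb_pr (X : Fin (m + 1) → ℝ) (t : ℝ) : emb (pr X t) = (X, t) := by
  simp only [pr, emb, Prod.mk.injEq, and_true]
  funext i
  refine Fin.lastCases ?_ (fun j => ?_) i <;> simp

def PE (m : ℕ) : EE m ≃ᵐ FF m :=
  ((MeasurableEquiv.piFinSuccAbove (fun _ => ℝ) (Fin.last m)).prodCongr (MeasurableEquiv.refl ℝ)).trans
    (MeasurableEquiv.prodAssoc.trans MeasurableEquiv.prodComm)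

lemma PE_apply (ξ : EE m) : PE m ξ = pr ξ.1 ξ.2 := by
  refine Prod.ext (Prod.ext ?_ rfl) rfl
  funext i
  show ξ.1 ((Fin.last m).succAbove i) = _
  simp [pr]

lemma PE_mp : MeasurePreserving (PE m) := by
  have h1 : MeasurePreserving (MeasurableEquiv.piFinSuccAbove (fun _ => ℝ) (Fin.last m)) :=
    volume_preserving_piFinSuccAbove (fun _ : Fin (m + 1) => ℝ) (Fin.last m)
  have h2 := h1.prod (MeasurePreserving.id (volume : Measure ℝ))
  have h3 := volume_preserving_prodAssoc (α₁ := ℝ) (β₁ := Fin m → ℝ) (γ₁ := ℝ)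
  have h4 := Measure.measurePreserving_swap (μ := (volume : Measure ℝ)) (ν := (volume : Measure ((Fin m → ℝ) × ℝ)))
  exact h4.comp (h3.comp h2)

lemma int_transport (g : FF m → ℝ) (U : Set (FF m)) :
    ∫ ξ in {ξ : EE m | pr ξ.1 ξ.2 ∈ U}, g (pr ξ.1 ξ.2) = ∫ ζ in U, g ζ := by
  rw [← PE_mp.setIntegral_preimage_emb (PE m).measurableEmbedding g U]
  have : (PE m) ⁻¹' U = {ξ : EE m | pr ξ.1 ξ.2 ∈ U} := by
    ext ξ; simp [PE_apply]
  rw [this]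
  simp only [PE_apply]

lemma ae_transport {P : FF m → Prop} (h : ∀ᵐ ζ : FF m, P ζ) : ∀ᵐ ξ : EE m, P (pr ξ.1 ξ.2) := by
  have := PE_mp.quasiMeasurePreserving.ae h
  simpa only [PE_apply] using this

/-! derivatives -/
lemma pr_castSucc (X : Fin (m + 1) → ℝ) (t : ℝ) (j : Fin m) (s : ℝ) :
    pr (Function.update X j.castSucc s) t = pr X t + (s - X j.castSucc) • dI j := by
  refine Prod.ext (Prod.ext ?_ ?_) ?_
  · funext i
    by_cases h : i = j
    · subst h; simp [pr, dI]
    · have : i.castSucc ≠ j.castSucc := fun e => h (Fin.castSucc_injective _ e)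
      simp [pr, dI, Function.update_of_ne this, h]
  · simp [pr, dI]
  · have : Fin.last m ≠ j.castSucc := (Fin.castSucc_lt_last j).ne'
    simp [pr, dI, Function.update_of_ne this]

lemma pr_last (X : Fin (m + 1) → ℝ) (t : ℝ) (s : ℝ) :
    pr (Function.update X (Fin.last m) s) t = pr X t + (s - X (Fin.last m)) • dY := by
  refine Prod.ext (Prod.ext ?_ ?_) ?_
  · funext i
    have : i.castSucc ≠ Fin.last m := (Fin.castSucc_lt_last i).ne
    simp [pr, dY, Function.update_of_ne this]
  · simp [pr, dY]
  · simp [pr, dY]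

lemma pr_time (X : Fin (m + 1) → ℝ) (t s : ℝ) : pr X s = pr X t + (s - t) • dT := by
  refine Prod.ext (Prod.ext ?_ ?_) ?_ <;> simp [pr, dT]

lemma deriv_shift {w : FF m → ℝ} {ζ d : FF m} (h : DifferentiableAt ℝ w ζ) (c : ℝ) :
    deriv (fun s : ℝ => w (ζ + (s - c) • d)) c = dd d w ζ := by
  have h0 := hasDerivAt_line (f := w) (x := ζ) (d := d) (s := c - c) (by simpa using h)
  have h1 := h0.comp (h := fun s : ℝ => s - c) c ((hasDerivAt_id c).sub_const c)
  have h2 := h1.deriv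
  simp only [sub_self, zero_smul, add_zero, mul_one] at h2
  exact h2

lemma pd_castSucc {w : FF m → ℝ} {X : Fin (m + 1) → ℝ} {t : ℝ} (h : DifferentiableAt ℝ w (pr X t)) (j : Fin m) :
    pd j.castSucc (fun Z => w (pr Z t)) X = dd (dI j) w (pr X t) := by
  unfold pd
  simp only [pr_castSucc]
  exact deriv_shift h _

lemma pd_last {w : FF m → ℝ} {X : Fin (m + 1) → ℝ} {t : ℝ} (h : DifferentiableAt ℝ w (pr X t)) :
    pd (Fin.last m) (fun Z => w (pr Z t)) X = dd dY w (pr X t) := by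
  unfold pd
  simp only [pr_last]
  exact deriv_shift h _

lemma pd_congr {n : ℕ} {f g : (Fin n → ℝ) → ℝ} {X : Fin n → ℝ} (i : Fin n) (h : f =ᶠ[nhds X] g) : pd i f X = pd i g X := by
  unfold pd
  refine Filter.EventuallyEq.deriv_eq ?_
  have hc : ContinuousAt (fun s : ℝ => Function.update X i s) (X i) :=
    (continuous_const.update i continuous_id).continuousAt
  have : Filter.Tendsto (fun s : ℝ => Function.update X i s) (nhds (X i)) (nhds X) := by
    have h0 := hc.tendsto
    rwa [Function.update_eq_self] at h0
  exact this.eventually h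

lemma ev_ne {X : Fin (m + 1) → ℝ} (h : X (Fin.last m) ≠ 0) : ∀ᶠ Z in nhds X, Z (Fin.last m) ≠ 0 :=
  (continuous_apply (Fin.last m)).continuousAt.eventually_ne h

lemma Lau_eq {a : ℝ} {w : FF m → ℝ} (hw : ∀ ζ : FF m, ζ.2 ≠ 0 → ContDiffAt ℝ 2 w ζ) {u : (Fin (m + 1) → ℝ) → ℝ → ℝ}
    (hu : ∀ X t, u X t = w (pr X t)) {X : Fin (m + 1) → ℝ} {t : ℝ} (hX : X (Fin.last m) ≠ 0) :
    Lau a m u X t = Lop a w (pr X t) := by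
  have hu' : u = fun X t => w (pr X t) := by funext X t; exact hu X t
  subst hu'
  have hd : ∀ Z : Fin (m + 1) → ℝ, Z (Fin.last m) ≠ 0 → DifferentiableAt ℝ w (pr Z t) := fun Z hZ => cdAt_da (hw _ hZ)
  have e1 : ∀ j : Fin m, pd j.castSucc (pd j.castSucc (fun Z => w (pr Z t))) X = dd (dI j) (dd (dI j) w) (pr X t) := by
    intro j
    rw [pd_congr (g := fun Z => dd (dI j) w (pr Z t)) _ ((ev_ne hX).mono fun Z hZ => pd_castSucc (hd Z hZ) j)]
    exact pd_castSucc (cdAt_dda (hw _ hX) _) j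
  have e2 : pd (Fin.last m) (pd (Fin.last m) (fun Z => w (pr Z t))) X = dd dY (dd dY w) (pr X t) := by
    rw [pd_congr (g := fun Z => dd dY w (pr Z t)) _ ((ev_ne hX).mono fun Z hZ => pd_last (hd Z hZ))]
    exact pd_last (cdAt_dda (hw _ hX) _)
  have e3 : deriv (fun s => w (pr X s)) t = dd dT w (pr X t) := by
    rw [← deriv_shift (hd X hX) t]
    congr 1; funext s; rw [pr_time X t s]
  unfold Lau Lop
  rw [Fin.sum_univ_castSucc]
  simp only [e1, e2, e3]
  rw [pd_last (hd X hX)]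
  simp only [pr]
  ring

lemma emb_cd : ContDiff ℝ 2 (emb (m := m)) := by
  refine ContDiff.prodMk ?_ (by fun_prop)
  rw [contDiff_pi]
  intro i
  refine Fin.lastCases ?_ (fun j => ?_) i
  · simp only [Fin.snoc_last]; fun_prop
  · simp only [Fin.snoc_castSucc]; fun_prop

lemma sub_of_memHa {a : ℝ} (ha : a < 1) {u : (Fin (m + 1) → ℝ) → ℝ → ℝ} (hu : memHa a m u) {U : Set (FF m)}
    (hU : ∀ ξ : EE m, pr ξ.1 ξ.2 ∈ U → Lau a m u ξ.1 ξ.2 ≤ 0) : SubSol a U (fun ζ => u (emb ζ).1 (emb ζ).2) := by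
  obtain ⟨c1, c2, c3⟩ := hu
  have hcont : Continuous (fun ζ : FF m => u (emb ζ).1 (emb ζ).2) := c1.comp emb_cd.continuous
  have hcd : ∀ ζ : FF m, ζ.2 ≠ 0 → ContDiffAt ℝ 2 (fun ζ : FF m => u (emb ζ).1 (emb ζ).2) ζ := fun ζ h => by
    have := c2 (emb ζ).1 (emb ζ).2 (by simpa [emb] using h)
    exact ContDiffAt.comp (g := fun p : EE m => u p.1 p.2) (f := emb) ζ this emb_cd.contDiffAt
  have hu : ∀ X t, u X t = (fun ζ : FF m => u (emb ζ).1 (emb ζ).2) (pr X t) := fun X t => by simp only [emb_pr]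
  refine ⟨hcont, hcd, fun q => ?_, fun ζ hζ hy => ?_⟩
  · obtain ⟨L, t1, t2⟩ := c3 (emb (q, 0)).1 q.2
    have key : ∀ y : ℝ, y ≠ 0 → |y| ^ a * pd (Fin.last m) (fun Z => u Z q.2) (Function.update (emb (q, 0)).1 (Fin.last m) y) =
        |y| ^ a * dd dY (fun ζ : FF m => u (emb ζ).1 (emb ζ).2) (q, y) := fun y hy => by
      have e : pr (Function.update (emb (q, 0)).1 (Fin.last m) y) q.2 = (q, y) := by
        rw [pr_last]
        have : pr (emb ((q, 0) : FF m)).1 q.2 = (q, 0) := pr_emb ((q, 0) : FF m)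
        rw [this]
        refine Prod.ext (Prod.ext ?_ ?_) ?_ <;> simp [dY, emb]
      have h1 := pd_last (w := fun ζ : FF m => u (emb ζ).1 (emb ζ).2) (X := Function.update (emb (q, 0)).1 (Fin.last m) y) (t := q.2)
        (by rw [e]; exact cdAt_da (hcd _ hy))
      rw [e] at h1
      simp only [emb_pr] at h1
      rw [h1]
    refine symSmall_of_flux ha hcont (fun ζ h => cdAt_da (hcd ζ h)) q L ?_ ?_
    · refine t1.congr' ?_
      filter_upwards [self_mem_nhdsWithin] with y hy using key y (ne_of_gt hy)
    · refine t2.congr' ?_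
      filter_upwards [self_mem_nhdsWithin] with y hy using key y (ne_of_lt hy)
  · have := hU (emb ζ) (by rw [pr_emb]; exact hζ)
    rw [Lau_eq hcd hu (by simpa [emb] using hy), pr_emb] at this
    exact this
end

set_option linter.all false
noncomputable section
open Real MeasureTheory
variable {m : ℕ}

/-! ### Part 25: identification of the kernel and conclusion -/

lemma Pc_of_series (c z : ℝ) (g : ℕ → ℝ) (hg : ∀ k, g k = (k:ℝ) + c) :
    ∑' k : ℕ, (z / 4) ^ (2 * k) / ((Nat.factorial k : ℝ) * Real.Gamma (g k)) = Pc c (z ^ 2 / 16) := by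
  unfold Pc pt
  refine tsum_congr fun k => ?_
  rw [hg k, pow_mul, show (z / 4) ^ 2 = z ^ 2 / 16 by ring]
  ring

lemma Fker_eq (a z : ℝ) : Fker a z = Real.exp (-z / 2) * (Pc ((1 + a) / 2) (z ^ 2 / 16) + sg a (z / 4) * Pc ((3 - a) / 2) (z ^ 2 / 16)) := by
  unfold Fker
  rw [Pc_of_series ((1 + a) / 2) z _ (fun k => by ring), Pc_of_series ((3 - a) / 2) z _ (fun k => by ring)]
  rfl

lemma sg_prod {a x y s : ℝ} (hs : 0 < s) : sg a (x * y / s / 4) = sg a (x / 4) * sg a y * s ^ (a - 1) := by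
  unfold sg
  rw [show x * y / s / 4 = (x / 4) * y * s⁻¹ by ring, abs_mul, abs_mul, Real.mul_rpow (by positivity) (by positivity),
    Real.mul_rpow (by positivity) (by positivity), abs_of_pos (inv_pos.2 hs), Real.inv_rpow hs.le, Real.rpow_neg hs.le a, inv_inv,
    Real.rpow_sub_one hs.ne']
  field_simp

def kp0 (a : ℝ) (ha1 : -1 < a) (ha2 : a < 1) (X0 : Fin (m + 1) → ℝ) (t0 : ℝ) : KP m where
  a := a
  x0 := X0 (Fin.last m)
  t0 := t0
  b := fun i => X0 i.castSucc
  c0 := 2 ^ (-1 - a) * (4 * π) ^ (-(m : ℝ) / 2)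
  kp := sg a (X0 (Fin.last m) / 4)
  ha1 := ha1
  ha2 := ha2
  hc0 := by positivity
  hkp := sg_abs ha2

lemma kern_eq {a : ℝ} (ha1 : -1 < a) (ha2 : a < 1) (X0 : Fin (m + 1) → ℝ) {t0 τ : ℝ} (h : τ < t0) (Y : Fin (m + 1) → ℝ) :
    GammaFS a m X0 t0 Y τ = (kp0 a ha1 ha2 X0 t0).G (pr Y τ) := by
  have hs : 0 < t0 - τ := sub_pos.2 h
  simp only [KP.G, KP.F1, KP.F2, Phi, ph, kp0, sv, Rv, pr, GammaFS, if_pos h, Fker_eq, sg_prod hs]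
  rw [Fin.sum_univ_castSucc]
  set s := t0 - τ
  set x := X0 (Fin.last m)
  set y := Y (Fin.last m)
  set S := ∑ i : Fin m, (X0 i.castSucc - Y i.castSucc) ^ 2
  have e1 : (x * y / s) ^ 2 / 16 = x ^ 2 * y ^ 2 / (16 * s ^ 2) := by field_simp
  have e2 : Real.exp (-(S + x ^ 2 + y ^ 2) / (4 * s)) = Real.exp (-(S + (x - y) ^ 2) / (4 * s)) * Real.exp (-(x * y / s) / 2) := by
    rw [← Real.exp_add]; congr 1; field_simp; ring
  have e3 : s ^ (-((m:ℝ) / 2 + (1 + a) / 2)) = s ^ (-((m : ℝ) + 1 + a) / 2) := by congr 1; ring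
  have e4 : s ^ (-((m:ℝ) / 2 + (3 - a) / 2)) = s ^ (-((m : ℝ) + 1 + a) / 2) * s ^ (a - 1) := by
    rw [← Real.rpow_add hs]; congr 1; ring
  rw [e1, e2, e3, e4]
  ring

lemma phiw_pos {a x ρ : ℝ} (h : 0 < ρ) : 0 < phiw a m x ρ := by
  unfold phiw
  have : 0 < 1 + x ^ 2 / ρ := by positivity
  positivity

lemma phiw_log {a x ρ : ℝ} (h : 0 < ρ) : Real.log (phiw a m x ρ) =
    ((m:ℝ) + 1 + a) / 2 * Real.log (4 * π * ρ) + a / 2 * Real.log (1 + x ^ 2 / ρ) := by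
  unfold phiw
  have h1 : 0 < 1 + x ^ 2 / ρ := by positivity
  have h2 : 0 < 4 * π * ρ := by positivity
  rw [Real.log_mul (by positivity) (by positivity), Real.log_rpow h2, Real.log_rpow h1]

lemma phiw_step {a x ρ α : ℝ} (ha1 : -1 < a) (h : 0 < ρ) (hα : 1 < α) :
    (m:ℝ) / 2 * Real.log α ≤ Real.log (phiw a m x (α * ρ)) - Real.log (phiw a m x ρ) := by
  have hα0 : 0 < α := by linarith
  have hL : 0 < Real.log α := Real.log_pos hα
  rw [phiw_log h, phiw_log (by positivity)]
  have e : Real.log (4 * π * (α * ρ)) = Real.log α + Real.log (4 * π * ρ) := by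
    rw [← Real.log_mul (by positivity) (by positivity)]; congr 1; ring
  have d1 : Real.log (1 + x ^ 2 / (α * ρ)) ≤ Real.log (1 + x ^ 2 / ρ) := by
    refine Real.log_le_log (by positivity) ?_
    have : x ^ 2 / (α * ρ) ≤ x ^ 2 / ρ := by
      refine div_le_div_of_nonneg_left (by positivity) h ?_
      nlinarith
    linarith
  have d2 : Real.log (1 + x ^ 2 / ρ) ≤ Real.log α + Real.log (1 + x ^ 2 / (α * ρ)) := by
    rw [← Real.log_mul (by positivity) (by positivity)]
    refine Real.log_le_log (by positivity) ?_
    have : α * (1 + x ^ 2 / (α * ρ)) = α + x ^ 2 / ρ := by field_simp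
    linarith
  rw [e]
  generalize Real.log (1 + x ^ 2 / (α * ρ)) = A at *
  generalize Real.log (1 + x ^ 2 / ρ) = B at *
  generalize Real.log α = L at *
  have hm0 : (0:ℝ) ≤ m := Nat.cast_nonneg m
  by_cases h0 : 0 ≤ a
  · have := mul_nonneg h0 (by linarith : 0 ≤ L + A - B)
    nlinarith
  · have := mul_nonneg (by linarith : 0 ≤ -a) (by linarith : 0 ≤ B - A)
    nlinarith

lemma pball_eq {a : ℝ} (ha1 : -1 < a) (ha2 : a < 1) (X0 : Fin (m + 1) → ℝ) (t0 : ℝ) {ρ : ℝ} (hρ : 0 < ρ) :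
    pball a m X0 t0 ρ = {ξ : EE m | pr ξ.1 ξ.2 ∈ (kp0 a ha1 ha2 X0 t0).U (phiw a m (X0 (Fin.last m)) ρ)⁻¹} := by
  have hp := inv_pos.2 (phiw_pos (a := a) (m := m) (x := X0 (Fin.last m)) hρ)
  ext ξ
  simp only [pball, Set.mem_setOf_eq, KP.U]
  have es : (kp0 a ha1 ha2 X0 t0).s (pr ξ.1 ξ.2) = t0 - ξ.2 := rfl
  by_cases h : ξ.2 < t0
  · rw [kern_eq ha1 ha2 X0 h, es]
    exact ⟨fun h1 => ⟨sub_pos.2 h, h1⟩, fun h1 => h1.2⟩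
  · rw [es]
    constructor
    · intro h1
      simp only [GammaFS, if_neg h] at h1
      linarith
    · rintro ⟨h1, _⟩
      exact absurd (sub_pos.1 h1) h

lemma pball_meas {a : ℝ} (ha1 : -1 < a) (ha2 : a < 1) (X0 : Fin (m + 1) → ℝ) (t0 : ℝ) {ρ : ℝ} (hρ : 0 < ρ) :
    MeasurableSet (pball a m X0 t0 ρ) := by
  rw [pball_eq ha1 ha2 X0 t0 hρ]
  have := (PE m).measurable (((kp0 a ha1 ha2 X0 t0).U_open (phiw a m (X0 (Fin.last m)) ρ)⁻¹).measurableSet)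
  convert this using 1
  ext ξ
  simp [PE_apply]

lemma mval_eq {a : ℝ} (ha1 : -1 < a) (ha2 : a < 1) (X0 : Fin (m + 1) → ℝ) (t0 : ℝ) {ρ : ℝ} (hρ : 0 < ρ)
    (u : (Fin (m + 1) → ℝ) → ℝ → ℝ) :
    mval a m u X0 t0 ρ = (phiw a m (X0 (Fin.last m)) ρ)⁻¹ *
      ∫ ζ in (kp0 a ha1 ha2 X0 t0).U (phiw a m (X0 (Fin.last m)) ρ)⁻¹, (u (emb ζ).1 (emb ζ).2) * (kp0 a ha1 ha2 X0 t0).K ζ := by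
  unfold mval
  congr 1
  rw [← int_transport, ← pball_eq ha1 ha2 X0 t0 hρ]
  refine setIntegral_congr_ae (pball_meas ha1 ha2 X0 t0 hρ) ?_
  filter_upwards [ae_transport ae_off_plane] with ξ hy hξ
  rw [pball_eq ha1 ha2 X0 t0 hρ] at hξ
  have hs : 0 < (kp0 a ha1 ha2 X0 t0).s (pr ξ.1 ξ.2) := hξ.1
  have ht : ξ.2 < t0 := sub_pos.1 hs
  have hd := cdAt_da ((kp0 a ha1 ha2 X0 t0).G_cd hs hy)
  have e : (fun Y => GammaFS a m X0 t0 Y ξ.2) = fun Y => (kp0 a ha1 ha2 X0 t0).G (pr Y ξ.2) := by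
    funext Y; exact kern_eq ha1 ha2 X0 ht Y
  rw [e, kern_eq ha1 ha2 X0 ht, Fin.sum_univ_castSucc, pd_last hd]
  simp only [pd_castSucc hd, emb_pr, KP.K, KP.gr]
  have e1 : (kp0 a ha1 ha2 X0 t0).a = a := rfl
  have e2 : (pr ξ.1 ξ.2).2 = ξ.1 (Fin.last m) := rfl
  rw [e1, e2]
  ring

lemma Lint_eq {a : ℝ} (ha1 : -1 < a) (ha2 : a < 1) (X0 : Fin (m + 1) → ℝ) (t0 : ℝ) {ρ : ℝ} (hρ : 0 < ρ)
    {u : (Fin (m + 1) → ℝ) → ℝ → ℝ} (hcd : ∀ ζ : FF m, ζ.2 ≠ 0 → ContDiffAt ℝ 2 (fun ζ : FF m => u (emb ζ).1 (emb ζ).2) ζ) :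
    ∫ ξ in pball a m X0 t0 ρ, -Lau a m u ξ.1 ξ.2 =
      ∫ ζ in (kp0 a ha1 ha2 X0 t0).U (phiw a m (X0 (Fin.last m)) ρ)⁻¹, -Lop a (fun ζ => u (emb ζ).1 (emb ζ).2) ζ := by
  rw [← int_transport (fun ζ => -Lop a (fun ζ => u (emb ζ).1 (emb ζ).2) ζ), ← pball_eq ha1 ha2 X0 t0 hρ]
  refine setIntegral_congr_ae (pball_meas ha1 ha2 X0 t0 hρ) ?_
  filter_upwards [ae_transport ae_off_plane] with ξ hy hξ
  rw [Lau_eq hcd (fun X t => by simp only [emb_pr]) hy]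

theorem mean_value_gap_aux (a : ℝ) (ha₁ : -1 < a) (ha₂ : a < 1) (m : ℕ) (hm : 1 ≤ m)
    (α : ℝ) (hα : 1 < α) :
    ∃ C : ℝ, 0 < C ∧
      ∀ (X₀ : Fin (m + 1) → ℝ) (t₀ r : ℝ), 0 < r →
        ∀ u : (Fin (m + 1) → ℝ) → ℝ → ℝ, memHa a m u →
          (∀ ζ ∈ pball a m X₀ t₀ (α ^ 2 * r), Lau a m u ζ.1 ζ.2 ≤ 0) →
          C * ((phiw a m (X₀ (Fin.last m)) (α * r))⁻¹ -
                (phiw a m (X₀ (Fin.last m)) (α ^ 2 * r))⁻¹) *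
              (∫ ζ in pball a m X₀ t₀ r, -Lau a m u ζ.1 ζ.2) ≤
            mval a m u X₀ t₀ (α ^ 2 * r) - mval a m u X₀ t₀ (α * r) := by
  have hα0 : 0 < α := by linarith
  have hm0 : (0:ℝ) < m := by exact_mod_cast hm
  have hC : 0 < (m:ℝ) / 2 * Real.log α := mul_pos (by positivity) (Real.log_pos hα)
  refine ⟨(m:ℝ) / 2 * Real.log α, hC, fun X₀ t₀ r hr u hu hL => ?_⟩
  have hr1 : 0 < α * r := by positivity
  have hr2 : 0 < α ^ 2 * r := by positivity
  have s0 := phiw_step (m := m) (x := X₀ (Fin.last m)) ha₁ hr hα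
  have s1 := phiw_step (m := m) (x := X₀ (Fin.last m)) ha₁ hr1 hα
  rw [show α * (α * r) = α ^ 2 * r by ring] at s1
  have p0 := phiw_pos (a := a) (m := m) (x := X₀ (Fin.last m)) hr
  have p1 := phiw_pos (a := a) (m := m) (x := X₀ (Fin.last m)) hr1
  have p2 := phiw_pos (a := a) (m := m) (x := X₀ (Fin.last m)) hr2
  have l01 : phiw a m (X₀ (Fin.last m)) r < phiw a m (X₀ (Fin.last m)) (α * r) := (Real.log_lt_log_iff p0 p1).1 (by linarith)
  have l12 : phiw a m (X₀ (Fin.last m)) (α * r) < phiw a m (X₀ (Fin.last m)) (α ^ 2 * r) := (Real.log_lt_log_iff p1 p2).1 (by linarith)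
  have i01 := inv_strictAnti₀ p0 l01
  have i12 := inv_strictAnti₀ p1 l12
  have hsub : SubSol (kp0 a ha₁ ha₂ X₀ t₀).a ((kp0 a ha₁ ha₂ X₀ t₀).U (phiw a m (X₀ (Fin.last m)) (α ^ 2 * r))⁻¹)
      (fun ζ => u (emb ζ).1 (emb ζ).2) := by
    refine sub_of_memHa ha₂ hu fun ξ hξ => hL ξ ?_
    rw [pball_eq ha₁ ha₂ X₀ t₀ hr2]; exact hξ
  have main := (kp0 a ha₁ ha₂ X₀ t₀).main_FF hm (inv_pos.2 p2) i12 i01 hsub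
  rw [mval_eq ha₁ ha₂ X₀ t₀ hr2, mval_eq ha₁ ha₂ X₀ t₀ hr1]
  refine le_trans ?_ main
  have hI := Lint_eq ha₁ ha₂ X₀ t₀ hr hsub.cd
  have ea : (kp0 a ha₁ ha₂ X₀ t₀).a = a := rfl
  rw [ea, ← hI]
  have hI0 : 0 ≤ ∫ ζ in pball a m X₀ t₀ r, -Lau a m u ζ.1 ζ.2 := by
    refine setIntegral_nonneg (pball_meas ha₁ ha₂ X₀ t₀ hr) fun ξ hξ => ?_
    have : ξ ∈ pball a m X₀ t₀ (α ^ 2 * r) := (i12.trans i01).trans hξ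
    linarith [hL ξ this]
  refine mul_le_mul_of_nonneg_right ?_ hI0
  rw [mul_comm]
  refine mul_le_mul_of_nonneg_left ?_ (by linarith)
  rw [Real.log_div (inv_pos.2 p0).ne' (inv_pos.2 p1).ne', Real.log_inv, Real.log_inv]
  linarith
end

/-- Monotonicity gap of the mean values for supersolutions: there is `C = C(n,α,a) > 0`
such that whenever `u ∈ 𝓗_a` satisfies `𝓛_a u ≤ 0` in `Ω_{α²r}(ξ₀)`,
`u_{α²r}(ξ₀) - u_{αr}(ξ₀) ≥ C (φ(αr)⁻¹ - φ(α²r)⁻¹) ∫_{Ω_r(ξ₀)} (-𝓛_a u) dY dt`. -/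
theorem mean_value_gap (a : ℝ) (ha₁ : -1 < a) (ha₂ : a < 1) (m : ℕ) (hm : 1 ≤ m)
    (α : ℝ) (hα : 1 < α) :
    ∃ C : ℝ, 0 < C ∧
      ∀ (X₀ : Fin (m + 1) → ℝ) (t₀ r : ℝ), 0 < r →
        ∀ u : (Fin (m + 1) → ℝ) → ℝ → ℝ, memHa a m u →
          (∀ ζ ∈ pball a m X₀ t₀ (α ^ 2 * r), Lau a m u ζ.1 ζ.2 ≤ 0) →
          C * ((phiw a m (X₀ (Fin.last m)) (α * r))⁻¹ -
                (phiw a m (X₀ (Fin.last m)) (α ^ 2 * r))⁻¹) *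
              (∫ ζ in pball a m X₀ t₀ r, -Lau a m u ζ.1 ζ.2) ≤
            mval a m u X₀ t₀ (α ^ 2 * r) - mval a m u X₀ t₀ (α * r) := by
  exact mean_value_gap_aux a ha₁ ha₂ m hm α hα
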